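/- There exists an absolute constant c > 0 with the following property. For all integers n, k, d with 2 ≤ k ≤ log₂ log₂ n and 1 ≤ d ≤ log₂ k, every monotone AC⁰ formula on kn² variables that has ⋀-depth at most d and ⋀-fan-in at most n^{1/k} and that computes SUB-PMM_{n,k} has size at least n^{c · d · k^{1/d}}. -/

import Mathlib

/-- Unbounded fan-in `AC⁰` formulas over a set `ι` of variables: leaves are constants or
literals (a variable together with a sign, `true` = positive), and gates are `⋀`s or `⋁`s
of finite lists of subformulas. -/
inductive AC0 (ι : Type) where
  | const : Bool → AC0 ι
  | lit : ι → Bool → AC0 ι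
  | and : List (AC0 ι) → AC0 ι
  | or : List (AC0 ι) → AC0 ι

namespace AC0

variable {ι : Type}

mutual
  /-- Evaluation of an `AC⁰` formula on an input. -/
  def eval (x : ι → Bool) : AC0 ι → Bool
    | const b => b
    | lit i b => if b then x i else !x i
    | and Fs => evalAll x Fs
    | or Fs => evalAny x Fs
  def evalAll (x : ι → Bool) : List (AC0 ι) → Bool
    | [] => true
    | F :: Fs => eval x F && evalAll x Fs
  def evalAny (x : ι → Bool) : List (AC0 ι) → Bool
    | [] => false
    | F :: Fs => eval x F || evalAny x Fs
end

mutual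
  /-- Size: the number of leaves labelled by literals. -/
  def size : AC0 ι → ℕ
    | const _ => 0
    | lit _ _ => 1
    | and Fs => sizeList Fs
    | or Fs => sizeList Fs
  def sizeList : List (AC0 ι) → ℕ
    | [] => 0
    | F :: Fs => size F + sizeList Fs
end

mutual
  /-- Monotone: no leaf is labelled by a negated literal. -/
  def Mono : AC0 ι → Prop
    | const _ => True
    | lit _ b => b = true
    | and Fs => MonoList Fs
    | or Fs => MonoList Fs
  def MonoList : List (AC0 ι) → Prop
    | [] => True
    | F :: Fs => Mono F ∧ MonoList Fs
end

mutual
  /-- `⋀`-depth: the maximum number of `⋀`-gates on a root-to-leaf branch. -/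
  def andDepth : AC0 ι → ℕ
    | const _ => 0
    | lit _ _ => 0
    | and Fs => andDepthList Fs + 1
    | or Fs => andDepthList Fs
  def andDepthList : List (AC0 ι) → ℕ
    | [] => 0
    | F :: Fs => max (andDepth F) (andDepthList Fs)
end

mutual
  /-- Every `⋀`-gate has fan-in at most `w`. -/
  def AndFanInLE (w : ℝ) : AC0 ι → Prop
    | const _ => True
    | lit _ _ => True
    | and Fs => (Fs.length : ℝ) ≤ w ∧ AndFanInLEList w Fs
    | or Fs => AndFanInLEList w Fs
  def AndFanInLEList (w : ℝ) : List (AC0 ι) → Prop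
    | [] => True
    | F :: Fs => AndFanInLE w F ∧ AndFanInLEList w Fs
end

end AC0

/-- A sub-permutation matrix: at most a single `1` in each row and in each column. -/
def IsSubPerm {n : ℕ} (M : Fin n → Fin n → Bool) : Prop :=
  (∀ a b b', M a b = true → M a b' = true → b = b') ∧
  (∀ a a' b, M a b = true → M a' b = true → a = a')

/-- The `(1,1)` entry of the product `M⁽¹⁾ ⋯ M⁽ᵏ⁾` over the Boolean semiring equals `1`:
there is a path `1 = a_0, a_1, …, a_k = 1` with `M⁽ⁱ⁾_{a_{i-1}, a_i} = 1` for all `i`. -/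
def ProdEntryOneOne (n k : ℕ) (M : Fin k → Fin n → Fin n → Bool) : Prop :=
  ∃ f : Fin (k + 1) → Fin n, (f 0 : ℕ) = 0 ∧ (f (Fin.last k) : ℕ) = 0 ∧
    ∀ i : Fin k, M i (f i.castSucc) (f i.succ) = true

/-- A formula on the `k·n²` variables `M⁽ⁱ⁾_{a,b}` computes `SUB-PMM_{n,k}` if it agrees, on
every `k`-tuple of sub-permutation matrices, with the `(1,1)` entry of their Boolean product. -/
def ComputesSubPMM (n k : ℕ) (F : AC0 (Fin k × Fin n × Fin n)) : Prop :=
  ∀ M : Fin k → Fin n → Fin n → Bool, (∀ i, IsSubPerm (M i)) →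
    (AC0.eval (fun p => M p.1 p.2.1 p.2.2) F = true ↔ ProdEntryOneOne n k M)

namespace SubPMM

open Finset

/-- Two sets of edges of the line are apart if no edge of one shares a vertex with the other. -/
def Apart (C U : Finset ℤ) : Prop := ∀ e ∈ C, ∀ f ∈ U, e + 1 < f ∨ f + 1 < e

/-- The last edges of the connected components of a set of edges. -/
def runEnds (S : Finset ℤ) : Finset ℤ := S.filter (fun e => e + 1 ∉ S)

/-- The number of connected components of a set of edges. -/
def nc (S : Finset ℤ) : ℕ := (runEnds S).card

lemma mem_runEnds {S : Finset ℤ} {e : ℤ} : e ∈ runEnds S ↔ e ∈ S ∧ e + 1 ∉ S := by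
  simp [runEnds]

/-- The last edge of the connected component of `e` in `S`. -/
def runEnd (S : Finset ℤ) (e : ℤ) : ℤ :=
  if h : ((runEnds S).filter (e ≤ ·)).Nonempty then ((runEnds S).filter (e ≤ ·)).min' h else e

lemma runEnd_spec {S : Finset ℤ} {e : ℤ} (he : e ∈ S) :
    runEnd S e ∈ runEnds S ∧ e ≤ runEnd S e ∧ ∀ x, e ≤ x → x ≤ runEnd S e → x ∈ S := by
  have h : ((runEnds S).filter (e ≤ ·)).Nonempty := by
    refine ⟨S.max' ⟨e, he⟩, ?_⟩
    rw [mem_filter, mem_runEnds]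
    refine ⟨⟨max'_mem _ _, fun h => ?_⟩, le_max' _ _ he⟩
    have := le_max' _ _ h
    omega
  have hr : runEnd S e = ((runEnds S).filter (e ≤ ·)).min' h := by simp [runEnd, h]
  have hm := min'_mem _ h
  rw [← hr, mem_filter] at hm
  refine ⟨hm.1, hm.2, fun x hx => ?_⟩
  induction x, hx using Int.leInduction with
  | base => intro _; exact he
  | succ x hx ih =>
    intro hx'
    by_contra hc
    have hxS := ih (by omega)
    have : runEnd S e ≤ x := by
      rw [hr]
      exact min'_le _ _ (by rw [mem_filter, mem_runEnds]; exact ⟨⟨hxS, hc⟩, hx⟩)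
    omega

lemma runEnd_eq {S : Finset ℤ} {e f : ℤ} (hf : f ∈ runEnds S) (hef : e ≤ f)
    (h : ∀ x, e ≤ x → x ≤ f → x ∈ S) : runEnd S e = f := by
  obtain ⟨h1, h2, h3⟩ := runEnd_spec (h e le_rfl hef)
  rw [mem_runEnds] at h1 hf
  rcases lt_trichotomy (runEnd S e) f with hlt | heq | hgt
  · exact absurd (h (runEnd S e + 1) (by omega) (by omega)) h1.2
  · exact heq
  · exact absurd (h3 (f + 1) (by omega) (by omega)) hf.2

lemma runEnd_eq_of_Icc {S : Finset ℤ} {e f : ℤ} (hef : e ≤ f)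
    (h : ∀ x, e ≤ x → x ≤ f → x ∈ S) : runEnd S e = runEnd S f := by
  obtain ⟨h1, h2, h3⟩ := runEnd_spec (h f hef le_rfl)
  refine runEnd_eq h1 (by omega) fun x hx hx' => ?_
  by_cases hxf : x ≤ f
  · exact h x hx hxf
  · exact h3 x (by omega) hx'

lemma Icc_subset_of_runEnd_eq {S : Finset ℤ} {e f : ℤ} (he : e ∈ S)
    (hf : f ∈ S) (h : runEnd S e = runEnd S f) {x : ℤ} (hx : e ≤ x) (hx' : x ≤ f) : x ∈ S := by
  obtain ⟨_, h2, h3⟩ := runEnd_spec he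
  obtain ⟨_, h2', h3'⟩ := runEnd_spec hf
  exact h3 x hx (by omega)

lemma runEnd_self {S : Finset ℤ} {e : ℤ} (he : e ∈ runEnds S) : runEnd S e = e :=
  runEnd_eq he le_rfl fun x h1 h2 => by
    obtain rfl : x = e := le_antisymm h2 h1
    exact (mem_runEnds.1 he).1

lemma runEnd_adj {S : Finset ℤ} {e f : ℤ} (he : e ∈ S) (hf : f ∈ S)
    (h : ¬ (e + 1 < f ∨ f + 1 < e)) : runEnd S e = runEnd S f := by
  rcases le_total e f with hl | hl
  · refine runEnd_eq_of_Icc hl fun x h1 h2 => ?_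
    rcases (by omega : x = e ∨ x = f) with rfl | rfl <;> assumption
  · refine (runEnd_eq_of_Icc hl fun x h1 h2 => ?_).symm
    rcases (by omega : x = e ∨ x = f) with rfl | rfl <;> assumption

lemma nc_pos {S : Finset ℤ} (h : S.Nonempty) : 1 ≤ nc S := by
  obtain ⟨e, he⟩ := h
  exact card_pos.2 ⟨_, (runEnd_spec he).1⟩

lemma card_le_nc {S U T : Finset ℤ} (hT : T ⊆ runEnds S) (hU : U ⊆ S)
    (h : ∀ e ∈ T, ∃ u ∈ U, u ≤ e ∧ ∀ x, u ≤ x → x ≤ e → x ∈ S) : T.card ≤ nc U := by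
  have h' : ∀ e ∈ T, ∃ w ∈ runEnds U, w ≤ e ∧ ∀ x, w ≤ x → x ≤ e → x ∈ S := by
    intro e he
    obtain ⟨u, hu, hue, hx⟩ := h e he
    obtain ⟨h1, h2, h3⟩ := runEnd_spec hu
    have heS := mem_runEnds.1 (hT he)
    have hle : runEnd U u ≤ e := by
      by_contra hc
      exact heS.2 (hU (h3 _ (by omega) (by omega)))
    exact ⟨_, h1, hle, fun x hx1 hx2 => hx x (by omega) hx2⟩
  choose! w hw1 hw2 hw3 using h'
  refine card_le_card_of_injOn w (fun e he => hw1 e he) fun e he e' he' heq => ?_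
  have h1 := runEnd_eq (hT he) (hw2 e he) (hw3 e he)
  have h2 := runEnd_eq (hT he') (hw2 e' he') (hw3 e' he')
  rw [← h1, ← h2, heq]

/-- A property of edges that is constant on the connected components of `S`. -/
def Compat (p : ℤ → Prop) (S : Finset ℤ) : Prop := ∀ e ∈ S, e + 1 ∈ S → (p e ↔ p (e + 1))

lemma Compat.mono {p : ℤ → Prop} {S T : Finset ℤ} (h : Compat p S) (hT : T ⊆ S) : Compat p T :=
  fun e he he' => h e (hT he) (hT he')

lemma Compat.not {p : ℤ → Prop} {S : Finset ℤ} (h : Compat p S) :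
    Compat (fun e => ¬ p e) S := fun e he he' => not_congr (h e he he')

lemma Compat.Icc {p : ℤ → Prop} {S : Finset ℤ} (h : Compat p S) {e f : ℤ} (hef : e ≤ f)
    (hS : ∀ x, e ≤ x → x ≤ f → x ∈ S) : p e ↔ p f := by
  induction f, hef using Int.leInduction with
  | base => rfl
  | succ f hf ih =>
    rw [ih fun x h1 h2 => hS x h1 (by omega)]
    exact h f (hS f hf (by omega)) (hS _ (by omega) le_rfl)

lemma Compat.runEnd_eq {p : ℤ → Prop} {S : Finset ℤ} (h : Compat p S) {e f : ℤ}
    (he : e ∈ S) (hf : f ∈ S) (hef : runEnd S e = runEnd S f) : p e ↔ p f := by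
  obtain ⟨_, h2, h3⟩ := runEnd_spec he
  obtain ⟨_, h2', h3'⟩ := runEnd_spec hf
  rw [h.Icc h2 h3, h.Icc h2' h3', hef]

lemma Compat.adj {p : ℤ → Prop} {S : Finset ℤ} (h : Compat p S) {e f : ℤ}
    (he : e ∈ S) (hf : f ∈ S) (hef : ¬ (e + 1 < f ∨ f + 1 < e)) : p e ↔ p f :=
  h.runEnd_eq he hf (runEnd_adj he hf hef)

lemma Compat.Icc_filter {p : ℤ → Prop} [DecidablePred p] {S : Finset ℤ} (h : Compat p S)
    {e f : ℤ} (hf : p f) (hS : ∀ x, e ≤ x → x ≤ f → x ∈ S) :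
    ∀ x, e ≤ x → x ≤ f → x ∈ S.filter p := by
  intro x h1 h2
  rw [mem_filter]
  exact ⟨hS x h1 h2, (h.Icc h2 fun y h3 h4 => hS y (by omega) h4).2 hf⟩

lemma runEnds_filter {p : ℤ → Prop} [DecidablePred p] {S : Finset ℤ} (h : Compat p S) :
    runEnds (S.filter p) = (runEnds S).filter p := by
  ext e
  simp only [mem_runEnds, mem_filter, not_and]
  constructor
  · rintro ⟨⟨h1, h2⟩, h3⟩
    exact ⟨⟨h1, fun h4 => h3 h4 ((h e h1 h4).1 h2)⟩, h2⟩
  · rintro ⟨⟨h1, h2⟩, h3⟩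
    exact ⟨⟨h1, h3⟩, fun h4 => absurd h4 h2⟩

lemma nc_filter_add {p : ℤ → Prop} [DecidablePred p] {S : Finset ℤ} (h : Compat p S) :
    nc (S.filter p) + nc (S.filter fun e => ¬ p e) = nc S := by
  unfold nc
  rw [runEnds_filter h, runEnds_filter h.not, card_filter_add_card_filter_not]

/-- The union of the connected components of `B` which do not touch `U`. -/
def free (B U : Finset ℤ) : Finset ℤ :=
  B.filter fun e => ∀ f ∈ B, runEnd B f = runEnd B e → ∀ u ∈ U, f + 1 < u ∨ u + 1 < f

lemma mem_free {B U : Finset ℤ} {e : ℤ} : e ∈ free B U ↔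
    e ∈ B ∧ ∀ f ∈ B, runEnd B f = runEnd B e → ∀ u ∈ U, f + 1 < u ∨ u + 1 < f := by
  simp only [free, mem_filter]

lemma free_subset (B U : Finset ℤ) : free B U ⊆ B := filter_subset _ _

lemma free_apart (B U : Finset ℤ) : Apart (free B U) U := fun e he u hu =>
  (mem_free.1 he).2 e (mem_free.1 he).1 rfl u hu

lemma free_apart_sdiff (B U : Finset ℤ) : Apart (free B U) (B \ free B U) := by
  intro e he f hf
  by_contra hc
  rw [mem_sdiff] at hf
  have hr := runEnd_adj (free_subset _ _ he) hf.1 hc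
  refine hf.2 (mem_free.2 ⟨hf.1, fun f' hf' h => ?_⟩)
  exact (mem_free.1 he).2 f' hf' (h.trans hr.symm)

lemma nc_union_le {p : ℤ → Prop} [DecidablePred p] {U B : Finset ℤ} (h : Compat p (U ∪ B)) :
    nc ((U ∪ B).filter p) ≤ nc (U.filter p) + nc ((free B U).filter p) := by
  have hfree : ∀ e, e ∈ runEnds ((U ∪ B).filter p) → e ∈ free B U →
      e ∈ runEnds ((free B U).filter p) := by
    intro e he hef
    rw [runEnds_filter h, mem_filter, mem_runEnds] at he
    rw [mem_runEnds, mem_filter, mem_filter]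
    refine ⟨⟨hef, he.2⟩, fun h2 => he.1.2 ?_⟩
    exact mem_union_right _ (free_subset _ _ h2.1)
  have key : (runEnds ((U ∪ B).filter p) \ runEnds ((free B U).filter p)).card
      ≤ nc (U.filter p) := by
    refine card_le_nc (S := (U ∪ B).filter p) sdiff_subset
      (filter_subset_filter _ subset_union_left) ?_
    intro e he
    rw [mem_sdiff] at he
    have hnf : e ∉ free B U := fun hc => he.2 (hfree e he.1 hc)
    have he1 := he.1
    rw [runEnds_filter h, mem_filter, mem_runEnds] at he1
    obtain ⟨⟨heS, heS'⟩, hpe⟩ := he1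
    by_cases heU : e ∈ U
    · exact ⟨e, mem_filter.2 ⟨heU, hpe⟩, le_rfl, h.Icc_filter hpe fun x h1 h2 => by
        obtain rfl : x = e := le_antisymm h2 h1
        exact heS⟩
    have heB : e ∈ B := (mem_union.1 heS).resolve_left heU
    rw [mem_free] at hnf
    push Not at hnf
    obtain ⟨f, hfB, hr, u, huU, hfu1, hfu2⟩ := hnf heB
    have heE : e ∈ runEnds B := mem_runEnds.2 ⟨heB, fun hc => heS' (mem_union_right _ hc)⟩
    have hfe : f ≤ e := by
      have := (runEnd_spec hfB).2.1
      rw [hr, runEnd_self heE] at this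
      exact this
    have hue : u ≤ e := by
      by_contra hc
      have : u = e + 1 := by omega
      exact heS' (mem_union_left _ (this ▸ huU))
    have hIcc : ∀ x, u ≤ x → x ≤ e → x ∈ U ∪ B := by
      intro x h1 h2
      by_cases hxu : x = u
      · subst hxu; exact mem_union_left _ huU
      · exact mem_union_right _ (Icc_subset_of_runEnd_eq hfB heB hr (by omega) h2)
    have hF := h.Icc_filter hpe hIcc
    exact ⟨u, mem_filter.2 ⟨huU, (mem_filter.1 (hF u le_rfl hue)).2⟩, hue, hF⟩
  have := card_le_card_sdiff_add_card (s := runEnds ((U ∪ B).filter p))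
    (t := runEnds ((free B U).filter p))
  unfold nc at *
  omega

/-- `Gain U L g`: if the coordinates of the edges in `U` are exposed first and then those of the
members of `L` in turn, then at least `g` components are met that do not touch anything exposed
before them. -/
def Gain : Finset ℤ → List (Finset ℤ) → ℕ → Prop
  | _, [], g => g = 0
  | U, B :: L, g => ∃ D g', D ⊆ B ∧ Apart D (B \ D) ∧ Apart D U ∧ Gain (U ∪ B) L g' ∧
      g = nc D + g'

lemma Gain.mono {L : List (Finset ℤ)} : ∀ {U U' : Finset ℤ} {g : ℕ}, U' ⊆ U → Gain U L g →
    Gain U' L g := by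
  induction L with
  | nil => intro U U' g _ h; exact h
  | cons B L ih =>
    rintro U U' g hU ⟨D, g', h1, h2, h3, h4, h5⟩
    exact ⟨D, g', h1, h2, fun e he f hf => h3 e he f (hU hf),
      ih (union_subset_union_left hU) h4, h5⟩

lemma Gain.cons_free {L : List (Finset ℤ)} {U B : Finset ℤ} {g : ℕ} (h : Gain (U ∪ B) L g) :
    Gain U (B :: L) (nc (free B U) + g) :=
  ⟨free B U, g, free_subset _ _, free_apart_sdiff _ _, free_apart _ _, h, rfl⟩

/-- Repeatedly expose labels having a component that does not touch anything exposed so far. -/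
lemma exists_greedy (A : Finset ℤ) (C : ℤ → Finset ℤ) (hC : ∀ e ∈ A, e ∈ C e ∧ C e ⊆ A)
    (U : Finset ℤ) (p : ℤ → Prop) [DecidablePred p] (hp : Compat p (U ∪ A)) :
    ∃ (us : List ℤ) (U' : Finset ℤ) (γ γ₁ γ₂ : ℕ),
      (∀ e ∈ us, e ∈ A) ∧ us.length ≤ γ ∧ γ₁ + γ₂ = γ ∧ U ⊆ U' ∧ U' ⊆ U ∪ A ∧
      (∀ e ∈ A, e ∉ free (C e) U') ∧
      (∀ L g, Gain U' L g → Gain U (us.map C ++ L) (γ + g)) ∧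
      nc (U'.filter p) ≤ nc (U.filter p) + γ₁ ∧
      nc (U'.filter fun e => ¬ p e) ≤ nc (U.filter fun e => ¬ p e) + γ₂ ∧
      ∀ x ∈ U', x ∈ U ∨ ∃ e ∈ us, x ∈ C e := by
  induction hN : (A \ U).card using Nat.strong_induction_on generalizing U with
  | _ N ih =>
  by_cases hbl : ∀ e ∈ A, e ∉ free (C e) U
  · exact ⟨[], U, 0, 0, 0, by simp, by simp, rfl, Subset.rfl, subset_union_left, hbl,
      fun L g h => by simpa using h, by simp, by simp, fun x hx => Or.inl hx⟩
  push Not at hbl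
  obtain ⟨e, heA, hef⟩ := hbl
  have heU : e ∉ U := fun hc => by
    have := free_apart _ _ e hef e hc
    omega
  have hsub : U ∪ C e ∪ A ⊆ U ∪ A :=
    union_subset (union_subset_union_right (hC e heA).2) subset_union_right
  have hlt : (A \ (U ∪ C e)).card < N := by
    rw [← hN]
    refine card_lt_card ⟨sdiff_subset_sdiff Subset.rfl subset_union_left, fun hc => ?_⟩
    have := hc (mem_sdiff.2 ⟨heA, heU⟩)
    rw [mem_sdiff, mem_union] at this
    exact this.2 (Or.inr (hC e heA).1)
  obtain ⟨us, U', γ, γ₁, γ₂, h1, h2, h3, h4, h5, h6, h7, h8, h9, h10⟩ :=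
    ih _ hlt (U ∪ C e) (hp.mono hsub) rfl
  have hcp : Compat p (U ∪ C e) := hp.mono (union_subset_union_right (hC e heA).2)
  have hcf : Compat p (free (C e) U) :=
    hcp.mono ((free_subset _ _).trans subset_union_right)
  have hadd := nc_filter_add hcf
  have hpos := nc_pos ⟨e, hef⟩
  have hu1 := nc_union_le hcp
  have hu2 := nc_union_le hcp.not
  refine ⟨e :: us, U', nc (free (C e) U) + γ, nc ((free (C e) U).filter p) + γ₁,
    nc ((free (C e) U).filter fun e => ¬ p e) + γ₂, ?_, ?_, ?_, subset_union_left.trans h4,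
    h5.trans hsub, h6, ?_, ?_, ?_, ?_⟩
  · intro x hx
    rcases List.mem_cons.1 hx with rfl | hx
    · exact heA
    · exact h1 x hx
  · simp only [List.length_cons]; omega
  · omega
  · intro L g hg
    rw [List.map_cons, List.cons_append, add_assoc]
    exact (h7 L g hg).cons_free
  · omega
  · omega
  · intro x hx
    rcases h10 x hx with h | ⟨f, hf, hxf⟩
    · rcases mem_union.1 h with h | h
      · exact Or.inl h
      · exact Or.inr ⟨e, List.mem_cons_self, h⟩
    · exact Or.inr ⟨f, List.mem_cons_of_mem _ hf, hxf⟩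

lemma card_filter_le_add_mul {C : ℤ → Finset ℤ} {us : List ℤ} {U U' : Finset ℤ}
    (h : ∀ x ∈ U', x ∈ U ∨ ∃ e ∈ us, x ∈ C e) (q : ℤ → Prop) [DecidablePred q] {b : ℕ}
    (hb : ∀ e ∈ us, ((C e).filter q).card ≤ b) :
    (U'.filter q).card ≤ (U.filter q).card + b * us.length := by
  have hsub : U'.filter q ⊆ U.filter q ∪ us.toFinset.biUnion fun e => (C e).filter q := by
    intro x hx
    obtain ⟨hx, hq⟩ := mem_filter.1 hx
    rw [mem_union, mem_filter, mem_biUnion]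
    rcases h x hx with h | ⟨e, he, hxe⟩
    · exact Or.inl ⟨h, hq⟩
    · exact Or.inr ⟨e, List.mem_toFinset.2 he, mem_filter.2 ⟨hxe, hq⟩⟩
  refine (card_le_card hsub).trans ((card_union_le _ _).trans (Nat.add_le_add_left ?_ _))
  calc _ ≤ us.toFinset.card * b := card_biUnion_le_card_mul _ _ _ fun e he =>
        hb e (List.mem_toFinset.1 he)
    _ ≤ us.length * b := Nat.mul_le_mul_right _ us.toFinset_card_le
    _ = b * us.length := mul_comm _ _

lemma exists_adj_of_not_mem_free {B U : Finset ℤ} {e : ℤ} (he : e ∈ B) (h : e ∉ free B U) :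
    ∃ f ∈ B, runEnd B f = runEnd B e ∧ ∃ u ∈ U, ¬ (f + 1 < u ∨ u + 1 < f) := by
  rw [mem_free] at h
  push Not at h
  obtain ⟨f, h1, h2, u, h3, h4⟩ := h he
  exact ⟨f, h1, h2, u, h3, by push Not; exact h4⟩

/-- After exposing greedily, every component has been met. -/
lemma nc_le_of_blocked {A U U' : Finset ℤ} {C : ℤ → Finset ℤ}
    (hC : ∀ e ∈ A, e ∈ C e ∧ C e ⊆ A) {p : ℤ → Prop} [DecidablePred p]
    (hp : Compat p (U ∪ A)) (hU : U ⊆ U') (hU' : U' ⊆ U ∪ A)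
    (h : ∀ e ∈ A, e ∉ free (C e) U') : nc ((U ∪ A).filter p) ≤ nc (U'.filter p) := by
  refine card_le_nc Subset.rfl (filter_subset_filter _ hU') fun e he => ?_
  rw [runEnds_filter hp, mem_filter, mem_runEnds] at he
  obtain ⟨⟨heS, heS'⟩, hpe⟩ := he
  by_cases heU : e ∈ U
  · exact ⟨e, mem_filter.2 ⟨hU heU, hpe⟩, le_rfl, hp.Icc_filter hpe fun x h1 h2 => by
      obtain rfl : x = e := le_antisymm h2 h1
      exact heS⟩
  have heA : e ∈ A := (mem_union.1 heS).resolve_left heU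
  obtain ⟨f, hfB, hr, u, huU, hfu⟩ := exists_adj_of_not_mem_free (hC e heA).1 (h e heA)
  have heE : e ∈ runEnds (C e) := mem_runEnds.2 ⟨(hC e heA).1, fun hc =>
    heS' (mem_union_right _ ((hC e heA).2 hc))⟩
  have hfe : f ≤ e := by
    have := (runEnd_spec hfB).2.1
    rw [hr, runEnd_self heE] at this
    exact this
  have hue : u ≤ e := by
    by_contra hc
    have : u = e + 1 := by omega
    exact heS' (hU' (this ▸ huU))
  have hIcc : ∀ x, u ≤ x → x ≤ e → x ∈ U ∪ A := by
    intro x h1 h2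
    by_cases hxu : x = u
    · subst hxu; exact hU' huU
    · exact mem_union_right _ ((hC e heA).2
        (Icc_subset_of_runEnd_eq hfB (hC e heA).1 hr (by omega) h2))
  have hF := hp.Icc_filter hpe hIcc
  exact ⟨u, mem_filter.2 ⟨huU, (mem_filter.1 (hF u le_rfl hue)).2⟩, hue, hF⟩

lemma card_le_of_near {X U : Finset ℤ} {b : ℕ}
    (h : ∀ e ∈ X, e ∈ U ∨ ∃ u ∈ U, e ≤ u + b ∧ u ≤ e + b) :
    X.card ≤ U.card + 2 * b * nc U := by
  classical
  set St := U.filter (fun e => e - 1 ∉ U) with hSt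
  have hSt_le : St.card ≤ nc U := by
    refine card_le_card_of_injOn (runEnd U)
      (fun e he => (runEnd_spec (mem_filter.1 he).1).1) fun e he e' he' heq => ?_
    have he := mem_filter.1 he
    have he' := mem_filter.1 he'
    rcases lt_trichotomy e e' with hl | hl | hl
    · exact absurd (Icc_subset_of_runEnd_eq he.1 he'.1 heq (x := e' - 1) (by omega) (by omega))
        he'.2
    · exact hl
    · exact absurd (Icc_subset_of_runEnd_eq he'.1 he.1 heq.symm (x := e - 1) (by omega)
        (by omega)) he.2
  have hsub : X ⊆ U ∪ ((runEnds U ×ˢ Finset.Icc (1 : ℤ) b).image (fun q => q.1 + q.2) ∪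
      (St ×ˢ Finset.Icc (1 : ℤ) b).image (fun q => q.1 - q.2)) := by
    intro e he
    by_cases heU : e ∈ U
    · exact mem_union_left _ heU
    obtain ⟨u, hu, h1, h2⟩ := (h e he).resolve_left heU
    refine mem_union_right _ ?_
    have hne : u ≠ e := fun hc => heU (hc ▸ hu)
    rcases lt_or_gt_of_ne hne with hl | hl
    · refine mem_union_left _ (mem_image.2 ⟨(runEnd U u, e - runEnd U u), ?_, by simp⟩)
      obtain ⟨h3, h4, h5⟩ := runEnd_spec hu
      have : runEnd U u < e := by
        by_contra hc
        exact heU (h5 e (by omega) (by omega))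
      simp only [mem_product, Finset.mem_Icc]
      exact ⟨h3, by omega, by omega⟩
    · have hne' : (U.filter (e < ·)).Nonempty := ⟨u, mem_filter.2 ⟨hu, hl⟩⟩
      set w := (U.filter (e < ·)).min' hne' with hw
      have hwm := mem_filter.1 (min'_mem _ hne')
      have hwu : w ≤ u := min'_le _ _ (mem_filter.2 ⟨hu, hl⟩)
      refine mem_union_right _ (mem_image.2 ⟨(w, w - e), ?_, by simp⟩)
      rw [← hw] at hwm
      simp only [mem_product, Finset.mem_Icc]
      refine ⟨mem_filter.2 ⟨hwm.1, fun hc => ?_⟩, by omega, by omega⟩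
      by_cases hwe : w - 1 = e
      · exact heU (hwe ▸ hc)
      · have : w ≤ w - 1 := min'_le _ _ (mem_filter.2 ⟨hc, by omega⟩)
        omega
  have hI : (Finset.Icc (1 : ℤ) b).card = b := by simp
  calc X.card ≤ _ := card_le_card hsub
    _ ≤ U.card + ((runEnds U ×ˢ Finset.Icc (1 : ℤ) b).card +
        (St ×ˢ Finset.Icc (1 : ℤ) b).card) := by
        refine (card_union_le _ _).trans (Nat.add_le_add_left ?_ _)
        exact (card_union_le _ _).trans (Nat.add_le_add card_image_le card_image_le)
    _ ≤ U.card + 2 * b * nc U := by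
        rw [card_product, card_product, hI]
        have : St.card * b ≤ nc U * b := Nat.mul_le_mul_right _ hSt_le
        unfold nc at *
        nlinarith

lemma exists_near_of_blocked {A U U' : Finset ℤ} {C : ℤ → Finset ℤ}
    (hC : ∀ e ∈ A, e ∈ C e ∧ C e ⊆ A) {p : ℤ → Prop} [DecidablePred p]
    (hp : Compat p (U ∪ A)) (hU' : U' ⊆ U ∪ A)
    (h : ∀ e ∈ A, e ∉ free (C e) U') {b : ℕ} (hb : ∀ e ∈ A, ((C e).filter p).card ≤ b)
    {e : ℤ} (heA : e ∈ A) (hpe : p e) : ∃ u ∈ U'.filter p, e ≤ u + b ∧ u ≤ e + b := by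
  obtain ⟨f, hfB, hr, u, huU, hfu⟩ := exists_adj_of_not_mem_free (hC e heA).1 (h e heA)
  have hpC : Compat p (C e) := hp.mono ((hC e heA).2.trans subset_union_right)
  have hpf : p f := (hpC.runEnd_eq hfB (hC e heA).1 hr).2 hpe
  have hpu : p u := (hp.adj (mem_union_right _ ((hC e heA).2 hfB)) (hU' huU) hfu).1 hpf
  refine ⟨u, mem_filter.2 ⟨huU, hpu⟩, ?_⟩
  have hcard : ∀ x y : ℤ, x ∈ C e → y ∈ C e → p y → runEnd (C e) x = runEnd (C e) y → x ≤ y →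
      y + 1 - x ≤ b := by
    intro x y hx hy hpy hxy hle
    have hs : Finset.Icc x y ⊆ (C e).filter p := by
      intro z hz
      rw [Finset.mem_Icc] at hz
      exact hpC.Icc_filter hpy (fun t h1 h2 => Icc_subset_of_runEnd_eq hx hy hxy h1 h2) z hz.1 hz.2
    have := (card_le_card hs).trans (hb e heA)
    rw [Int.card_Icc] at this
    omega
  rcases le_total e f with hl | hl
  · have := hcard e f (hC e heA).1 hfB hpf hr.symm hl
    omega
  · have := hcard f e hfB (hC e heA).1 hpe hr hl
    omega

lemma card_le_of_blocked {A U U' : Finset ℤ} {C : ℤ → Finset ℤ}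
    (hC : ∀ e ∈ A, e ∈ C e ∧ C e ⊆ A) {p : ℤ → Prop} [DecidablePred p]
    (hp : Compat p (U ∪ A)) (hU' : U' ⊆ U ∪ A)
    (h : ∀ e ∈ A, e ∉ free (C e) U') {b : ℕ} (hb : ∀ e ∈ A, ((C e).filter p).card ≤ b) :
    (A.filter p).card ≤ (U'.filter p).card + 2 * b * nc (U'.filter p) :=
  card_le_of_near fun _ he => Or.inr
    (exists_near_of_blocked hC hp hU' h hb (mem_filter.1 he).1 (mem_filter.1 he).2)

/-- `Win d A L v`: whichever sub-labels the restricted depth-`d` decompositions of the label `A`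
present, one can continue to a single sub-label, retaining some of the others, so that the total
exponent collected is at least `v`. -/
def Win : ℕ → Finset ℤ → List (Finset ℤ) → ℝ → Prop
  | 0, A, L, v => 2 ≤ A.card ∨ ∃ g, Gain A L g ∧ v ≤ 6 * (g : ℝ) + 1
  | d + 1, A, L, v => ∀ C : ℤ → Finset ℤ, (∀ e ∈ A, e ∈ C e ∧ C e ⊆ A) →
      ∃ h ∈ A, ∃ us : List ℤ, (∀ e ∈ us, e ∈ A) ∧ ∃ L1 L2, L = L1 ++ L2 ∧
        Win d (C h) (L1 ++ (us.map C ++ L2)) (v + us.length)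

lemma Win.mono {d : ℕ} : ∀ {A : Finset ℤ} {L : List (Finset ℤ)} {v v' : ℝ}, v' ≤ v →
    Win d A L v → Win d A L v' := by
  induction d with
  | zero =>
    rintro A L v v' hv (h | ⟨g, hg, h⟩)
    · exact Or.inl h
    · exact Or.inr ⟨g, hg, hv.trans h⟩
  | succ d ih =>
    intro A L v v' hv h C hC
    obtain ⟨e, he, us, hus, L1, L2, hL, hw⟩ := h C hC
    exact ⟨e, he, us, hus, L1, L2, hL, ih (by linarith) hw⟩

lemma Gain.of_subset {Ls : List (Finset ℤ)} {L1 L2 : List (Finset ℤ)} : ∀ {U : Finset ℤ} {g : ℕ},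
    (∀ B ∈ Ls, B ⊆ U) → Gain U (L1 ++ (Ls ++ L2)) g → Gain U (L1 ++ L2) g := by
  induction L1 with
  | nil =>
    induction Ls with
    | nil => intro U g _ h; exact h
    | cons B Ls ih =>
      rintro U g hB ⟨D, g', h1, h2, h3, h4, h5⟩
      have hBU := hB B List.mem_cons_self
      have hD : D = ∅ := by
        refine eq_empty_of_forall_notMem fun e he => ?_
        have := h3 e he e (hBU (h1 he))
        omega
      rw [union_eq_left.2 hBU] at h4
      have : g = g' := by rw [h5, hD]; simp [nc, runEnds]
      rw [this]
      exact ih (fun B' hB' => hB B' (List.mem_cons_of_mem _ hB')) h4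
  | cons B L1 ih =>
    rintro U g hB ⟨D, g', h1, h2, h3, h4, h5⟩
    exact ⟨D, g', h1, h2, h3, ih (fun B' hB' => (hB B' hB').trans subset_union_left) h4, h5⟩

lemma Win.singleton {d : ℕ} : ∀ {e : ℤ} {L : List (Finset ℤ)} {v : ℝ}, Win d {e} L v →
    ∃ g, Gain {e} L g ∧ v ≤ 6 * (g : ℝ) + 1 := by
  induction d with
  | zero =>
    rintro e L v (h | h)
    · simp at h
    · exact h
  | succ d ih =>
    intro e L v h
    obtain ⟨h', hh', us, hus, L1, L2, hL, hw⟩ := h (fun _ => {e}) (by simp)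
    obtain ⟨g, hg, hv⟩ := ih hw
    refine ⟨g, ?_, by have : (0 : ℝ) ≤ us.length := Nat.cast_nonneg _
                      linarith⟩
    rw [hL]
    refine Gain.of_subset (fun B hB => ?_) hg
    obtain ⟨_, _, rfl⟩ := List.mem_map.1 hB
    exact Subset.rfl

/-- The potential in the regime `k ^ (1 / d)` large. -/
noncomputable def pot (K : ℝ) (d : ℕ) (m : ℝ) : ℝ :=
  if d = 0 then (if m ≤ 1 then 0 else K) else (d * m ^ (1 / (d : ℝ)) - 12 * d) / 24

lemma pot_step {K m ρ b : ℝ} {d : ℕ} (hm : 0 ≤ m) (hρ : 0 < ρ) (hb : 0 ≤ b) (h : m ≤ ρ * b)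
    (hK : m ≤ K) : pot K (d + 1) m ≤ pot K d b + (ρ - 12) / 24 := by
  rcases Nat.eq_zero_or_pos d with rfl | hd
  · simp only [pot, zero_add, one_ne_zero, if_false, if_true, Nat.cast_one, div_one, Real.rpow_one]
    split_ifs with hb1
    · have : ρ * b ≤ ρ * 1 := mul_le_mul_of_nonneg_left hb1 hρ.le
      linarith
    · linarith
  · have hd0 : d ≠ 0 := hd.ne'
    have hdr : (0 : ℝ) < d := by exact_mod_cast hd
    simp only [pot, Nat.succ_ne_zero, hd0, if_false]
    have key : ((d + 1 : ℕ) : ℝ) * m ^ (1 / ((d + 1 : ℕ) : ℝ)) ≤ ρ + d * b ^ (1 / (d : ℝ)) := by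
      have hw : (1 / ((d : ℝ) + 1)) + d / ((d : ℝ) + 1) = 1 := by field_simp; ring
      have hbd : (0 : ℝ) ≤ b ^ (1 / (d : ℝ)) := Real.rpow_nonneg hb _
      have := Real.geom_mean_le_arith_mean2_weighted (w₁ := 1 / ((d : ℝ) + 1))
        (w₂ := d / ((d : ℝ) + 1)) (p₁ := ρ) (p₂ := b ^ (1 / (d : ℝ))) (by positivity)
        (by positivity) hρ.le hbd hw
      have h2 : m ^ (1 / ((d : ℝ) + 1)) ≤
          ρ ^ (1 / ((d : ℝ) + 1)) * (b ^ (1 / (d : ℝ))) ^ (d / ((d : ℝ) + 1)) := by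
        rw [← Real.rpow_mul hb, show 1 / (d : ℝ) * (d / ((d : ℝ) + 1)) = 1 / ((d : ℝ) + 1) by
          field_simp, ← Real.mul_rpow hρ.le hb]
        exact Real.rpow_le_rpow hm h (by positivity)
      have h3 := h2.trans this
      push_cast
      calc ((d : ℝ) + 1) * m ^ (1 / ((d : ℝ) + 1)) ≤ ((d : ℝ) + 1) *
            (1 / ((d : ℝ) + 1) * ρ + d / ((d : ℝ) + 1) * b ^ (1 / (d : ℝ))) := by gcongr
        _ = ρ + d * b ^ (1 / (d : ℝ)) := by field_simp
    push_cast at key ⊢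
    linarith

/-- Half of the components carrying at least half of the edges. -/
lemma exists_split {S : Finset ℤ} {p : ℤ → Prop} [DecidablePred p] (hp : Compat p S) :
    ∃ q : ℤ → Prop, ∃ _ : DecidablePred q, Compat q S ∧
      2 * nc (S.filter q) ≤ nc (S.filter p) + 1 ∧
      (S.filter p).card ≤ 2 * (S.filter q).card := by
  classical
  obtain ⟨T₁, hT₁, hc₁⟩ := exists_subset_card_eq (s := (runEnds S).filter p)
    (n := ((runEnds S).filter p).card / 2) (Nat.div_le_self _ _)
  have hq : ∀ T : Finset ℤ, Compat (fun e => p e ∧ runEnd S e ∈ T) S := by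
    intro T e he he'
    beta_reduce
    rw [hp e he he', runEnd_adj he he' (by omega)]
  have hn : ∀ T : Finset ℤ, nc (S.filter fun e => p e ∧ runEnd S e ∈ T) =
      (((runEnds S).filter p).filter (· ∈ T)).card := by
    intro T
    unfold nc
    rw [runEnds_filter (hq T), filter_filter]
    congr 1
    refine filter_congr fun e he => ?_
    rw [runEnd_self he]
  have hnp : nc (S.filter p) = ((runEnds S).filter p).card := by unfold nc; rw [runEnds_filter hp]
  set T₂ := (runEnds S).filter p \ T₁ with hT₂
  have h1 : ((runEnds S).filter p).filter (· ∈ T₁) = T₁ := by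
    rw [filter_mem_eq_inter, inter_eq_right.2 hT₁]
  have h2 : ((runEnds S).filter p).filter (· ∈ T₂) = T₂ := by
    rw [filter_mem_eq_inter, inter_eq_right.2 sdiff_subset]
  have hc₂ : T₂.card = ((runEnds S).filter p).card - T₁.card := card_sdiff_of_subset hT₁
  have hcard : (S.filter p).card ≤ (S.filter fun e => p e ∧ runEnd S e ∈ T₁).card +
      (S.filter fun e => p e ∧ runEnd S e ∈ T₂).card := by
    refine (card_le_card fun e he => ?_).trans (card_union_le _ _)
    obtain ⟨he1, he2⟩ := mem_filter.1 he
    have hr : runEnd S e ∈ (runEnds S).filter p := by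
      obtain ⟨h3, h4, h5⟩ := runEnd_spec he1
      exact mem_filter.2 ⟨h3, (hp.Icc h4 h5).1 he2⟩
    rw [mem_union, mem_filter, mem_filter]
    by_cases hm : runEnd S e ∈ T₁
    · exact Or.inl ⟨he1, he2, hm⟩
    · exact Or.inr ⟨he1, he2, mem_sdiff.2 ⟨hr, hm⟩⟩
  rcases le_total (S.filter fun e => p e ∧ runEnd S e ∈ T₂).card
    (S.filter fun e => p e ∧ runEnd S e ∈ T₁).card with hl | hl
  · refine ⟨_, inferInstance, hq T₁, ?_, by omega⟩
    rw [hn, h1, hnp]; omega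
  · refine ⟨_, inferInstance, hq T₂, ?_, by omega⟩
    rw [hn, h2, hnp]; omega

theorem win_of_pot (K : ℝ) (d : ℕ) : ∀ (A : Finset ℤ) (p : ℤ → Prop) [DecidablePred p]
    (L : List (Finset ℤ)) (g : ℕ) (v : ℝ), (A.card : ℝ) ≤ K → Compat p A →
    (A.filter p).Nonempty → Gain A L g →
    v ≤ nc (A.filter fun e => ¬ p e) + pot K d ((A.filter p).card : ℝ) + 6 * (g : ℝ) →
    Win d A L v := by
  induction d with
  | zero =>
    intro A p _ L g v hK hp hne hg hv
    by_cases hA : 2 ≤ A.card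
    · exact Or.inl hA
    refine Or.inr ⟨g, hg, ?_⟩
    have h1 : 0 < (A.filter p).card := card_pos.2 hne
    have h2 := card_filter_add_card_filter_not (s := A) p
    have h3 : nc (A.filter fun e => ¬ p e) = 0 := by
      have : (A.filter fun e => ¬ p e) = ∅ := card_eq_zero.1 (by omega)
      rw [this]; simp [nc, runEnds]
    have h4 : (A.filter p).card = 1 := by omega
    rw [h3, h4] at hv
    simp [pot] at hv
    linarith
  | succ d ih =>
    intro A p _ L g v hK hp hne hg hv C hC
    have hAne : A.Nonempty := hne.mono (filter_subset _ _)
    obtain ⟨h, hhA, hmax⟩ := exists_max_image A (fun e => ((C e).filter p).card) hAne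
    set b := ((C h).filter p).card with hb
    have hbpos : 1 ≤ b := by
      obtain ⟨e, he⟩ := hne
      obtain ⟨he1, he2⟩ := mem_filter.1 he
      refine le_trans ?_ (hmax e he1)
      exact card_pos.2 ⟨e, mem_filter.2 ⟨(hC e he1).1, he2⟩⟩
    have hUA : C h ∪ A = A := union_eq_right.2 (hC h hhA).2
    have hp' : Compat p (C h ∪ A) := by rwa [hUA]
    obtain ⟨us, U', γ, γ₁, γ₂, h1, h2, h3, h4, h5, h6, h7, h8, h9, h10⟩ :=
      exists_greedy A C hC (C h) p hp'
    replace h10 := card_filter_le_add_mul h10 p fun e he => hmax e (h1 e he)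
    have hcard := card_le_of_blocked hC hp' h5 h6 hmax
    have hncn := nc_le_of_blocked hC hp'.not h4 h5 h6
    rw [hUA] at hncn h5
    have hCne : ((C h).filter p).Nonempty := card_pos.1 hbpos
    set n := nc ((C h).filter p) with hn
    have hnpos : 1 ≤ n := nc_pos hCne
    set m := (A.filter p).card with hm
    have hmb : m ≤ 3 * (n + γ) * b := by
      have e1 : b * us.length ≤ b * γ := Nat.mul_le_mul_left _ h2
      have e2 : 2 * b * nc (U'.filter p) ≤ 2 * b * (n + γ) := Nat.mul_le_mul_left _ (by omega)
      have e3 : b * 1 ≤ b * n := Nat.mul_le_mul_left _ hnpos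
      nlinarith
    have hgain := h7 L g (hg.mono h5)
    have hKC : ((C h).card : ℝ) ≤ K := le_trans (by exact_mod_cast card_le_card (hC h hhA).2) hK
    have hmK : (m : ℝ) ≤ K := le_trans (by exact_mod_cast card_filter_le _ _) hK
    have hpC : Compat p (C h) := hp.mono (hC h hhA).2
    refine ⟨h, hhA, us, h1, [], L, rfl, ?_⟩
    rw [List.nil_append]
    have r2 : (us.length : ℝ) ≤ γ := by exact_mod_cast h2
    have r3 : (γ₂ : ℝ) ≤ γ := by exact_mod_cast (by omega : γ₂ ≤ γ)
    have r4 : (nc (A.filter fun e => ¬ p e) : ℝ) ≤ nc ((C h).filter fun e => ¬ p e) + γ₂ := by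
      exact_mod_cast hncn.trans h9
    have r5 : (m : ℝ) ≤ 3 * (n + γ) * b := by exact_mod_cast hmb
    have r6 : (1 : ℝ) ≤ n := by exact_mod_cast hnpos
    have r7 : (1 : ℝ) ≤ b := by exact_mod_cast hbpos
    rcases le_or_gt n γ with hγ | hγ
    · have r8 : (n : ℝ) ≤ γ := by exact_mod_cast hγ
      have := pot_step (K := K) (m := m) (ρ := 6 * γ) (b := b) (d := d) (by positivity)
        (by linarith) (by positivity) (by nlinarith) hmK
      refine ih (C h) p _ (γ + g) _ hKC hpC hCne hgain ?_
      push_cast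
      linarith
    · have r8 : (γ : ℝ) ≤ n := by exact_mod_cast hγ.le
      obtain ⟨q, _, hq1, hq2, hq3⟩ := exists_split hpC
      have hadd := (nc_filter_add hq1).trans (nc_filter_add hpC).symm
      have hqne : ((C h).filter q).Nonempty := card_pos.1 (by omega)
      have r9 : (nc ((C h).filter fun e => ¬ p e) : ℝ) + (n - 1) / 2 ≤
          nc ((C h).filter fun e => ¬ q e) := by
        have : 2 * nc ((C h).filter fun e => ¬ p e) + n ≤
            2 * nc ((C h).filter fun e => ¬ q e) + 1 := by omega
        have : 2 * (nc ((C h).filter fun e => ¬ p e) : ℝ) + n ≤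
            2 * nc ((C h).filter fun e => ¬ q e) + 1 := by exact_mod_cast this
        linarith
      have r10 : (b : ℝ) ≤ 2 * ((C h).filter q).card := by exact_mod_cast hq3
      have := pot_step (K := K) (m := m) (ρ := 12 * n) (b := ((C h).filter q).card) (d := d)
        (by positivity) (by linarith) (by positivity) (by nlinarith) hmK
      refine ih (C h) q _ (γ + g) _ hKC hq1 hqne hgain ?_
      push_cast
      linarith

lemma exists_component {S : Finset ℤ} {e : ℤ} (he : e ∈ S) : ∃ x y, x ≤ e ∧ e ≤ y ∧
    Icc x y ⊆ S ∧ x - 1 ∉ S ∧ y + 1 ∉ S := by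
  classical
  obtain ⟨h1, h2, h3⟩ := runEnd_spec he
  have hne : (S.filter fun z => z ≤ e ∧ ∀ t, z ≤ t → t ≤ e → t ∈ S).Nonempty :=
    ⟨e, mem_filter.2 ⟨he, le_rfl, fun t ht ht' => le_antisymm ht' ht ▸ he⟩⟩
  obtain ⟨hx1, hx2, hx3⟩ := mem_filter.1 (min'_mem _ hne)
  set x := min' _ hne with hx
  refine ⟨x, runEnd S e, hx2, h2, fun z hz => ?_, fun hc => ?_, (mem_runEnds.1 h1).2⟩
  · rw [mem_Icc] at hz
    rcases le_total z e with h | h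
    · exact hx3 z hz.1 h
    · exact h3 z h hz.2
  · have : x ≤ x - 1 := min'_le _ _ (mem_filter.2 ⟨hc, by omega, fun t ht ht' => by
      by_cases h : t = x - 1
      · exact h ▸ hc
      · exact hx3 t (by omega) ht'⟩)
    omega

lemma mem_component {S : Finset ℤ} {e f x y : ℤ} (hxe : x ≤ e) (hey : e ≤ y) (hs : Icc x y ⊆ S)
    (hx : x - 1 ∉ S) (hy : y + 1 ∉ S) (hf : f ∈ S) (h : runEnd S f = runEnd S e) :
    f ∈ Icc x y := by
  have he : e ∈ S := hs (mem_Icc.2 ⟨hxe, hey⟩)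
  rw [mem_Icc]
  by_contra hc
  rcases (by omega : f < x ∨ y < f) with h' | h'
  · exact hx (Icc_subset_of_runEnd_eq hf he h (by omega) (by omega))
  · exact hy (Icc_subset_of_runEnd_eq he hf h.symm (by omega) (by omega))

lemma nc_Icc {x y : ℤ} (h : x ≤ y) : nc (Icc x y) = 1 := by
  unfold nc
  rw [card_eq_one]
  refine ⟨y, ?_⟩
  ext e
  simp only [mem_runEnds, mem_Icc, mem_singleton]
  omega

lemma exists_eq_Icc {S : Finset ℤ} (h : nc S = 1) : ∃ x y, x ≤ y ∧ S = Icc x y := by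
  obtain ⟨r, hr⟩ := card_eq_one.1 h
  have hrS : r ∈ S := (mem_runEnds.1 (hr ▸ mem_singleton_self r)).1
  obtain ⟨x, y, h1, h2, h3, h4, h5⟩ := exists_component hrS
  refine ⟨x, y, h1.trans h2, Subset.antisymm (fun f hf => ?_) h3⟩
  refine mem_component h1 h2 h3 h4 h5 hf ?_
  have e1 := (runEnd_spec hf).1
  have e2 := (runEnd_spec hrS).1
  rw [hr, mem_singleton] at e1 e2
  rw [e1, e2]

lemma exists_large_component {S : Finset ℤ} (h : S.Nonempty) : ∃ x y, x ≤ y ∧ Icc x y ⊆ S ∧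
    x - 1 ∉ S ∧ y + 1 ∉ S ∧ (S.card : ℤ) ≤ nc S * (y + 1 - x) := by
  have hne : (runEnds S).Nonempty := by
    obtain ⟨e, he⟩ := h
    exact ⟨_, (runEnd_spec he).1⟩
  obtain ⟨r, hr, hmax⟩ := exists_max_image (runEnds S)
    (fun r => (S.filter fun e => runEnd S e = r).card) hne
  have hrS := (mem_runEnds.1 hr).1
  obtain ⟨x, y, h1, h2, h3, h4, h5⟩ := exists_component hrS
  refine ⟨x, y, h1.trans h2, h3, h4, h5, ?_⟩
  have hc : S.card ≤ nc S * (S.filter fun e => runEnd S e = r).card := by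
    rw [card_eq_sum_card_fiberwise (f := runEnd S) (t := runEnds S)
      fun e he => (runEnd_spec he).1]
    exact sum_le_card_nsmul _ _ _ hmax
  have hsub : (S.filter fun e => runEnd S e = r) ⊆ Icc x y := fun f hf => by
    obtain ⟨hf1, hf2⟩ := mem_filter.1 hf
    exact mem_component h1 h2 h3 h4 h5 hf1 (hf2.trans (runEnd_self hr).symm)
  have hc2 := card_le_card hsub
  rw [Int.card_Icc] at hc2
  have hc3 : ((S.filter fun e => runEnd S e = r).card : ℤ) ≤ y + 1 - x := by omega
  calc (S.card : ℤ) ≤ nc S * ((S.filter fun e => runEnd S e = r).card : ℤ) := by exact_mod_cast hc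
    _ ≤ nc S * (y + 1 - x) := mul_le_mul_of_nonneg_left hc3 (by positivity)

lemma compat_Icc {S : Finset ℤ} {x y : ℤ} (hx : x - 1 ∉ S) (hy : y + 1 ∉ S) :
    Compat (· ∈ Icc x y) S := by
  intro e he he'
  have h1 : e ≠ x - 1 := fun hc => hx (hc ▸ he)
  have h2 : e ≠ y := fun hc => hy (hc ▸ he')
  simp only [mem_Icc]
  omega

lemma nc_component {S : Finset ℤ} {p : ℤ → Prop} [DecidablePred p] (hp : Compat p S) {x y : ℤ}
    (hxy : x ≤ y) (hs : Icc x y ⊆ S) (hx : x - 1 ∉ S) (hy : y + 1 ∉ S) :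
    nc (S.filter fun e => e ∉ Icc x y) + 1 =
      nc (S.filter p) + nc (S.filter fun e => ¬ p e) := by
  have h1 := nc_filter_add (compat_Icc hx hy)
  have h2 := nc_filter_add hp
  rw [filter_mem_eq_inter, inter_eq_right.2 hs, nc_Icc hxy] at h1
  omega

lemma nc_inter_Icc_le (S : Finset ℤ) (a b : ℤ) : nc (S.filter (· ∈ Icc a b)) ≤ nc S := by
  unfold nc
  refine card_le_card_of_injOn (runEnd S) (fun e he => ?_) fun e he f hf hef => ?_
  · exact (runEnd_spec (mem_filter.1 (mem_runEnds.1 he).1).1).1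
  · have he := mem_runEnds.1 he
    have hf := mem_runEnds.1 hf
    simp only [mem_filter, mem_Icc] at he hf
    rcases lt_trichotomy e f with h | h | h
    · exact absurd ⟨Icc_subset_of_runEnd_eq he.1.1 hf.1.1 hef (x := e + 1) (by omega) (by omega),
        by omega, by omega⟩ he.2
    · exact h
    · exact absurd ⟨Icc_subset_of_runEnd_eq hf.1.1 he.1.1 hef.symm (x := f + 1) (by omega)
        (by omega), by omega, by omega⟩ hf.2

lemma nc_free_filter_le {p : ℤ → Prop} [DecidablePred p] {B U : Finset ℤ} :
    nc ((free B U).filter p) ≤ nc (B.filter p) := by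
  refine card_le_card fun e he => ?_
  simp only [mem_runEnds, mem_filter, not_and] at he ⊢
  refine ⟨⟨free_subset _ _ he.1.1, he.1.2⟩, fun h => he.2 ?_⟩
  by_contra hc
  have := free_apart_sdiff B U e he.1.1 (e + 1) (mem_sdiff.2 ⟨h, hc⟩)
  omega

/-- The greedy exposure, starting from a chosen sub-label and a pending label. -/
lemma exists_greedy_from {A B : Finset ℤ} {C : ℤ → Finset ℤ} (hC : ∀ e ∈ A, e ∈ C e ∧ C e ⊆ A)
    {h : ℤ} (hh : h ∈ A) (p : ℤ → Prop) [DecidablePred p] (hp : Compat p (A ∪ B))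
    {L : List (Finset ℤ)} {g : ℕ} (hg : Gain (A ∪ B) L g) :
    ∃ (us : List ℤ) (U' : Finset ℤ) (γ γ₁ γ₂ : ℕ),
      (∀ e ∈ us, e ∈ A) ∧ us.length ≤ γ ∧ γ₁ + γ₂ = γ ∧ C h ∪ B ⊆ U' ∧ U' ⊆ A ∪ B ∧
      (∀ e ∈ A, e ∉ free (C e) U') ∧ Gain (C h ∪ B) (us.map C ++ L) (γ + g) ∧
      nc (U'.filter p) ≤ nc ((C h ∪ B).filter p) + γ₁ ∧
      nc ((A ∪ B).filter fun e => ¬ p e) ≤ nc ((C h ∪ B).filter fun e => ¬ p e) + γ₂ ∧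
      ∀ x ∈ U', x ∈ C h ∪ B ∨ ∃ e ∈ us, x ∈ C e := by
  have hU : C h ∪ B ∪ A = A ∪ B := by
    rw [union_right_comm, union_eq_right.2 (hC h hh).2]
  have hp' : Compat p (C h ∪ B ∪ A) := by rwa [hU]
  obtain ⟨us, U', γ, γ₁, γ₂, h1, h2, h3, h4, h5, h6, h7, h8, h9, h10⟩ :=
    exists_greedy A C hC (C h ∪ B) p hp'
  have := nc_le_of_blocked hC hp'.not h4 h5 h6
  rw [hU] at this h5
  exact ⟨us, U', γ, γ₁, γ₂, h1, h2, h3, h4, h5, h6, h7 L g (hg.mono h5), h8, this.trans h9, h10⟩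

/-- The potential in the regime `k ^ (1 / d)` bounded. -/
noncomputable def logPot (d : ℕ) (m : ℝ) : ℝ := max 0 ((Real.logb 2 m - 4 - d / 2) / 16)

lemma logPot_nonneg (d : ℕ) (m : ℝ) : 0 ≤ logPot d m := le_max_left _ _

lemma logPot_eq_zero {d : ℕ} {m : ℝ} (h0 : 0 < m) (h : m ≤ 16) : logPot d m = 0 := by
  refine max_eq_left ?_
  have : Real.logb 2 m ≤ 4 := by
    rw [Real.logb_le_iff_le_rpow (by norm_num) h0]
    norm_num
    exact h
  have : (0 : ℝ) ≤ d := Nat.cast_nonneg d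
  linarith

lemma logPot_step {d : ℕ} {m m' j : ℝ} (h0 : 0 < m) (hj : 0 ≤ j) (h : m ≤ 2 ^ j * m') :
    logPot (d + 1) m ≤ logPot d m' + j / 16 := by
  have hm' : 0 < m' := by
    by_contra hc
    have : (0 : ℝ) < 2 ^ j := Real.rpow_pos_of_pos (by norm_num) _
    nlinarith
  have hl : Real.logb 2 m ≤ j + Real.logb 2 m' := by
    have h1 : Real.logb 2 (2 ^ j * m') = j + Real.logb 2 m' := by
      rw [Real.logb_mul (Real.rpow_pos_of_pos (by norm_num) _).ne' hm'.ne',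
        Real.logb_rpow (by norm_num) (by norm_num)]
    rw [← h1]
    exact Real.logb_le_logb_of_le (by norm_num) h0 h
  refine max_le (by have := logPot_nonneg d m'; linarith) ?_
  have : (Real.logb 2 m' - 4 - d / 2) / 16 ≤ logPot d m' := le_max_right _ _
  push_cast
  linarith

lemma logPot_step_of_le {d : ℕ} {m m' : ℝ} (h0 : 0 < m) (h : 3 * m ≤ 4 * m') :
    logPot (d + 1) m ≤ logPot d m' := by
  have hm' : 0 < m' := by linarith
  have h2 : m ≤ 2 ^ (1 / 2 : ℝ) * m' := by
    have : (4 / 3 : ℝ) ≤ 2 ^ (1 / 2 : ℝ) := by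
      rw [← Real.sqrt_eq_rpow]
      exact Real.le_sqrt_of_sq_le (by norm_num)
    nlinarith
  have hl : Real.logb 2 m ≤ 1 / 2 + Real.logb 2 m' := by
    have h1 : Real.logb 2 (2 ^ (1 / 2 : ℝ) * m') = 1 / 2 + Real.logb 2 m' := by
      rw [Real.logb_mul (Real.rpow_pos_of_pos (by norm_num) _).ne' hm'.ne',
        Real.logb_rpow (by norm_num) (by norm_num)]
    rw [← h1]
    exact Real.logb_le_logb_of_le (by norm_num) h0 h2
  refine max_le (logPot_nonneg d m') (le_trans ?_ (le_max_right _ _))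
  push_cast
  linarith

/-- The value of following a label that has an interval component. -/
def WinInterval (d : ℕ) : Prop := ∀ (A : Finset ℤ) (x y : ℤ) (L : List (Finset ℤ)) (g : ℕ) (v : ℝ),
  x ≤ y → Icc x y ⊆ A → x - 1 ∉ A → y + 1 ∉ A → Gain A L g →
  v ≤ 3 * nc (A.filter fun e => e ∉ Icc x y) + logPot d (y + 1 - x : ℤ) + 6 * (g : ℝ) →
  Win d A L v

/-- The value of following a label while an adjacent label is pending. -/
def WinPending (d : ℕ) : Prop := ∀ (A B : Finset ℤ) (p : ℤ → Prop) [DecidablePred p]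
  (u v w₁ w₂ j₁ j₂ : ℤ) (L : List (Finset ℤ)) (g : ℕ) (val : ℝ),
  Compat p (A ∪ B) → A.filter p = Icc u v → B.filter p = Icc j₁ j₂ → j₁ ≤ j₂ → w₁ ≤ w₂ →
  u ≤ w₁ → w₂ ≤ v → ((w₂ = v ∧ j₂ + 1 < w₁) ∨ (w₁ = u ∧ w₂ + 1 < j₁)) → Gain (A ∪ B) L g →
  val ≤ 3 * nc ((A ∪ B).filter fun e => ¬ p e) + logPot d (w₂ + 1 - w₁ : ℤ) + 3 / 2 +
    6 * (g : ℝ) → Win d A (B :: L) val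

lemma WinInterval.follow {d : ℕ} (hA : WinInterval d) {S : Finset ℤ} {p : ℤ → Prop}
    [DecidablePred p] (hp : Compat p S) {x y : ℤ} (hxy : x ≤ y) (hs : Icc x y ⊆ S)
    (hx : x - 1 ∉ S) (hy : y + 1 ∉ S) {L : List (Finset ℤ)} {g : ℕ} (hg : Gain S L g) {v : ℝ}
    (hv : v ≤ 3 * nc (S.filter fun e => ¬ p e) + 3 * (nc (S.filter p) - 1) +
      logPot d (y + 1 - x : ℤ) + 6 * (g : ℝ)) : Win d S L v := by
  refine hA S x y L g v hxy hs hx hy hg ?_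
  have := nc_component hp hxy hs hx hy
  have : (nc (S.filter fun e => e ∉ Icc x y) : ℝ) + 1 =
      nc (S.filter p) + nc (S.filter fun e => ¬ p e) := by exact_mod_cast this
  linarith

lemma winInterval_zero : WinInterval 0 := by
  intro A x y L g v hxy hs hx hy hg hv
  by_cases hA : 2 ≤ A.card
  · exact Or.inl hA
  refine Or.inr ⟨g, hg, ?_⟩
  have hxA : x ∈ A := hs (mem_Icc.2 ⟨le_rfl, hxy⟩)
  have hyA : y ∈ A := hs (mem_Icc.2 ⟨hxy, le_rfl⟩)
  obtain rfl : x = y := by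
    by_contra hc
    exact hA (one_lt_card.2 ⟨x, hxA, y, hyA, hc⟩)
  have h0 : (A.filter fun e => e ∉ Icc x x) = ∅ := by
    refine filter_eq_empty_iff.2 fun e he => ?_
    by_contra hc
    refine hA (one_lt_card.2 ⟨x, hxA, e, he, fun h => hc (mem_Icc.2 ⟨h.le, h.ge⟩)⟩)
  rw [h0, logPot_eq_zero (by simp) (by simp)] at hv
  simp [nc, runEnds] at hv
  linarith

lemma winPending_zero : WinPending 0 := by
  intro A B p _ u v w₁ w₂ j₁ j₂ L g val hp hA hB hj hw hu hv ho hg hval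
  by_cases hA2 : 2 ≤ A.card
  · exact Or.inl hA2
  have huA : ∀ z ∈ Icc u v, z ∈ A := fun z hz => (mem_filter.1 (hA ▸ hz)).1
  have hall : ∀ z ∈ A, z = u := by
    intro z hz
    by_contra hc
    exact hA2 (one_lt_card.2 ⟨u, huA u (mem_Icc.2 ⟨le_rfl, by omega⟩), z, hz, fun h => hc h.symm⟩)
  have hvu : v = u := hall v (huA v (mem_Icc.2 ⟨by omega, le_rfl⟩))
  have hpu : p u := (mem_filter.1 (hA.symm ▸ mem_Icc.2 ⟨le_rfl, by omega⟩ : u ∈ A.filter p)).2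
  refine Or.inr ⟨_, hg.cons_free, ?_⟩
  have hAn : (A.filter fun e => ¬ p e) = ∅ :=
    filter_eq_empty_iff.2 fun e he => by rw [hall e he]; exact not_not.2 hpu
  have h1 := nc_union_le hp.not
  rw [hAn] at h1
  have h1' : nc ((A ∪ B).filter fun e => ¬ p e) ≤ nc ((free B A).filter fun e => ¬ p e) := by
    simpa [nc, runEnds] using h1
  have hpB : Compat p B := hp.mono subset_union_right
  have h2 := nc_filter_add (hpB.mono (free_subset B A))
  have h3 : 1 ≤ nc ((free B A).filter p) := by
    have hj1 : j₁ ∈ B.filter p := hB.symm ▸ mem_Icc.2 ⟨le_rfl, hj⟩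
    obtain ⟨hj1B, hpj⟩ := mem_filter.1 hj1
    refine nc_pos ⟨j₁, mem_filter.2 ⟨mem_free.2 ⟨hj1B, fun f hf hr z hz => ?_⟩, hpj⟩⟩
    have hpf := (hpB.runEnd_eq hf hj1B hr).2 hpj
    have : f ∈ Icc j₁ j₂ := hB ▸ mem_filter.2 ⟨hf, hpf⟩
    rw [mem_Icc] at this
    rw [hall z hz]
    omega
  obtain rfl : w₁ = w₂ := by omega
  rw [logPot_eq_zero (by simp) (by simp)] at hval
  have r1 : (nc ((A ∪ B).filter fun e => ¬ p e) : ℝ) ≤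
    nc ((free B A).filter fun e => ¬ p e) := by exact_mod_cast h1'
  have r2 : (nc ((free B A).filter p) : ℝ) + nc ((free B A).filter fun e => ¬ p e) =
    nc (free B A) := by exact_mod_cast h2
  have r3 : (1 : ℝ) ≤ nc ((free B A).filter p) := by exact_mod_cast h3
  have r4 : (0 : ℝ) ≤ nc ((free B A).filter fun e => ¬ p e) := Nat.cast_nonneg _
  push_cast
  linarith

lemma sq_le_two_rpow (s : ℕ) {a j : ℝ} (ha : a ≤ 2 ^ j) :
    a * ((s : ℝ) + 1) ^ 2 ≤ 2 ^ (j + 2 * s) := by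
  have h1 : (s : ℝ) + 1 ≤ 2 ^ (s : ℝ) := by
    rw [Real.rpow_natCast]
    exact_mod_cast Nat.lt_two_pow_self (n := s)
  have h2 : ((s : ℝ) + 1) ^ 2 ≤ 2 ^ (2 * (s : ℝ)) := by
    rw [mul_comm, Real.rpow_mul (by norm_num), Real.rpow_two]
    gcongr
  rw [Real.rpow_add (by norm_num)]
  have : (0 : ℝ) ≤ 2 ^ j := Real.rpow_nonneg (by norm_num) _
  gcongr

lemma logPot_step_sq {d s : ℕ} {m m' a j c : ℝ} (h0 : 0 < m) (hm' : 0 ≤ m') (hj : 0 ≤ j)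
    (ha : a ≤ 2 ^ j) (h : m ≤ a * ((s : ℝ) + 1) ^ 2 * m') (hc : (j + 2 * s) / 16 ≤ c) :
    logPot (d + 1) m ≤ logPot d m' + c := by
  have := logPot_step (d := d) (m' := m') (j := j + 2 * s) h0 (by positivity)
    (h.trans (mul_le_mul_of_nonneg_right (sq_le_two_rpow s ha) hm'))
  linarith

lemma winInterval_succ {d : ℕ} (hA : WinInterval d) (hB : WinPending d) : WinInterval (d + 1) := by
  intro A p q L g v hpq hsub hp1 hq1 hg hv C hC
  have hP : Compat (· ∈ Icc p q) A := compat_Icc hp1 hq1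
  have hAP : A.filter (· ∈ Icc p q) = Icc p q := by
    rw [filter_mem_eq_inter, inter_eq_right.2 hsub]
  have hpA : p ∈ A := hsub (mem_Icc.2 ⟨le_rfl, hpq⟩)
  have hqA : q ∈ A := hsub (mem_Icc.2 ⟨hpq, le_rfl⟩)
  have hPp : p ∈ Icc p q := mem_Icc.2 ⟨le_rfl, hpq⟩
  have hPq : q ∈ Icc p q := mem_Icc.2 ⟨hpq, le_rfl⟩
  obtain ⟨m, hm⟩ : ∃ m : ℤ, m = q + 1 - p := ⟨_, rfl⟩
  have hmr : (m : ℝ) = q + 1 - p := by rw [hm]; push_cast; ring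
  rw [← hm] at hv
  have hm0 : 0 < m := by omega
  have hm0r : (0 : ℝ) < m := by exact_mod_cast hm0
  -- following an arbitrary sub-label
  have follow : ∀ e ∈ A, ∀ x y : ℤ, x ≤ y → Icc x y ⊆ C e → x - 1 ∉ C e → y + 1 ∉ C e →
      ∀ (us : List ℤ) (γ γ₂ : ℕ), (∀ e ∈ us, e ∈ A) → us.length ≤ γ → γ₂ ≤ γ →
      Gain (C e) (us.map C ++ L) (γ + g) →
      nc (A.filter fun e => ¬ e ∈ Icc p q) ≤ nc ((C e).filter fun e => ¬ e ∈ Icc p q) + γ₂ →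
      logPot (d + 1) m ≤ logPot d (y + 1 - x : ℤ) +
        (3 * ((nc ((C e).filter (· ∈ Icc p q)) : ℝ) - 1) + 2 * γ) →
      ∃ h ∈ A, ∃ us : List ℤ, (∀ e ∈ us, e ∈ A) ∧ ∃ L1 L2, L = L1 ++ L2 ∧
        Win d (C h) (L1 ++ (us.map C ++ L2)) (v + us.length) := by
    intro e heA x y hxy hs hx hy us γ γ₂ hus h1 h2 hgain hnc hpot
    refine ⟨e, heA, us, hus, [], L, rfl, ?_⟩
    refine hA.follow (hP.mono (hC e heA).2) hxy hs hx hy hgain ?_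
    have r1 : (us.length : ℝ) ≤ γ := by exact_mod_cast h1
    have r2 : (γ₂ : ℝ) ≤ γ := by exact_mod_cast h2
    have r3 : (nc (A.filter fun e => ¬ e ∈ Icc p q) : ℝ) ≤
      nc ((C e).filter fun e => ¬ e ∈ Icc p q) + γ₂ := by exact_mod_cast hnc
    push_cast at hpot ⊢
    linarith
  have hgA : Gain (A ∪ ∅) L g := by rwa [union_empty]
  have hPA : Compat (· ∈ Icc p q) (A ∪ ∅) := by rwa [union_empty]
  obtain ⟨h, hhA, hmax⟩ := exists_max_image A (fun e => ((C e).filter (· ∈ Icc p q)).card) ⟨p, hpA⟩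
  set b := ((C h).filter (· ∈ Icc p q)).card with hb
  have hbpos : 1 ≤ b := by
    refine le_trans ?_ (hmax p hpA)
    exact card_pos.2 ⟨p, mem_filter.2 ⟨(hC p hpA).1, hPp⟩⟩
  obtain ⟨us, U', γ, γ₁, γ₂, h1, h2, h3, h4, h5, h6, h7, h8, h9, h10⟩ :=
    exists_greedy_from hC hhA _ hPA hgA
  simp only [union_empty] at h4 h5 h7 h8 h9 h10
  have hUA : C h ∪ A = A := union_eq_right.2 (hC h hhA).2
  have hcard := card_le_of_blocked (U := C h) hC (by rwa [hUA]) (by rwa [hUA]) h6 hmax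
  have hcard2 := card_filter_le_add_mul h10 (· ∈ Icc p q) fun e he => hmax e (h1 e he)
  have hCne : ((C h).filter (· ∈ Icc p q)).Nonempty := card_pos.1 hbpos
  set n := nc ((C h).filter (· ∈ Icc p q)) with hn
  have hnpos : 1 ≤ n := nc_pos hCne
  have hmb : m ≤ 3 * (n + γ) * b := by
    rw [hAP, Int.card_Icc] at hcard
    have e1 : b * us.length ≤ b * γ := Nat.mul_le_mul_left _ h2
    have e2 : 2 * b * nc (U'.filter (· ∈ Icc p q)) ≤ 2 * b * (n + γ) :=
      Nat.mul_le_mul_left _ (by omega)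
    have e3 : b * 1 ≤ b * n := Nat.mul_le_mul_left _ hnpos
    have e4 : (q + 1 - p).toNat ≤ 3 * (n + γ) * b := by nlinarith
    have e5 : ((q + 1 - p).toNat : ℤ) ≤ ((3 * (n + γ) * b : ℕ) : ℤ) := by exact_mod_cast e4
    push_cast at e5
    omega
  have hPC : Compat (· ∈ Icc p q) (C h) := hP.mono (hC h hhA).2
  -- components inside the region are components
  have hcomp : ∀ e ∈ A, ∀ x y : ℤ, x ≤ y → Icc x y ⊆ (C e).filter (· ∈ Icc p q) →
      x - 1 ∉ (C e).filter (· ∈ Icc p q) → y + 1 ∉ (C e).filter (· ∈ Icc p q) →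
      Icc x y ⊆ C e ∧ x - 1 ∉ C e ∧ y + 1 ∉ C e := by
    intro e heA x y hxy hs hx hy
    have hx' := mem_filter.1 (hs (mem_Icc.2 ⟨le_rfl, hxy⟩))
    have hy' := mem_filter.1 (hs (mem_Icc.2 ⟨hxy, le_rfl⟩))
    have hPe := hP.mono (hC e heA).2
    refine ⟨hs.trans (filter_subset _ _), fun hc => hx (mem_filter.2 ⟨hc, ?_⟩), fun hc =>
      hy (mem_filter.2 ⟨hc, ?_⟩)⟩
    · exact (hPe.adj hx'.1 hc (by omega)).1 hx'.2
    · exact (hPe.adj hy'.1 hc (by omega)).1 hy'.2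
  obtain ⟨x, y, hxy, hs, hx, hy, hlen⟩ := exists_large_component hCne
  obtain ⟨hsC, hxC, hyC⟩ := hcomp h hhA x y hxy hs hx hy
  obtain ⟨ℓ, hℓ⟩ : ∃ ℓ : ℤ, ℓ = y + 1 - x := ⟨_, rfl⟩
  have hℓ0 : 0 < ℓ := by omega
  have hℓ0r : (0 : ℝ) < ℓ := by exact_mod_cast hℓ0
  rw [← hb, ← hn, ← hℓ] at hlen
  have r5 : (m : ℝ) ≤ 3 * (n + γ) * b := by exact_mod_cast hmb
  have r6 : (1 : ℝ) ≤ n := by exact_mod_cast hnpos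
  have r7 : (b : ℝ) ≤ n * ℓ := by exact_mod_cast hlen
  by_cases hs0 : n = 1 ∧ γ = 0
  swap
  · obtain ⟨s, hs'⟩ : ∃ s, n + γ = s + 1 := ⟨n + γ - 1, by omega⟩
    have hs1 : 1 ≤ s := by omega
    have r8 : (1 : ℝ) ≤ s := by exact_mod_cast hs1
    have r9 : (n : ℝ) + γ = s + 1 := by exact_mod_cast hs'
    refine follow h hhA x y hxy hsC hxC hyC us γ γ₂ h1 h2 (by omega) h7 h9 ?_
    rw [← hℓ]
    refine logPot_step_sq (s := s) (a := 3) (j := 2) hm0r hℓ0r.le (by norm_num)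
      (by norm_num) ?_ ?_
    · rw [r9] at r5
      have : (n : ℝ) ≤ s + 1 := by have : (0 : ℝ) ≤ γ := Nat.cast_nonneg _
                                   linarith
      calc (m : ℝ) ≤ 3 * (s + 1) * b := r5
        _ ≤ 3 * (s + 1) * ((s + 1) * ℓ) := by
          refine mul_le_mul_of_nonneg_left (r7.trans ?_) (by positivity)
          gcongr
        _ = _ := by ring
    · have : (0 : ℝ) ≤ n - 1 := by linarith
      linarith
  obtain ⟨hn1, hγ0⟩ := hs0
  by_cases hbig : m ≤ 16 ∨ 3 * m ≤ 4 * ℓ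
  · refine follow h hhA x y hxy hsC hxC hyC us γ γ₂ h1 h2 (by omega) h7 h9 ?_
    rw [← hℓ, ← hn, hn1, hγ0]
    have := logPot_nonneg d ℓ
    rcases hbig with hm16 | hm34
    · rw [logPot_eq_zero hm0r (by exact_mod_cast hm16)]
      simpa using this
    · have := logPot_step_of_le (d := d) hm0r (m' := ℓ) (by exact_mod_cast hm34)
      simpa using this
  push Not at hbig
  obtain ⟨hm16, hm34⟩ := hbig
  obtain ⟨x', y', hxy', hH⟩ := exists_eq_Icc (hn ▸ hn1)
  have hxx : x' = x ∧ y' = y := by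
    rw [hH] at hs hx hy
    have e1 := hs (mem_Icc.2 ⟨le_rfl, hxy⟩)
    have e2 := hs (mem_Icc.2 ⟨hxy, le_rfl⟩)
    simp only [mem_Icc] at e1 e2 hx hy
    omega
  obtain ⟨rfl, rfl⟩ := hxx
  have hus : us = [] := List.eq_nil_of_length_eq_zero (by omega)
  have hU' : ∀ z ∈ U', z ∈ C h := by
    intro z hz
    rcases h10 z hz with h' | ⟨e, he, _⟩
    · exact h'
    · rw [hus] at he; simp at he
  have hxin : x' ∈ Icc p q ∧ y' ∈ Icc p q :=
    ⟨(mem_filter.1 (hs (mem_Icc.2 ⟨le_rfl, hxy⟩))).2, (mem_filter.1 (hs (mem_Icc.2 ⟨hxy, le_rfl⟩))).2⟩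
  simp only [mem_Icc] at hxin
  -- a sub-label with a long component next to the component of `C h`
  have fin : ∀ e ∈ A, ∀ z₁ z₂ w₁ w₂ : ℤ, z₁ ≤ z₂ → Icc z₁ z₂ ⊆ (C e).filter (· ∈ Icc p q) →
      z₁ - 1 ∉ (C e).filter (· ∈ Icc p q) → z₂ + 1 ∉ (C e).filter (· ∈ Icc p q) →
      m ≤ 16 * (w₂ + 1 - w₁) → m ≤ 8 * (z₂ + 1 - z₁) → z₁ ≤ w₁ → w₂ ≤ z₂ →
      ((w₂ = z₂ ∧ y' + 1 < w₁) ∨ (w₁ = z₁ ∧ w₂ + 1 < x')) →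
      ∃ h ∈ A, ∃ us : List ℤ, (∀ e ∈ us, e ∈ A) ∧ ∃ L1 L2, L = L1 ++ L2 ∧
        Win d (C h) (L1 ++ (us.map C ++ L2)) (v + us.length) := by
    intro e heA z₁ z₂ w₁ w₂ hz hzs hz1 hz2 hw hmz hzw hwz ho
    obtain ⟨hsE, hz1E, hz2E⟩ := hcomp e heA z₁ z₂ hz hzs hz1 hz2
    have hzne : ((C e).filter (· ∈ Icc p q)).Nonempty := ⟨z₁, hzs (mem_Icc.2 ⟨le_rfl, hz⟩)⟩
    rcases (Nat.lt_or_ge (nc ((C e).filter (· ∈ Icc p q))) 2) with hlt | hge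
    · have hnc1 : nc ((C e).filter (· ∈ Icc p q)) = 1 := by have := nc_pos hzne; omega
      obtain ⟨x'', y'', hxy'', hH'⟩ := exists_eq_Icc hnc1
      have hzz : x'' = z₁ ∧ y'' = z₂ := by
        rw [hH'] at hzs hz1 hz2
        have e1 := hzs (mem_Icc.2 ⟨le_rfl, hz⟩)
        have e2 := hzs (mem_Icc.2 ⟨hz, le_rfl⟩)
        simp only [mem_Icc] at e1 e2 hz1 hz2
        omega
      obtain ⟨rfl, rfl⟩ := hzz
      have hAh : A ∪ C h = A := union_eq_left.2 (hC h hhA).2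
      obtain ⟨us', U'', γ', γ₁', γ₂', k1, k2, k3, k4, k5, k6, k7, k8, k9, k10⟩ :=
        exists_greedy_from (B := C h) hC heA (· ∈ Icc p q) (by rwa [hAh]) (by rwa [hAh])
      refine ⟨e, heA, h :: us', ?_, [], L, rfl, ?_⟩
      · intro z hz
        rcases List.mem_cons.1 hz with rfl | hz
        · exact hhA
        · exact k1 z hz
      rw [hAh] at k9
      refine hB (C e) (C h) (· ∈ Icc p q) x'' y'' w₁ w₂ x' y' _ _ _ ?_ hH' hH hxy (by omega) hzw
        hwz ho k7 ?_
      · exact hP.mono (union_subset (hC e heA).2 (hC h hhA).2)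
      have r1 : (us'.length : ℝ) ≤ γ' := by exact_mod_cast k2
      have r2 : (γ₂' : ℝ) ≤ γ' := by exact_mod_cast (by omega : γ₂' ≤ γ')
      have r3 : (nc (A.filter fun e => ¬ e ∈ Icc p q) : ℝ) ≤
        nc ((C e ∪ C h).filter fun e => ¬ e ∈ Icc p q) + γ₂' := by exact_mod_cast k9
      have r4 : (m : ℝ) ≤ 16 * (w₂ + 1 - w₁ : ℤ) := by exact_mod_cast hw
      have r5 := logPot_step (d := d) (m := m) (m' := (w₂ + 1 - w₁ : ℤ)) (j := 4) hm0r
        (by norm_num) (by norm_num; push_cast at r4; linarith)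
      rw [List.length_cons]
      push_cast at r5 ⊢
      linarith
    · obtain ⟨us', U'', γ', γ₁', γ₂', k1, k2, k3, k4, k5, k6, k7, k8, k9, k10⟩ :=
        exists_greedy_from hC heA _ hPA hgA
      simp only [union_empty] at k7 k9
      refine follow e heA z₁ z₂ hz hsE hz1E hz2E us' γ' γ₂' k1 k2 (by omega) k7 k9 ?_
      have r4 : (m : ℝ) ≤ 8 * (z₂ + 1 - z₁ : ℤ) := by exact_mod_cast hmz
      have r5 := logPot_step (d := d) (m := m) (m' := (z₂ + 1 - z₁ : ℤ)) (j := 3) hm0r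
        (by norm_num) (by norm_num; push_cast at r4; linarith)
      have r6 : (2 : ℝ) ≤ nc ((C e).filter (· ∈ Icc p q)) := by exact_mod_cast hge
      have r7 : (0 : ℝ) ≤ γ' := Nat.cast_nonneg _
      linarith
  -- the component of an endpoint touches the component of `C h`
  have touch : ∀ e ∈ A, e ∈ Icc p q → ∃ z₁ z₂ f u, z₁ ≤ e ∧ e ≤ z₂ ∧
      Icc z₁ z₂ ⊆ (C e).filter (· ∈ Icc p q) ∧
      z₁ - 1 ∉ (C e).filter (· ∈ Icc p q) ∧ z₂ + 1 ∉ (C e).filter (· ∈ Icc p q) ∧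
      z₁ ≤ f ∧ f ≤ z₂ ∧ x' ≤ u ∧ u ≤ y' ∧ ¬ (f + 1 < u ∨ u + 1 < f) := by
    intro e heA heP
    obtain ⟨f, hf, hr, u, hu, hfu⟩ := exists_adj_of_not_mem_free (hC e heA).1 (h6 e heA)
    obtain ⟨z₁, z₂, hz1, hz2, hz3, hz4, hz5⟩ := exists_component (hC e heA).1
    have hPe := hP.mono (hC e heA).2
    have hfz := mem_component hz1 hz2 hz3 hz4 hz5 hf hr
    have hfP : f ∈ Icc p q := (hPe.runEnd_eq hf (hC e heA).1 hr).2 heP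
    have huP : u ∈ Icc p q := (hP.adj ((hC e heA).2 hf) (h5 hu) hfu).1 hfP
    have huH : u ∈ Icc x' y' := hH ▸ mem_filter.2 ⟨hU' u hu, huP⟩
    rw [mem_Icc] at hfz huH
    refine ⟨z₁, z₂, f, u, hz1, hz2, fun z hz => mem_filter.2 ⟨hz3 hz, ?_⟩,
      fun hc => hz4 (filter_subset _ _ hc), fun hc => hz5 (filter_subset _ _ hc), hfz.1, hfz.2,
      huH.1, huH.2, hfu⟩
    rw [mem_Icc] at hz
    rcases le_total z e with hze | hze
    · exact (hPe.Icc hze fun t ht ht' => hz3 (mem_Icc.2 ⟨by omega, by omega⟩)).2 heP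
    · exact (hPe.Icc hze fun t ht ht' => hz3 (mem_Icc.2 ⟨by omega, by omega⟩)).1 heP
  rcases (by omega : m ≤ 8 * (q - y') ∨ m ≤ 8 * (x' - p)) with hside | hside
  · obtain ⟨z₁, z₂, f, u, t1, t2, t3, t4, t5, t6, t7, t8, t9, t10⟩ := touch q hqA hPq
    have hz2 := (mem_filter.1 (t3 (mem_Icc.2 ⟨t1.trans t2, le_rfl⟩))).2
    rw [mem_Icc] at hz2
    exact fin q hqA z₁ z₂ (y' + 2) z₂ (by omega) t3 t4 t5 (by omega) (by omega) (by omega)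
      le_rfl (Or.inl ⟨rfl, by omega⟩)
  · obtain ⟨z₁, z₂, f, u, t1, t2, t3, t4, t5, t6, t7, t8, t9, t10⟩ := touch p hpA hPp
    have hz1 := (mem_filter.1 (t3 (mem_Icc.2 ⟨le_rfl, t1.trans t2⟩))).2
    rw [mem_Icc] at hz1
    exact fin p hpA z₁ z₂ z₁ (x' - 2) (by omega) t3 t4 t5 (by omega) (by omega) le_rfl
      (by omega) (Or.inr ⟨rfl, by omega⟩)

lemma component_of_filter {S : Finset ℤ} {p : ℤ → Prop} [DecidablePred p] (hp : Compat p S)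
    {x y : ℤ} (hxy : x ≤ y) (hs : Icc x y ⊆ S.filter p) (hx : x - 1 ∉ S.filter p)
    (hy : y + 1 ∉ S.filter p) : Icc x y ⊆ S ∧ x - 1 ∉ S ∧ y + 1 ∉ S := by
  have hx' := mem_filter.1 (hs (mem_Icc.2 ⟨le_rfl, hxy⟩))
  have hy' := mem_filter.1 (hs (mem_Icc.2 ⟨hxy, le_rfl⟩))
  refine ⟨hs.trans (filter_subset _ _), fun hc => hx (mem_filter.2 ⟨hc, ?_⟩), fun hc =>
    hy (mem_filter.2 ⟨hc, ?_⟩)⟩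
  · exact (hp.adj hx'.1 hc (by omega)).1 hx'.2
  · exact (hp.adj hy'.1 hc (by omega)).1 hy'.2

lemma eq_component_of_nc_eq_one {S : Finset ℤ} (h : nc S = 1) {x y : ℤ} (hxy : x ≤ y)
    (hs : Icc x y ⊆ S) (hx : x - 1 ∉ S) (hy : y + 1 ∉ S) : S = Icc x y := by
  obtain ⟨x', y', hxy', rfl⟩ := exists_eq_Icc h
  have e1 := hs (mem_Icc.2 ⟨le_rfl, hxy⟩)
  have e2 := hs (mem_Icc.2 ⟨hxy, le_rfl⟩)
  simp only [mem_Icc] at e1 e2 hx hy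
  obtain rfl : x' = x := by omega
  obtain rfl : y' = y := by omega
  rfl

lemma exists_touch {S T : Finset ℤ} {p : ℤ → Prop} [DecidablePred p] (hp : Compat p (S ∪ T))
    {e : ℤ} (he : e ∈ S) (hpe : p e) (h : e ∉ free S T) : ∃ z₁ z₂ f u, z₁ ≤ e ∧ e ≤ z₂ ∧
      Icc z₁ z₂ ⊆ S.filter p ∧ z₁ - 1 ∉ S.filter p ∧ z₂ + 1 ∉ S.filter p ∧
      z₁ ≤ f ∧ f ≤ z₂ ∧ u ∈ T.filter p ∧ ¬ (f + 1 < u ∨ u + 1 < f) := by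
  obtain ⟨f, hf, hr, u, hu, hfu⟩ := exists_adj_of_not_mem_free he h
  obtain ⟨z₁, z₂, hz1, hz2, hz3, hz4, hz5⟩ := exists_component he
  have hpS : Compat p S := hp.mono subset_union_left
  have hfz := mem_component hz1 hz2 hz3 hz4 hz5 hf hr
  have hpf : p f := (hpS.runEnd_eq hf he hr).2 hpe
  have hpu : p u := (hp.adj (mem_union_left _ hf) (mem_union_right _ hu) hfu).1 hpf
  rw [mem_Icc] at hfz
  refine ⟨z₁, z₂, f, u, hz1, hz2, fun z hz => mem_filter.2 ⟨hz3 hz, ?_⟩,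
    fun hc => hz4 (filter_subset _ _ hc), fun hc => hz5 (filter_subset _ _ hc), hfz.1, hfz.2,
    mem_filter.2 ⟨hu, hpu⟩, hfu⟩
  rw [mem_Icc] at hz
  rcases le_total z e with hze | hze
  · exact (hpS.Icc hze fun t ht ht' => hz3 (mem_Icc.2 ⟨by omega, by omega⟩)).2 hpe
  · exact (hpS.Icc hze fun t ht ht' => hz3 (mem_Icc.2 ⟨by omega, by omega⟩)).1 hpe

/-- The number of edges of the active interval is controlled by the number of components. -/
lemma card_active_le {A B : Finset ℤ} {p : ℤ → Prop} [DecidablePred p] (hp : Compat p (A ∪ B))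
    {C : ℤ → Finset ℤ} (hC : ∀ e ∈ A, e ∈ C e ∧ C e ⊆ A) {h : ℤ} (hh : h ∈ A) {b : ℕ}
    (hb : ∀ e ∈ A, ((C e).filter p).card ≤ b) {u v w₁ w₂ j₁ j₂ : ℤ} (hA : A.filter p = Icc u v)
    (hB : B.filter p = Icc j₁ j₂) (hj : j₁ ≤ j₂) (hu : u ≤ w₁) (hv : w₂ ≤ v)
    (ho : (w₂ = v ∧ j₂ + 1 < w₁) ∨ (w₁ = u ∧ w₂ + 1 < j₁)) {us : List ℤ}
    {U' : Finset ℤ} {γ γ₁ : ℕ} (h1 : ∀ e ∈ us, e ∈ A) (h2 : us.length ≤ γ) (h3 : γ₁ ≤ γ)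
    (h5 : U' ⊆ A ∪ B) (h6 : ∀ e ∈ A, e ∉ free (C e) U')
    (h8 : nc (U'.filter p) ≤ nc ((C h ∪ B).filter p) + γ₁)
    (h10 : ∀ x ∈ U', x ∈ C h ∪ B ∨ ∃ e ∈ us, x ∈ C e) :
    w₂ + 1 - w₁ ≤ b * (4 + 2 * nc ((C h).filter p) + 3 * γ) := by
  have hA' : ∀ z, (z ∈ A ∧ p z) ↔ (u ≤ z ∧ z ≤ v) := fun z => by
    rw [← mem_filter, hA, mem_Icc]
  have hB' : ∀ z, (z ∈ B ∧ p z) ↔ (j₁ ≤ z ∧ z ≤ j₂) := fun z => by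
    rw [← mem_filter, hB, mem_Icc]
  have hsubU : C h ∪ B ⊆ A ∪ B := union_subset_union_left (hC h hh).2
  obtain ⟨X, hX, hXn⟩ : ∃ X : Finset ℤ, (w₂ + 1 - w₁ ≤ X.card + b) ∧
      ∀ e ∈ X, ∃ t ∈ U'.filter (· ∈ Icc w₁ w₂), e ≤ t + b ∧ t ≤ e + b := by
    have near : ∀ e, w₁ ≤ e → e ≤ w₂ → ∃ t ∈ U', p t ∧ e ≤ t + b ∧ t ≤ e + b := by
      intro e he he'
      obtain ⟨heA, hpe⟩ := (hA' e).2 ⟨by omega, by omega⟩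
      have hX : U' ∪ A ⊆ A ∪ B := union_subset h5 subset_union_left
      obtain ⟨t, ht, ht1, ht2⟩ := exists_near_of_blocked (U := A ∪ B) hC (hp.mono (union_subset
        Subset.rfl subset_union_left)) (h5.trans subset_union_left) h6 hb heA hpe
      rw [mem_filter] at ht
      exact ⟨t, ht.1, ht.2, ht1, ht2⟩
    have cases : ∀ t ∈ U', p t → (u ≤ t ∧ t ≤ v) ∨ (j₁ ≤ t ∧ t ≤ j₂) := by
      intro t ht hpt
      rcases mem_union.1 (h5 ht) with h | h
      · exact Or.inl ((hA' t).1 ⟨h, hpt⟩)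
      · exact Or.inr ((hB' t).1 ⟨h, hpt⟩)
    rcases ho with ⟨ho1, ho2⟩ | ⟨ho1, ho2⟩
    · refine ⟨Icc (w₁ + b) w₂, by rw [Int.card_Icc]; omega, fun e he => ?_⟩
      rw [mem_Icc] at he
      obtain ⟨t, ht, hpt, ht1, ht2⟩ := near e (by omega) he.2
      have := cases t ht hpt
      exact ⟨t, mem_filter.2 ⟨ht, mem_Icc.2 ⟨by omega, by omega⟩⟩, ht1, ht2⟩
    · refine ⟨Icc w₁ (w₂ - b), by rw [Int.card_Icc]; omega, fun e he => ?_⟩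
      rw [mem_Icc] at he
      obtain ⟨t, ht, hpt, ht1, ht2⟩ := near e he.1 (by omega)
      have := cases t ht hpt
      exact ⟨t, mem_filter.2 ⟨ht, mem_Icc.2 ⟨by omega, by omega⟩⟩, ht1, ht2⟩
  have hc := card_le_of_near fun e he => Or.inr (hXn e he)
  have hpw : ∀ z ∈ A, z ∈ Icc w₁ w₂ → p z := by
    intro z _ hz
    rw [mem_Icc] at hz
    exact ((hA' z).2 ⟨by omega, by omega⟩).2
  have hc2 := card_filter_le_add_mul (b := b) h10 (· ∈ Icc w₁ w₂) fun e he =>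
    (card_le_card fun z hz => by
      rw [mem_filter] at hz ⊢
      exact ⟨hz.1, hpw z ((hC e (h1 e he)).2 hz.1) hz.2⟩ : _ ≤ ((C e).filter p).card).trans
      (hb e (h1 e he))
  have hc3 : ((C h ∪ B).filter (· ∈ Icc w₁ w₂)).card ≤ b := by
    refine (card_le_card fun z hz => ?_ : _ ≤ ((C h).filter p).card).trans (hb h hh)
    rw [mem_filter] at hz ⊢
    obtain ⟨hz1, hz2⟩ := hz
    have hz3 := mem_Icc.1 hz2
    obtain ⟨hzA, hpz⟩ := (hA' z).2 ⟨by omega, by omega⟩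
    rcases mem_union.1 hz1 with hz1 | hz1
    · exact ⟨hz1, hpz⟩
    · have := (hB' z).1 ⟨hz1, hpz⟩
      omega
  have hc4 : nc (U'.filter (· ∈ Icc w₁ w₂)) ≤ nc ((C h).filter p) + 1 + γ := by
    have e1 : U'.filter (· ∈ Icc w₁ w₂) = (U'.filter p).filter (· ∈ Icc w₁ w₂) := by
      ext z
      simp only [mem_filter]
      constructor
      · rintro ⟨hz1, hz2⟩
        have hz3 := mem_Icc.1 hz2
        exact ⟨⟨hz1, ((hA' z).2 ⟨by omega, by omega⟩).2⟩, hz2⟩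
      · rintro ⟨⟨hz1, _⟩, hz2⟩
        exact ⟨hz1, hz2⟩
    have e2 := nc_union_le (hp.mono hsubU)
    have e3 := nc_free_filter_le (p := p) (B := B) (U := C h)
    rw [hB, nc_Icc hj] at e3
    have e4 := nc_inter_Icc_le (U'.filter p) w₁ w₂
    rw [e1]
    omega
  have e1 : b * us.length ≤ b * γ := Nat.mul_le_mul_left _ h2
  have e2 := Nat.mul_le_mul_left (2 * b) hc4
  have e3 : (X.card : ℤ) ≤ b + b * γ + 2 * b * (nc ((C h).filter p) + 1 + γ) := by
    exact_mod_cast hc.trans (by omega)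
  linarith

lemma winPending_succ {d : ℕ} (hI : WinInterval d) (hP : WinPending d) : WinPending (d + 1) := by
  intro A B p _ u v w₁ w₂ j₁ j₂ L g val hp hA hB hj hw hu hv ho hg hval C hC
  have hA' : ∀ z, (z ∈ A ∧ p z) ↔ (u ≤ z ∧ z ≤ v) := fun z => by
    rw [← mem_filter, hA, mem_Icc]
  have hB' : ∀ z, (z ∈ B ∧ p z) ↔ (j₁ ≤ z ∧ z ≤ j₂) := fun z => by
    rw [← mem_filter, hB, mem_Icc]
  have hpA : Compat p A := hp.mono subset_union_left
  have hpB : Compat p B := hp.mono subset_union_right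
  have hsubU : ∀ e ∈ A, C e ∪ B ⊆ A ∪ B := fun e he => union_subset_union_left (hC e he).2
  obtain ⟨w, hwd⟩ : ∃ w : ℤ, w = w₂ + 1 - w₁ := ⟨_, rfl⟩
  rw [← hwd] at hval
  have hw0 : 0 < w := by omega
  have hw0r : (0 : ℝ) < w := by exact_mod_cast hw0
  have follow : ∀ e ∈ A, ∀ x y : ℤ, x ≤ y → Icc x y ⊆ (C e).filter p →
      x - 1 ∉ (C e).filter p → y + 1 ∉ (C e).filter p →
      ∀ (us : List ℤ) (γ γ₂ : ℕ), (∀ e ∈ us, e ∈ A) → us.length ≤ γ → γ₂ ≤ γ →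
      Gain (C e ∪ B) (us.map C ++ L) (γ + g) →
      nc ((A ∪ B).filter fun e => ¬ p e) ≤ nc ((C e ∪ B).filter fun e => ¬ p e) + γ₂ →
      logPot (d + 1) w + 3 / 2 ≤ logPot d (y + 1 - x : ℤ) +
        (3 * ((nc ((C e).filter p) : ℝ) - 1) + 2 * γ) + 6 * nc ((free B (C e)).filter p) →
      ∃ h ∈ A, ∃ us : List ℤ, (∀ e ∈ us, e ∈ A) ∧ ∃ L1 L2, B :: L = L1 ++ L2 ∧
        Win d (C h) (L1 ++ (us.map C ++ L2)) (val + us.length) := by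
    intro e heA x y hxy hs hx hy us γ γ₂ hus h1 h2 hgain hnc hpot
    have hpe : Compat p (C e) := hpA.mono (hC e heA).2
    obtain ⟨hs', hx', hy'⟩ := component_of_filter hpe hxy hs hx hy
    refine ⟨e, heA, us, hus, [B], L, rfl, ?_⟩
    refine hI.follow hpe hxy hs' hx' hy' hgain.cons_free ?_
    have e1 := nc_union_le (hp.mono (hsubU e heA)).not
    have e2 := nc_filter_add (hpB.mono (free_subset B (C e)))
    have r1 : (us.length : ℝ) ≤ γ := by exact_mod_cast h1
    have r2 : (γ₂ : ℝ) ≤ γ := by exact_mod_cast h2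
    have r3 : (nc ((A ∪ B).filter fun e => ¬ p e) : ℝ) ≤
      nc ((C e).filter fun e => ¬ p e) + nc ((free B (C e)).filter fun e => ¬ p e) + γ₂ := by
      exact_mod_cast hnc.trans (Nat.add_le_add_right e1 _)
    have r4 : (nc ((free B (C e)).filter p) : ℝ) + nc ((free B (C e)).filter fun e => ¬ p e) =
      nc (free B (C e)) := by exact_mod_cast e2
    have r5 : (0 : ℝ) ≤ nc ((free B (C e)).filter fun e => ¬ p e) := Nat.cast_nonneg _
    push_cast at hpot ⊢
    linarith
  have keep : ∀ e ∈ A, ∀ x y w₁' w₂' : ℤ, (C e).filter p = Icc x y → w₁' ≤ w₂' → x ≤ w₁' →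
      w₂' ≤ y → ((w₂' = y ∧ j₂ + 1 < w₁') ∨ (w₁' = x ∧ w₂' + 1 < j₁)) →
      ∀ (us : List ℤ) (γ γ₂ : ℕ), (∀ e ∈ us, e ∈ A) → us.length ≤ γ → γ₂ ≤ γ →
      Gain (C e ∪ B) (us.map C ++ L) (γ + g) →
      nc ((A ∪ B).filter fun e => ¬ p e) ≤ nc ((C e ∪ B).filter fun e => ¬ p e) + γ₂ →
      3 * w ≤ 4 * (w₂' + 1 - w₁') →
      ∃ h ∈ A, ∃ us : List ℤ, (∀ e ∈ us, e ∈ A) ∧ ∃ L1 L2, B :: L = L1 ++ L2 ∧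
        Win d (C h) (L1 ++ (us.map C ++ L2)) (val + us.length) := by
    intro e heA x y w₁' w₂' hxy hw' hx hy ho' us γ γ₂ hus h1 h2 hgain hnc hpot
    refine ⟨e, heA, us, hus, [B], L, rfl, ?_⟩
    refine hP (C e) B p x y w₁' w₂' j₁ j₂ _ _ _ (hp.mono (hsubU e heA)) hxy hB hj hw' hx hy ho'
      hgain ?_
    have r1 : (us.length : ℝ) ≤ γ := by exact_mod_cast h1
    have r2 : (γ₂ : ℝ) ≤ γ := by exact_mod_cast h2
    have r3 : (nc ((A ∪ B).filter fun e => ¬ p e) : ℝ) ≤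
      nc ((C e ∪ B).filter fun e => ¬ p e) + γ₂ := by exact_mod_cast hnc
    have r4 := logPot_step_of_le (d := d) hw0r (m' := (w₂' + 1 - w₁' : ℤ)) (by exact_mod_cast hpot)
    push_cast at r4 ⊢
    linarith
  -- a label disjoint from the pending one can be cashed
  have touchB : ∀ e ∈ A, nc ((free B (C e)).filter p) = 0 →
      ∃ f c, j₁ ≤ f ∧ f ≤ j₂ ∧ c ∈ (C e).filter p ∧ ¬ (f + 1 < c ∨ c + 1 < f) := by
    intro e heA h0
    obtain ⟨hj1, hpj⟩ := (hB' j₁).2 ⟨le_rfl, hj⟩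
    have hnf : j₁ ∉ free B (C e) := fun hc => by
      have := nc_pos ⟨j₁, mem_filter.2 ⟨hc, hpj⟩⟩
      omega
    obtain ⟨z₁, z₂, f, c, t1, t2, t3, t4, t5, t6, t7, t8, t9⟩ := exists_touch
      (hp.mono (union_subset subset_union_right ((hC e heA).2.trans subset_union_left))) hj1 hpj hnf
    have := t3 (mem_Icc.2 ⟨t6, t7⟩)
    rw [hB, mem_Icc] at this
    exact ⟨f, c, this.1, this.2, t8, t9⟩
  have hne : A.Nonempty := ⟨u, ((hA' u).2 ⟨le_rfl, by omega⟩).1⟩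
  obtain ⟨h, hhA, hmax⟩ := exists_max_image A (fun e => ((C e).filter p).card) hne
  set b := ((C h).filter p).card with hb
  have hbpos : 1 ≤ b := by
    obtain ⟨huA, hpu⟩ := (hA' u).2 ⟨le_rfl, by omega⟩
    refine le_trans ?_ (hmax u huA)
    exact card_pos.2 ⟨u, mem_filter.2 ⟨(hC u huA).1, hpu⟩⟩
  obtain ⟨us, U', γ, γ₁, γ₂, h1, h2, h3, h4, h5, h6, h7, h8, h9, h10⟩ :=
    exists_greedy_from hC hhA p hp hg
  have hwb := card_active_le hp hC hhA hmax hA hB hj hu hv ho h1 h2 (by omega) h5 h6 h8 h10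
  have hCne : ((C h).filter p).Nonempty := card_pos.1 hbpos
  set n := nc ((C h).filter p) with hn
  have hnpos : 1 ≤ n := nc_pos hCne
  obtain ⟨x, y, hxy, hs, hx, hy, hlen⟩ := exists_large_component hCne
  obtain ⟨ℓ, hℓ⟩ : ∃ ℓ : ℤ, ℓ = y + 1 - x := ⟨_, rfl⟩
  have hℓ0 : 0 < ℓ := by omega
  have hℓ0r : (0 : ℝ) < ℓ := by exact_mod_cast hℓ0
  rw [← hb, ← hn, ← hℓ] at hlen
  rw [← hwd] at hwb
  have r5 : (w : ℝ) ≤ b * (4 + 2 * n + 3 * γ) := by exact_mod_cast hwb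
  have r6 : (1 : ℝ) ≤ n := by exact_mod_cast hnpos
  have r7 : (b : ℝ) ≤ n * ℓ := by exact_mod_cast hlen
  have r10 : (0 : ℝ) ≤ γ := Nat.cast_nonneg _
  have r11 : (w : ℝ) ≤ 6 * (n + γ) * (n * ℓ) := by
    have : (b : ℝ) * (4 + 2 * n + 3 * γ) ≤ (n * ℓ) * (6 * (n + γ)) := by
      refine mul_le_mul r7 (by linarith) (by positivity) (by positivity)
    linarith
  have r12 : (0 : ℝ) ≤ nc ((free B (C h)).filter p) := Nat.cast_nonneg _
  by_cases hs0 : n = 1 ∧ γ = 0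
  swap
  · obtain ⟨s, hs'⟩ : ∃ s, n + γ = s + 1 := ⟨n + γ - 1, by omega⟩
    have hs1 : 1 ≤ s := by omega
    have r8 : (1 : ℝ) ≤ s := by exact_mod_cast hs1
    have r9 : (n : ℝ) + γ = s + 1 := by exact_mod_cast hs'
    refine follow h hhA x y hxy hs hx hy us γ γ₂ h1 h2 (by omega) h7 h9 ?_
    rw [← hℓ]
    have := logPot_step_sq (d := d) (s := s) (m := w) (m' := ℓ) (a := 6) (j := 3)
      (c := 2 * s - 3 / 2) hw0r hℓ0r.le (by norm_num) (by norm_num) (by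
        rw [r9] at r11
        refine r11.trans ?_
        have : (n : ℝ) * ℓ ≤ (s + 1) * ℓ := by
          refine mul_le_mul_of_nonneg_right ?_ hℓ0r.le
          linarith
        calc 6 * ((s : ℝ) + 1) * (n * ℓ) ≤ 6 * ((s : ℝ) + 1) * ((s + 1) * ℓ) :=
              mul_le_mul_of_nonneg_left this (by positivity)
          _ = _ := by ring) (by linarith)
    linarith
  obtain ⟨hn1, hγ0⟩ := hs0
  have r13 : (w : ℝ) ≤ 2 ^ (3 : ℝ) * ℓ := by
    rw [hn1, hγ0] at r11
    norm_num at r11 ⊢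
    linarith
  have hH : (C h).filter p = Icc x y := eq_component_of_nc_eq_one (hn ▸ hn1) hxy hs hx hy
  by_cases hfree : nc ((free B (C h)).filter p) = 0
  swap
  · refine follow h hhA x y hxy hs hx hy us γ γ₂ h1 h2 (by omega) h7 h9 ?_
    rw [← hℓ]
    have := logPot_step (d := d) hw0r (by norm_num) r13
    have r14 : (1 : ℝ) ≤ nc ((free B (C h)).filter p) := by
      exact_mod_cast Nat.one_le_iff_ne_zero.2 hfree
    linarith
  obtain ⟨f, c, hf1, hf2, hc, hfc⟩ := touchB h hhA hfree
  rw [hH, mem_Icc] at hc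
  have hxin : u ≤ x ∧ y ≤ v := by
    have e1 := mem_filter.1 (hs (mem_Icc.2 ⟨le_rfl, hxy⟩))
    have e2 := mem_filter.1 (hs (mem_Icc.2 ⟨hxy, le_rfl⟩))
    exact ⟨((hA' x).1 ⟨(hC h hhA).2 e1.1, e1.2⟩).1, ((hA' y).1 ⟨(hC h hhA).2 e2.1, e2.2⟩).2⟩
  have hus : us = [] := List.eq_nil_of_length_eq_zero (by omega)
  have hU' : ∀ z ∈ U'.filter p, (x ≤ z ∧ z ≤ y) ∨ (j₁ ≤ z ∧ z ≤ j₂) := by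
    intro z hz
    obtain ⟨hz, hpz⟩ := mem_filter.1 hz
    rcases h10 z hz with h' | ⟨e, he, _⟩
    · rcases mem_union.1 h' with h' | h'
      · left
        rw [← mem_Icc, ← hH]
        exact mem_filter.2 ⟨h', hpz⟩
      · exact Or.inr ((hB' z).1 ⟨h', hpz⟩)
    · rw [hus] at he; simp at he
  have big : ∀ e ∈ A, ∀ z₁ z₂ : ℤ, z₁ ≤ z₂ → Icc z₁ z₂ ⊆ (C e).filter p →
      z₁ - 1 ∉ (C e).filter p → z₂ + 1 ∉ (C e).filter p → w ≤ 8 * (z₂ + 1 - z₁) →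
      (∀ f c, j₁ ≤ f → f ≤ j₂ → z₁ ≤ c → c ≤ z₂ → ¬ (f + 1 < c ∨ c + 1 < f) → z₁ ≤ w₁ ∧
        w₂ ≤ z₂ ∧ ((w₂ = z₂ ∧ j₂ + 1 < w₁) ∨ (w₁ = z₁ ∧ w₂ + 1 < j₁))) →
      ∃ h ∈ A, ∃ us : List ℤ, (∀ e ∈ us, e ∈ A) ∧ ∃ L1 L2, B :: L = L1 ++ L2 ∧
        Win d (C h) (L1 ++ (us.map C ++ L2)) (val + us.length) := by
    intro e heA z₁ z₂ hz hzs hz1 hz2 hwz hcond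
    obtain ⟨us', U'', γ', γ₁', γ₂', k1, k2, k3, k4, k5, k6, k7, k8, k9, k10⟩ :=
      exists_greedy_from hC heA p hp hg
    have q1 : (w : ℝ) ≤ 8 * (z₂ + 1 - z₁ : ℤ) := by exact_mod_cast hwz
    have q2 := logPot_step (d := d) (m := w) (m' := (z₂ + 1 - z₁ : ℤ)) (j := 3) hw0r
      (by norm_num) (by norm_num; push_cast at q1; linarith)
    have q3 : (0 : ℝ) ≤ γ' := Nat.cast_nonneg _
    have q4 : (0 : ℝ) ≤ nc ((free B (C e)).filter p) := Nat.cast_nonneg _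
    have q5 : 1 ≤ nc ((C e).filter p) := nc_pos ⟨z₁, hzs (mem_Icc.2 ⟨le_rfl, hz⟩)⟩
    have q6 : (1 : ℝ) ≤ nc ((C e).filter p) := by exact_mod_cast q5
    by_cases hge : 2 ≤ nc ((C e).filter p)
    · refine follow e heA z₁ z₂ hz hzs hz1 hz2 us' γ' γ₂' k1 k2 (by omega) k7 k9 ?_
      have q7 : (2 : ℝ) ≤ nc ((C e).filter p) := by exact_mod_cast hge
      linarith
    by_cases hfree' : nc ((free B (C e)).filter p) = 0
    swap
    · refine follow e heA z₁ z₂ hz hzs hz1 hz2 us' γ' γ₂' k1 k2 (by omega) k7 k9 ?_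
      have q7 : (1 : ℝ) ≤ nc ((free B (C e)).filter p) := by
        exact_mod_cast Nat.one_le_iff_ne_zero.2 hfree'
      linarith
    have hE : (C e).filter p = Icc z₁ z₂ :=
      eq_component_of_nc_eq_one (by omega) hz hzs hz1 hz2
    obtain ⟨f', c', hf1', hf2', hc', hfc'⟩ := touchB e heA hfree'
    rw [hE, mem_Icc] at hc'
    obtain ⟨o1, o2, o3⟩ := hcond f' c' hf1' hf2' hc'.1 hc'.2 hfc'
    exact keep e heA z₁ z₂ w₁ w₂ hE hw o1 o2 o3 us' γ' γ₂' k1 k2 (by omega) k7 k9 (by omega)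
  have touchC : ∀ e ∈ A, p e → ∃ z₁ z₂ f u, z₁ ≤ e ∧ e ≤ z₂ ∧
      Icc z₁ z₂ ⊆ (C e).filter p ∧ z₁ - 1 ∉ (C e).filter p ∧ z₂ + 1 ∉ (C e).filter p ∧
      z₁ ≤ f ∧ f ≤ z₂ ∧ u ∈ U'.filter p ∧ ¬ (f + 1 < u ∨ u + 1 < f) := fun e heA hpe =>
    exists_touch (hp.mono (union_subset ((hC e heA).2.trans subset_union_left) h5)) (hC e heA).1
      hpe (h6 e heA)
  have inA : ∀ e ∈ A, ∀ z ∈ (C e).filter p, u ≤ z ∧ z ≤ v := fun e heA z hz =>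
    (hA' z).1 ⟨(hC e heA).2 (mem_filter.1 hz).1, (mem_filter.1 hz).2⟩
  rcases ho with ⟨ho1, ho2⟩ | ⟨ho1, ho2⟩
  · obtain ⟨hvA, hpv⟩ := (hA' v).2 ⟨by omega, le_rfl⟩
    obtain ⟨z₁, z₂, f', u', t1, t2, t3, t4, t5, t6, t7, t8, t9⟩ := touchC v hvA hpv
    have hz2 := inA v hvA z₂ (t3 (mem_Icc.2 ⟨t1.trans t2, le_rfl⟩))
    by_cases hwz : w ≤ 8 * (z₂ + 1 - z₁)
    · refine big v hvA z₁ z₂ (by omega) t3 t4 t5 hwz fun f c q1 q2 q3 q4 q5 => ?_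
      exact ⟨by omega, by omega, Or.inl ⟨by omega, by omega⟩⟩
    · have := hU' u' t8
      exact keep h hhA x y w₁ y hH (by omega) (by omega) le_rfl (Or.inl ⟨rfl, ho2⟩) us γ γ₂ h1 h2
        (by omega) h7 h9 (by omega)
  · obtain ⟨huA, hpu⟩ := (hA' u).2 ⟨le_rfl, by omega⟩
    obtain ⟨z₁, z₂, f', u', t1, t2, t3, t4, t5, t6, t7, t8, t9⟩ := touchC u huA hpu
    have hz1 := inA u huA z₁ (t3 (mem_Icc.2 ⟨le_rfl, t1.trans t2⟩))
    by_cases hwz : w ≤ 8 * (z₂ + 1 - z₁)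
    · refine big u huA z₁ z₂ (by omega) t3 t4 t5 hwz fun f c q1 q2 q3 q4 q5 => ?_
      exact ⟨by omega, by omega, Or.inr ⟨by omega, by omega⟩⟩
    · have := hU' u' t8
      exact keep h hhA x y x w₂ hH (by omega) le_rfl (by omega) (Or.inr ⟨rfl, ho2⟩) us γ γ₂ h1 h2
        (by omega) h7 h9 (by omega)

theorem winInterval (d : ℕ) : WinInterval d ∧ WinPending d := by
  induction d with
  | zero => exact ⟨winInterval_zero, winPending_zero⟩
  | succ d ih => exact ⟨winInterval_succ ih.1 ih.2, winPending_succ ih.1 ih.2⟩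

/-- Double counting along a coordinate `get` of `Ω` that can be resampled by `put`. -/
lemma card_mul_card_filter_mem {Ω Y : Type*} [Fintype Ω] [Fintype Y] [DecidableEq Ω]
    [DecidableEq Y] (get : Ω → Y) (put : Ω → Y → Ω) (h1 : ∀ ω y, get (put ω y) = y)
    (h2 : ∀ ω y y', put (put ω y) y' = put ω y') (h3 : ∀ ω, put ω (get ω) = ω)
    (B : Ω → Finset Y) (hB : ∀ ω y, B (put ω y) = B ω) :
    Fintype.card Y * (univ.filter fun ω => get ω ∈ B ω).card = ∑ ω, (B ω).card := by
  have e1 : Fintype.card Y * (univ.filter fun ω => get ω ∈ B ω).card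
      = ((univ.filter fun ω => get ω ∈ B ω) ×ˢ (univ : Finset Y)).card := by
    rw [card_product, card_univ, mul_comm]
  rw [e1, ← card_sigma]
  refine card_bij' (fun p _ => ⟨put p.1 p.2, get p.1⟩) (fun q _ => (put q.1 q.2, get q.1))
    ?_ ?_ ?_ ?_
  · rintro ⟨ω, y⟩ h
    simpa [hB] using h
  · rintro ⟨ω, y⟩ h
    simpa [hB, h1] using h
  · rintro ⟨ω, y⟩ _
    simp [h1, h2, h3]
  · rintro ⟨ω, y⟩ _
    simp [h1, h2, h3]

/-- The number of arrays with prescribed entries at the positions of `S`. -/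
lemma card_prescribed {I V α : Type*} [Fintype I] [Fintype V] [Fintype α] [DecidableEq I]
    [DecidableEq V] [DecidableEq α] (S : Finset (I × V)) (ψ : I → V → α) :
    (univ.filter fun ω : I → V → α => ∀ p ∈ S, ω p.1 p.2 = ψ p.1 p.2).card
      * Fintype.card α ^ S.card = Fintype.card (I → V → α) := by
  have h : (univ.filter fun ω : I → V → α => ∀ p ∈ S, ω p.1 p.2 = ψ p.1 p.2)
      = Fintype.piFinset fun i => Fintype.piFinset fun v =>
        if (i, v) ∈ S then {ψ i v} else univ := by
    ext ω
    simp only [mem_filter, mem_univ, true_and, Fintype.mem_piFinset, Prod.forall]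
    refine forall_congr' fun i => forall_congr' fun v => ?_
    split_ifs with hs <;> simp [hs]
  have h2 : ∀ i v, (if (i, v) ∈ S then ({ψ i v} : Finset α) else univ).card
      * (if (i, v) ∈ S then Fintype.card α else 1) = Fintype.card α := by
    intro i v
    split_ifs <;> simp
  have h3 : Fintype.card α ^ S.card
      = ∏ i, ∏ v, (if (i, v) ∈ S then Fintype.card α else 1) := by
    rw [← Fintype.prod_prod_type' (f := fun i v => if (i, v) ∈ S then Fintype.card α else 1)]
    rw [prod_ite_mem, univ_inter, prod_const]
  rw [h, Fintype.card_piFinset, h3]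
  simp_rw [Fintype.card_piFinset]
  rw [← prod_mul_distrib]
  simp_rw [← prod_mul_distrib, h2]
  simp

section Hitting

variable {V α G : Type*} [Fintype V] [DecidableEq V] [Fintype α] [DecidableEq α]

/-- Combine the samples `ω` on `W`, using the sample `i γ` on the points of colour `γ`. -/
def mix {M : ℕ} (W : Finset V) (c : V → G) (z : V → α) (i : G → Fin M)
    (ω : Fin M → V → α) : V → α := fun v => if v ∈ W then ω (i (c v)) v else z v

lemma card_mix_mem {M : ℕ} (W : Finset V) (c : V → G) (z : V → α) (R : Finset (V → α))
    (hR : ∀ x ∈ R, ∀ v ∉ W, x v = z v) (i : G → Fin M) :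
    (univ.filter fun ω => mix W c z i ω ∈ R).card * Fintype.card α ^ W.card
      = R.card * Fintype.card (Fin M → V → α) := by
  rw [card_eq_sum_card_fiberwise (f := mix W c z i) (t := R) (by intro ω hω; simpa using hω),
    sum_mul, card_eq_sum_ones R, sum_mul]
  refine sum_congr rfl fun r hr => ?_
  have hS : (W.image fun v => (i (c v), v)).card = W.card :=
    card_image_of_injective _ fun a b h => (Prod.ext_iff.1 h).2
  rw [one_mul, ← hS, ← card_prescribed (W.image fun v => (i (c v), v)) fun _ v => r v]
  congr 2
  ext ω
  simp only [mem_filter, mem_univ, true_and, mem_image, forall_exists_index, and_imp,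
    forall_apply_eq_imp_iff₂]
  constructor
  · rintro ⟨_, rfl⟩ v hv
    simp [mix, hv]
  · intro h
    have : mix W c z i ω = r := by
      funext v
      by_cases hv : v ∈ W
      · simp [mix, hv, h v hv]
      · simp [mix, hv, hR r hr v hv]
    exact ⟨this ▸ hr, this⟩

lemma card_mix_mem_mix_mem {M : ℕ} (W : Finset V) (c : V → G) (z : V → α)
    (R : Finset (V → α)) (hR : ∀ x ∈ R, ∀ v ∉ W, x v = z v) (i i' : G → Fin M) (s : ℕ)
    (hs : ∀ r ∈ R, (R.filter fun r' => ∀ v, v ∉ W ∨ i (c v) = i' (c v) → r' v = r v).card ≤ s) :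
    (univ.filter fun ω => mix W c z i ω ∈ R ∧ mix W c z i' ω ∈ R).card
        * Fintype.card α ^ (W.card + (W.filter fun v => i (c v) ≠ i' (c v)).card)
      ≤ R.card * s * Fintype.card (Fin M → V → α) := by
  set S₁ := W.image fun v => (i (c v), v) with hS₁
  set S₂ := (W.filter fun v => i (c v) ≠ i' (c v)).image fun v => (i' (c v), v) with hS₂
  have h1 : S₁.card = W.card := card_image_of_injective _ fun a b h => (Prod.ext_iff.1 h).2
  have h2 : S₂.card = (W.filter fun v => i (c v) ≠ i' (c v)).card :=
    card_image_of_injective _ fun a b h => (Prod.ext_iff.1 h).2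
  have hd : Disjoint S₁ S₂ := by
    rw [disjoint_left]
    rintro ⟨a, v⟩ ha hb
    simp only [hS₁, hS₂, mem_image, mem_filter, Prod.mk.injEq] at ha hb
    obtain ⟨v₁, _, h₁, rfl⟩ := ha
    obtain ⟨v₂, ⟨_, h₂⟩, h₃, rfl⟩ := hb
    exact h₂ (h₁.trans h₃.symm)
  rw [← h1, ← h2, ← card_union_of_disjoint hd]
  have hcov : (univ.filter fun ω => mix W c z i ω ∈ R ∧ mix W c z i' ω ∈ R) ⊆
      R.biUnion fun r => (R.filter fun r' => ∀ v, v ∉ W ∨ i (c v) = i' (c v) → r' v = r v).biUnion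
        fun r' => univ.filter fun ω : Fin M → V → α =>
          ∀ p ∈ S₁ ∪ S₂, ω p.1 p.2 = if p.1 = i (c p.2) then r p.2 else r' p.2 := by
    intro ω hω
    simp only [mem_filter, mem_univ, true_and] at hω
    simp only [mem_biUnion, mem_filter, mem_univ, true_and]
    refine ⟨_, hω.1, _, ⟨hω.2, ?_⟩, ?_⟩
    · rintro v (hv | hv)
      · rw [hR _ hω.1 v hv, hR _ hω.2 v hv]
      · simp [mix, hv]
    · intro p hp
      simp only [hS₁, hS₂, mem_union, mem_image, mem_filter] at hp
      rcases hp with ⟨v, hv, rfl⟩ | ⟨v, ⟨hv, hne⟩, rfl⟩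
      · simp [mix, hv]
      · simp [mix, hv, Ne.symm hne]
  refine (Nat.mul_le_mul_right _ (card_le_card hcov)).trans ?_
  have hb := card_biUnion_le_card_mul R (fun r => (R.filter fun r' => ∀ v,
    v ∉ W ∨ i (c v) = i' (c v) → r' v = r v).biUnion
        fun r' => univ.filter fun ω : Fin M → V → α =>
          ∀ p ∈ S₁ ∪ S₂, ω p.1 p.2 = if p.1 = i (c p.2) then r p.2 else r' p.2)
  have key : ∀ r ∈ R, ((R.filter fun r' => ∀ v,
    v ∉ W ∨ i (c v) = i' (c v) → r' v = r v).biUnion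
        fun r' => univ.filter fun ω : Fin M → V → α =>
          ∀ p ∈ S₁ ∪ S₂, ω p.1 p.2 = if p.1 = i (c p.2) then r p.2 else r' p.2).card
      * Fintype.card α ^ (S₁ ∪ S₂).card ≤ s * Fintype.card (Fin M → V → α) := by
    intro r hr
    refine (Nat.mul_le_mul_right _ card_biUnion_le).trans ?_
    rw [sum_mul]
    calc _ = ∑ r' ∈ R.filter fun r' => ∀ v, v ∉ W ∨ i (c v) = i' (c v) → r' v = r v,
          Fintype.card (Fin M → V → α) := by
          refine sum_congr rfl fun r' _ => ?_
          exact card_prescribed (S₁ ∪ S₂) fun a v => if a = i (c v) then r v else r' v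
      _ ≤ _ := by
          rw [sum_const, smul_eq_mul]
          exact Nat.mul_le_mul_right _ (hs r hr)
  refine (Nat.mul_le_mul_right _ card_biUnion_le).trans ?_
  rw [sum_mul, mul_assoc]
  exact (sum_le_sum key).trans (by rw [sum_const, smul_eq_mul])

variable [Fintype G] [DecidableEq G]

lemma sum_inv_pow_card_ne_le {M : ℕ} (i : G → Fin M) :
    ∑ i' : G → Fin M, ((M : ℝ) ^ (univ.filter fun γ => i γ ≠ i' γ).card)⁻¹
      ≤ 2 ^ Fintype.card G := by
  have h : ∀ i' : G → Fin M, ((M : ℝ) ^ (univ.filter fun γ => i γ ≠ i' γ).card)⁻¹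
      = ∏ γ, if i γ ≠ i' γ then (M : ℝ)⁻¹ else 1 := by
    intro i'
    rw [← inv_pow, prod_ite]
    simp
  simp_rw [h]
  rw [← Fintype.piFinset_univ,
    ← prod_univ_sum (fun _ => univ) fun γ s => if i γ ≠ s then (M : ℝ)⁻¹ else 1]
  rw [← card_univ, ← prod_const]
  refine prod_le_prod (fun γ _ => sum_nonneg fun s _ => by positivity) fun γ _ => ?_
  have hM : (0 : ℝ) < M := by
    have := (i γ).pos
    exact_mod_cast this
  calc ∑ s, (if i γ ≠ s then (M : ℝ)⁻¹ else 1)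
      ≤ ∑ s, ((M : ℝ)⁻¹ + if i γ = s then 1 else 0) := by
        refine sum_le_sum fun s _ => ?_
        have : (0 : ℝ) ≤ (M : ℝ)⁻¹ := by positivity
        by_cases hs : i γ = s <;> simp [hs, this]
    _ = 2 := by
        rw [sum_add_distrib]
        simp [hM.ne']
        norm_num

/-- A set of points which is dense, but none of whose proper slices is too dense, is hit by a
combination of `M` uniform samples with probability at least `1 / (2 ^ g + 1)`. -/
lemma card_le_mul_card_hit [Nonempty α] {M : ℕ} (hM : 0 < M) (W : Finset V) (c : V → G)
    (z : V → α) (R : Finset (V → α)) (hR : ∀ x ∈ R, ∀ v ∉ W, x v = z v)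
    (hsub : ∀ G' : Finset G, G' ≠ univ → ∀ z' : V → α,
      (R.filter fun x => ∀ v, v ∉ W ∨ c v ∉ G' → x v = z' v).card * M ^ G'.card
        ≤ Fintype.card α ^ (W.filter fun v => c v ∈ G').card)
    (hbig : Fintype.card α ^ W.card ≤ R.card * M ^ Fintype.card G) :
    Fintype.card (Fin M → V → α) ≤ (2 ^ Fintype.card G + 1)
      * (univ.filter fun ω => ∃ i : G → Fin M, mix W c z i ω ∈ R).card := by
  obtain ⟨N, hN⟩ : ∃ N : ℝ, N = ((Fintype.card (Fin M → V → α) : ℕ) : ℝ) := ⟨_, rfl⟩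
  have hNpos : 0 < N := by
    rw [hN]; exact_mod_cast Fintype.card_pos
  have hMpos : (0 : ℝ) < M := by exact_mod_cast hM
  set n := Fintype.card α with hn
  have hnpos : (0 : ℝ) < n := by rw [hn]; exact_mod_cast Fintype.card_pos
  set ρ : ℝ := R.card / (n : ℝ) ^ W.card with hρ
  have hρ0 : 0 ≤ ρ := by positivity
  set g := Fintype.card G with hg
  have hμ : 1 ≤ (M : ℝ) ^ g * ρ := by
    rw [hρ, ← mul_div_assoc, le_div_iff₀ (by positivity), one_mul, mul_comm]
    exact_mod_cast hbig
  have single : ∀ i : G → Fin M,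
      ((univ.filter fun ω => mix W c z i ω ∈ R).card : ℝ) = ρ * N := by
    intro i
    have := card_mix_mem W c z R hR i
    rw [hρ, div_mul_eq_mul_div, eq_div_iff (by positivity), hN]
    exact_mod_cast this
  have pair : ∀ i i' : G → Fin M,
      ((univ.filter fun ω => mix W c z i ω ∈ R ∧ mix W c z i' ω ∈ R).card : ℝ)
        ≤ ρ * N * ((M : ℝ) ^ (univ.filter fun γ => i γ ≠ i' γ).card)⁻¹ + ρ ^ 2 * N := by
    intro i i'
    set F := univ.filter fun γ => i γ ≠ i' γ with hF
    have hWF : (W.filter fun v => i (c v) ≠ i' (c v)) = W.filter fun v => c v ∈ F := by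
      ext v; simp [hF]
    by_cases hFu : F = univ
    · have := card_mix_mem_mix_mem W c z R hR i i' R.card fun r _ => card_filter_le _ _
      rw [hWF, hFu] at this
      simp only [mem_univ, filter_true] at this
      have h2 : ((univ.filter fun ω => mix W c z i ω ∈ R ∧ mix W c z i' ω ∈ R).card : ℝ)
          * ((n : ℝ) ^ W.card * (n : ℝ) ^ W.card) ≤ R.card * R.card * N := by
        rw [← pow_add, hN]; exact_mod_cast this
      have h3 : ((univ.filter fun ω => mix W c z i ω ∈ R ∧ mix W c z i' ω ∈ R).card : ℝ)
          ≤ ρ ^ 2 * N := by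
        rw [hρ, div_pow, div_mul_eq_mul_div, le_div_iff₀ (by positivity)]
        rw [sq, sq]; exact h2
      have : 0 ≤ ρ * N * ((M : ℝ) ^ F.card)⁻¹ := by positivity
      linarith
    · set s := n ^ (W.filter fun v => c v ∈ F).card / M ^ F.card with hs
      have := card_mix_mem_mix_mem W c z R hR i i' s (by
        intro r _
        rw [hs, Nat.le_div_iff_mul_le (by positivity)]
        refine le_trans (Nat.mul_le_mul_right _ (card_le_card ?_)) (hsub F hFu r)
        refine monotone_filter_right _ fun r' _ h v hv => h v ?_
        simpa [hF] using hv)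
      rw [hWF] at this
      have hs' : (s : ℝ) ≤ (n : ℝ) ^ (W.filter fun v => c v ∈ F).card / (M : ℝ) ^ F.card := by
        rw [hs]
        refine Nat.cast_div_le.trans ?_
        push_cast
        exact le_rfl
      have h2 : ((univ.filter fun ω => mix W c z i ω ∈ R ∧ mix W c z i' ω ∈ R).card : ℝ)
          * ((n : ℝ) ^ W.card * (n : ℝ) ^ (W.filter fun v => c v ∈ F).card)
            ≤ R.card * s * N := by
        rw [← pow_add, hN]; exact_mod_cast this
      have h3 := h2.trans (mul_le_mul_of_nonneg_right
        (mul_le_mul_of_nonneg_left hs' (Nat.cast_nonneg _)) hNpos.le)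
      have h4 : ((univ.filter fun ω => mix W c z i ω ∈ R ∧ mix W c z i' ω ∈ R).card : ℝ)
          ≤ ρ * N * ((M : ℝ) ^ F.card)⁻¹ := by
        rw [← mul_le_mul_iff_left₀ (show (0 : ℝ) < (n : ℝ) ^ W.card
          * (n : ℝ) ^ (W.filter fun v => c v ∈ F).card by positivity)]
        refine h3.trans (le_of_eq ?_)
        rw [hρ]
        field_simp
      have : 0 ≤ ρ ^ 2 * N := by positivity
      linarith
  set Z : (Fin M → V → α) → ℝ := fun ω => ∑ i : G → Fin M, if mix W c z i ω ∈ R then 1 else 0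
    with hZ
  set H := univ.filter fun ω => ∃ i : G → Fin M, mix W c z i ω ∈ R with hH
  have hZ0 : ∀ ω, ω ∉ H → Z ω = 0 := by
    intro ω hω
    refine sum_eq_zero fun i _ => if_neg fun h => hω ?_
    simp only [hH, mem_filter, mem_univ, true_and]
    exact ⟨i, h⟩
  have hcardfun : (Fintype.card (G → Fin M) : ℝ) = (M : ℝ) ^ g := by simp [hg]
  have sum1 : ∑ ω ∈ H, Z ω = (M : ℝ) ^ g * (ρ * N) := by
    rw [sum_subset (subset_univ H) fun ω _ h => hZ0 ω h]
    rw [sum_comm]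
    simp_rw [sum_boole, single]
    rw [sum_const, nsmul_eq_mul, card_univ, hcardfun]
  have sum2 : ∑ ω ∈ H, Z ω ^ 2 ≤ (2 ^ g + 1) * ((M : ℝ) ^ g * ρ) ^ 2 * N := by
    have e : ∑ ω ∈ H, Z ω ^ 2 = ∑ i : G → Fin M, ∑ i' : G → Fin M,
        ((univ.filter fun ω => mix W c z i ω ∈ R ∧ mix W c z i' ω ∈ R).card : ℝ) := by
      rw [sum_subset (subset_univ H) fun ω _ h => by simp [hZ0 ω h]]
      simp_rw [hZ, sq, sum_mul_sum]
      rw [sum_comm]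
      refine sum_congr rfl fun i _ => ?_
      rw [sum_comm]
      refine sum_congr rfl fun i' _ => ?_
      rw [← sum_boole]
      refine sum_congr rfl fun ω _ => ?_
      by_cases h1 : mix W c z i ω ∈ R <;> by_cases h2 : mix W c z i' ω ∈ R <;> simp [h1, h2]
    rw [e]
    calc _ ≤ ∑ i : G → Fin M, ∑ i' : G → Fin M,
          (ρ * N * ((M : ℝ) ^ (univ.filter fun γ => i γ ≠ i' γ).card)⁻¹ + ρ ^ 2 * N) :=
          sum_le_sum fun i _ => sum_le_sum fun i' _ => pair i i'
      _ ≤ ∑ _i : G → Fin M, (ρ * N * 2 ^ g + (M : ℝ) ^ g * (ρ ^ 2 * N)) := by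
          refine sum_le_sum fun i _ => ?_
          rw [sum_add_distrib, ← mul_sum, sum_const, nsmul_eq_mul, card_univ, hcardfun]
          have := mul_le_mul_of_nonneg_left (sum_inv_pow_card_ne_le i)
            (mul_nonneg hρ0 hNpos.le)
          linarith
      _ = (2 ^ g * ((M : ℝ) ^ g * ρ) * 1 + ((M : ℝ) ^ g * ρ) ^ 2) * N := by
          rw [sum_const, nsmul_eq_mul, card_univ, hcardfun]
          ring
      _ ≤ (2 ^ g * ((M : ℝ) ^ g * ρ) * ((M : ℝ) ^ g * ρ) + ((M : ℝ) ^ g * ρ) ^ 2) * N := by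
          gcongr
      _ = _ := by ring
  have cs := sq_sum_le_card_mul_sum_sq (s := H) (f := Z)
  rw [sum1] at cs
  have fin : N ≤ (2 ^ g + 1) * (H.card : ℝ) := by
    have h5 := cs.trans (mul_le_mul_of_nonneg_left sum2 (Nat.cast_nonneg _))
    have h6 : (((M : ℝ) ^ g * ρ) ^ 2 * N) * N
        ≤ (((M : ℝ) ^ g * ρ) ^ 2 * N) * ((2 ^ g + 1) * (H.card : ℝ)) := by
      calc _ = ((M : ℝ) ^ g * (ρ * N)) ^ 2 := by ring
        _ ≤ _ := h5
        _ = _ := by ring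
    exact le_of_mul_le_mul_left h6 (by positivity)
  rw [hN] at fin
  exact_mod_cast fin

end Hitting

end SubPMM

namespace AC0

variable {ι : Type}

theorem induction_list {P : AC0 ι → Prop} (hconst : ∀ b, P (const b)) (hlit : ∀ i b, P (lit i b))
    (hand : ∀ Fs : List (AC0 ι), (∀ F ∈ Fs, P F) → P (and Fs))
    (hor : ∀ Fs : List (AC0 ι), (∀ F ∈ Fs, P F) → P (or Fs)) (F : AC0 ι) : P F :=
  AC0.rec (motive_1 := P) (motive_2 := fun Fs => ∀ F ∈ Fs, P F) hconst hlit hand hor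
    (by simp) (by simp +contextual) F

lemma evalAll_eq_true (x : ι → Bool) (Fs : List (AC0 ι)) :
    evalAll x Fs = true ↔ ∀ F ∈ Fs, eval x F = true := by
  induction Fs with
  | nil => simp [evalAll]
  | cons F Fs ih => simp [evalAll, ih]

lemma evalAny_eq_true (x : ι → Bool) (Fs : List (AC0 ι)) :
    evalAny x Fs = true ↔ ∃ F ∈ Fs, eval x F = true := by
  induction Fs with
  | nil => simp [evalAny]
  | cons F Fs ih => simp [evalAny, ih]

lemma sizeList_eq_sum (Fs : List (AC0 ι)) : sizeList Fs = (Fs.map size).sum := by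
  induction Fs with
  | nil => simp [sizeList]
  | cons F Fs ih => simp [sizeList, ih]

lemma monoList_iff (Fs : List (AC0 ι)) : MonoList Fs ↔ ∀ F ∈ Fs, Mono F := by
  induction Fs with
  | nil => simp [MonoList]
  | cons F Fs ih => simp [MonoList, ih]

lemma andDepthList_le_iff (Fs : List (AC0 ι)) (d : ℕ) :
    andDepthList Fs ≤ d ↔ ∀ F ∈ Fs, andDepth F ≤ d := by
  induction Fs with
  | nil => simp [andDepthList]
  | cons F Fs ih => simp [andDepthList, ih]

lemma andFanInLEList_iff (w : ℝ) (Fs : List (AC0 ι)) :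
    AndFanInLEList w Fs ↔ ∀ F ∈ Fs, AndFanInLE w F := by
  induction Fs with
  | nil => simp [AndFanInLEList]
  | cons F Fs ih => simp [AndFanInLEList, ih]

open Classical in
/-- The predicate on sets of variables computed by a formula. -/
def sem (F : AC0 ι) (S : Set ι) : Prop := eval (fun p => decide (p ∈ S)) F = true

lemma sem_const (b : Bool) (S : Set ι) : sem (const b) S ↔ b = true := by
  simp [sem, eval]

lemma sem_lit_true (i : ι) (S : Set ι) : sem (lit i true) S ↔ i ∈ S := by
  simp [sem, eval]

lemma sem_and (Fs : List (AC0 ι)) (S : Set ι) : sem (and Fs) S ↔ ∀ F ∈ Fs, sem F S := by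
  simp [sem, eval, evalAll_eq_true]

lemma sem_or (Fs : List (AC0 ι)) (S : Set ι) : sem (or Fs) S ↔ ∃ F ∈ Fs, sem F S := by
  simp [sem, eval, evalAny_eq_true]

lemma Mono.sem_monotone {F : AC0 ι} : Mono F → Monotone (sem F) := by
  induction F using induction_list with
  | hconst b => intro _ S S' _; simp [sem_const]
  | hlit i b =>
    intro h S S' hS
    obtain rfl : b = true := h
    rw [sem_lit_true, sem_lit_true]
    exact fun hi => hS hi
  | hand Fs ih =>
    intro h S S' hS
    rw [sem_and, sem_and]
    exact fun hF F hm => ih F hm ((monoList_iff Fs).1 h F hm) hS (hF F hm)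
  | hor Fs ih =>
    intro h S S' hS
    rw [sem_or, sem_or]
    exact fun ⟨F, hm, hF⟩ => ⟨F, hm, ih F hm ((monoList_iff Fs).1 h F hm) hS hF⟩

mutual
  /-- The predicates computed by the subformulas of a formula. -/
  def funs : AC0 ι → Set (Set ι → Prop)
    | const b => {sem (const b)}
    | lit i b => {sem (lit i b)}
    | and Fs => insert (sem (and Fs)) (funsList Fs)
    | or Fs => insert (sem (or Fs)) (funsList Fs)
  /-- The predicates computed by the subformulas of the formulas of a list. -/
  def funsList : List (AC0 ι) → Set (Set ι → Prop)
    | [] => ∅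
    | F :: Fs => funs F ∪ funsList Fs
end

lemma mem_funsList (Fs : List (AC0 ι)) (f : Set ι → Prop) :
    f ∈ funsList Fs ↔ ∃ F ∈ Fs, f ∈ funs F := by
  induction Fs with
  | nil => simp [funsList]
  | cons F Fs ih => simp [funsList, ih]

lemma sem_mem_funs (F : AC0 ι) : sem F ∈ funs F := by
  cases F <;> simp [funs]

lemma Mono.monotone_of_mem_funs {F : AC0 ι} : Mono F → ∀ f ∈ funs F, Monotone f := by
  induction F using induction_list with
  | hconst b => intro h f hf; rw [funs] at hf; rw [hf]; exact h.sem_monotone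
  | hlit i b => intro h f hf; rw [funs] at hf; rw [hf]; exact h.sem_monotone
  | hand Fs ih =>
    intro h f hf
    rw [funs] at hf
    rcases hf with rfl | hf
    · exact h.sem_monotone
    · obtain ⟨F, hF, hf⟩ := (mem_funsList Fs f).1 hf
      exact ih F hF ((monoList_iff Fs).1 h F hF) f hf
  | hor Fs ih =>
    intro h f hf
    rw [funs] at hf
    rcases hf with rfl | hf
    · exact h.sem_monotone
    · obtain ⟨F, hF, hf⟩ := (mem_funsList Fs f).1 hf
      exact ih F hF ((monoList_iff Fs).1 h F hF) f hf

/-- A predicate is constant. -/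
def IsConst (f : Set ι → Prop) : Prop := ∀ S S', f S ↔ f S'

/-- The number of nonconstant predicates computed by subformulas is at most twice the size. -/
lemma exists_list_nonconst (F : AC0 ι) :
    ∃ l : List (Set ι → Prop), (∀ f ∈ funs F, ¬ IsConst f → f ∈ l) ∧
      (l.length + 1 ≤ 2 * size F ∨ l = []) := by
  have key : ∀ Fs : List (AC0 ι), (∀ F ∈ Fs, ∃ l : List (Set ι → Prop),
      (∀ f ∈ funs F, ¬ IsConst f → f ∈ l) ∧ (l.length + 1 ≤ 2 * size F ∨ l = [])) →
      ∃ l : List (Set ι → Prop), (∀ f ∈ funsList Fs, ¬ IsConst f → f ∈ l) ∧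
        ((l = [] ∧ ∀ F ∈ Fs, IsConst (sem F)) ∨
          (l.length + 1 ≤ 2 * sizeList Fs ∧ ∃ F ∈ Fs, ∀ F' ∈ Fs, F' = F ∨ IsConst (sem F')) ∨
          l.length + 2 ≤ 2 * sizeList Fs) := by
    intro Fs
    induction Fs with
    | nil => intro _; exact ⟨[], by simp [funsList]⟩
    | cons F Fs ih =>
      intro h
      obtain ⟨l₁, h₁, hl₁⟩ := h F (by simp)
      obtain ⟨l₂, h₂, hl₂⟩ := ih fun G hG => h G (by simp [hG])
      refine ⟨l₁ ++ l₂, ?_, ?_⟩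
      · rintro f (hf | hf) hc
        · exact List.mem_append_left _ (h₁ f hf hc)
        · exact List.mem_append_right _ (h₂ f hf hc)
      · have hFc : l₁ = [] → IsConst (sem F) := by
          rintro rfl
          by_contra hc
          simpa using h₁ _ (sem_mem_funs F) hc
        rw [List.length_append, sizeList]
        rcases hl₁ with hl₁ | rfl
        · rcases hl₂ with ⟨rfl, hc⟩ | ⟨hl, _⟩ | hl
          · right; left
            refine ⟨by simp; omega, F, by simp, ?_⟩
            intro F' hF'
            rcases List.mem_cons.1 hF' with rfl | hF'
            · exact Or.inl rfl
            · exact Or.inr (hc F' hF')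
          · right; right; omega
          · right; right; omega
        · rcases hl₂ with ⟨rfl, hc⟩ | ⟨hl, G, hG, hc⟩ | hl
          · left
            refine ⟨rfl, ?_⟩
            intro F' hF'
            rcases List.mem_cons.1 hF' with rfl | hF'
            · exact hFc rfl
            · exact hc F' hF'
          · right; left
            refine ⟨by simp; omega, G, by simp [hG], ?_⟩
            intro F' hF'
            rcases List.mem_cons.1 hF' with rfl | hF'
            · exact Or.inr (hFc rfl)
            · exact hc F' hF'
          · right; right
            simp; omega
  have fin : ∀ (Fs : List (AC0 ι)) (f : Set ι → Prop), (∀ F ∈ Fs, ∃ l : List (Set ι → Prop),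
      (∀ f ∈ funs F, ¬ IsConst f → f ∈ l) ∧ (l.length + 1 ≤ 2 * size F ∨ l = [])) →
      ((∀ F ∈ Fs, IsConst (sem F)) → IsConst f) →
      (∀ F ∈ Fs, (∀ F' ∈ Fs, F' = F ∨ IsConst (sem F')) → f = sem F ∨ IsConst f) →
      ∃ l : List (Set ι → Prop), (∀ g ∈ insert f (funsList Fs), ¬ IsConst g → g ∈ l) ∧
      (l.length + 1 ≤ 2 * sizeList Fs ∨ l = []) := by
    intro Fs f h hc1 hc2
    obtain ⟨l, hl, hl' | ⟨hl', F, hF, hF'⟩ | hl'⟩ := key Fs h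
    · refine ⟨l, ?_, Or.inr hl'.1⟩
      rintro g (rfl | hg) hgc
      · exact absurd (hc1 hl'.2) hgc
      · exact hl g hg hgc
    · refine ⟨l, ?_, Or.inl hl'⟩
      rintro g (rfl | hg) hgc
      · rcases hc2 F hF hF' with he | he
        · refine hl _ ((mem_funsList _ _).2 ⟨F, hF, ?_⟩) hgc
          rw [he]; exact sem_mem_funs F
        · exact absurd he hgc
      · exact hl g hg hgc
    · refine ⟨f :: l, ?_, Or.inl (by simp; omega)⟩
      rintro g (rfl | hg) hgc
      · simp
      · exact List.mem_cons_of_mem _ (hl g hg hgc)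
  induction F using induction_list with
  | hconst b =>
    refine ⟨[], ?_, Or.inr rfl⟩
    rintro f hf hc
    rw [funs] at hf
    refine absurd ?_ hc
    rw [hf]
    intro S S'
    simp [sem_const]
  | hlit i b =>
    refine ⟨[sem (lit i b)], ?_, Or.inl (by simp [size])⟩
    intro f hf _
    rw [funs] at hf
    simpa using hf
  | hand Fs ih =>
    rw [funs, size]
    refine fin Fs _ ih ?_ ?_
    · intro h S S'
      simp only [sem_and]
      exact forall_congr' fun F => forall_congr' fun hF => h F hF S S'
    · intro F hF h
      by_cases hall : ∀ F' ∈ Fs, F' = F ∨ ∀ S, sem F' S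
      · left
        funext S
        rw [sem_and, eq_iff_iff]
        refine ⟨fun h' => h' F hF, fun h' F' hF' => ?_⟩
        rcases hall F' hF' with rfl | h''
        · exact h'
        · exact h'' S
      · right
        push Not at hall
        obtain ⟨F', hF', hne, S, hS⟩ := hall
        have := (h F' hF').resolve_left hne
        intro S₁ S₂
        rw [sem_and, sem_and]
        exact ⟨fun h' => absurd ((this S₁ S).1 (h' F' hF')) hS,
          fun h' => absurd ((this S₂ S).1 (h' F' hF')) hS⟩
  | hor Fs ih =>
    rw [funs, size]
    refine fin Fs _ ih ?_ ?_
    · intro h S S'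
      simp only [sem_or]
      exact exists_congr fun F => and_congr_right fun hF => h F hF S S'
    · intro F hF h
      by_cases hall : ∀ F' ∈ Fs, F' = F ∨ ∀ S, ¬ sem F' S
      · left
        funext S
        rw [sem_or, eq_iff_iff]
        refine ⟨?_, fun h' => ⟨F, hF, h'⟩⟩
        rintro ⟨F', hF', h'⟩
        rcases hall F' hF' with rfl | h''
        · exact h'
        · exact absurd h' (h'' S)
      · right
        push Not at hall
        obtain ⟨F', hF', hne, S, hS⟩ := hall
        have := (h F' hF').resolve_left hne
        intro S₁ S₂
        rw [sem_or, sem_or]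
        exact ⟨fun _ => ⟨F', hF', (this S S₂).1 hS⟩, fun _ => ⟨F', hF', (this S S₁).1 hS⟩⟩

end AC0

namespace SubPMM

open Finset

/-- The vertices of the line `0, …, k` touched by a set of edges. -/
def verts (k : ℕ) (D : Finset ℤ) : Finset (Fin (k + 1)) :=
  univ.filter fun v => ((v : ℕ) : ℤ) ∈ D ∨ ((v : ℕ) : ℤ) - 1 ∈ D

lemma verts_mono {k : ℕ} {D E : Finset ℤ} (h : D ⊆ E) : verts k D ⊆ verts k E :=
  monotone_filter_right _ fun _ _ hv => hv.imp (fun h' => h h') fun h' => h h'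

lemma verts_disjoint {k : ℕ} {D E : Finset ℤ} (h : Apart D E) :
    Disjoint (verts k D) (verts k E) := by
  rw [disjoint_left]
  intro v hD hE
  simp only [verts, mem_filter, mem_univ, true_and] at hD hE
  rcases hD with hD | hD <;> rcases hE with hE | hE <;> have := h _ hD _ hE <;> omega

/-- Membership in `S` only depends on the coordinates in `W`. -/
def DeterminedBy {V α : Type*} (W : Finset V) (S : Finset (V → α)) : Prop :=
  ∀ x y, (∀ v ∈ W, x v = y v) → x ∈ S → y ∈ S

lemma DeterminedBy.mono {V α : Type*} {W W' : Finset V} {S : Finset (V → α)}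
    (h : DeterminedBy W S) (hW : W ⊆ W') : DeterminedBy W' S :=
  fun x y hxy => h x y fun v hv => hxy v (hW hv)

/-- A set all of whose fibres in the directions `W` have density at most `1 / q` meets a set not
depending on the coordinates in `W` in a proportion of at most `1 / q`. -/
lemma card_inter_mul_le {V α : Type*} [Fintype V] [DecidableEq V] [Fintype α] [DecidableEq α]
    [Nonempty α] (W : Finset V) (Q S : Finset (V → α))
    (hQ : ∀ x y, (∀ v ∉ W, x v = y v) → x ∈ Q → y ∈ Q) (q : ℕ)
    (hS : ∀ z : V → α, (S.filter fun x => ∀ v ∉ W, x v = z v).card * q ≤ Fintype.card α ^ W.card) :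
    (Q ∩ S).card * q ≤ Q.card := by
  let put : (V → α) → (W → α) → V → α := fun x y v => if h : v ∈ W then y ⟨v, h⟩ else x v
  have hput : ∀ x y, ∀ v ∉ W, put x y v = x v := fun x y v hv => by simp [put, hv]
  have hput' : ∀ x y, ∀ v (hv : v ∈ W), put x y v = y ⟨v, hv⟩ := fun x y v hv => by
    simp [put, hv]
  have hpp : ∀ x y y', put (put x y) y' = put x y' := by
    intro x y y'
    funext v
    by_cases hv : v ∈ W <;> simp [put, hv]
  have hid : ∀ x : V → α, put x (fun w => x w) = x := by
    intro x
    funext v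
    by_cases hv : v ∈ W <;> simp [put, hv]
  have key := card_mul_card_filter_mem (fun (x : V → α) (w : W) => x w) put
    (by intro x y; funext w; simp [hput']) hpp hid
    (fun x => univ.filter fun y => put x y ∈ Q ∩ S) (by intro x y; simp [hpp])
  simp only [mem_filter, mem_univ, true_and, hid, filter_mem_eq_inter, univ_inter] at key
  have hcard : Fintype.card (W → α) = Fintype.card α ^ W.card := by simp
  have hpos : 0 < Fintype.card α ^ W.card := pow_pos Fintype.card_pos _
  rw [hcard] at key
  have hsum : (∑ x, (univ.filter fun y => put x y ∈ Q ∩ S).card) * q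
      ≤ Q.card * Fintype.card α ^ W.card := by
    rw [sum_mul, ← smul_eq_mul (Q.card), ← sum_const, ← sum_subset (subset_univ Q)]
    · refine sum_le_sum fun x _ => le_trans (Nat.mul_le_mul_right _ ?_) (hS x)
      refine card_le_card_of_injOn (put x) ?_ ?_
      · intro y hy
        simp only [coe_filter, Set.mem_ofPred_eq, mem_univ, true_and, mem_inter] at hy ⊢
        exact ⟨hy.2, fun v hv => hput x y v hv⟩
      · intro y _ y' _ hyy
        funext w
        rw [← hput' x y w w.2, hyy, hput']
    · intro x _ hx
      rw [card_eq_zero.2, zero_mul]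
      refine filter_eq_empty_iff.2 fun y _ hy => hx ?_
      exact hQ _ _ (hput x y) (mem_inter.1 hy).1
  rw [← key] at hsum
  refine Nat.le_of_mul_le_mul_left ?_ hpos
  calc _ = Fintype.card α ^ W.card * (Q ∩ S).card * q := by ring
    _ ≤ _ := hsum
    _ = _ := by ring

/-- All slices of `S` in the directions of a union `D` of connected components of `B` have
density at most `q ^ (- nc D)`. -/
def Small {k n : ℕ} (q : ℕ) (B : Finset ℤ) (S : Finset (Fin (k + 1) → Fin n)) : Prop :=
  DeterminedBy (verts k B) S ∧ ∀ D ⊆ B, Apart D (B \ D) → ∀ z : Fin (k + 1) → Fin n,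
    (S.filter fun x => ∀ v ∉ verts k D, x v = z v).card * q ^ nc D ≤ n ^ (verts k D).card

lemma card_filter_mul_le_of_gain {k n q : ℕ} [NeZero n] :
    ∀ {L : List (Finset ℤ)} {Ss : List (Finset (Fin (k + 1) → Fin n))} {U : Finset ℤ} {g : ℕ}
      (Q : Finset (Fin (k + 1) → Fin n)), Gain U L g → DeterminedBy (verts k U) Q →
      List.Forall₂ (Small q) L Ss →
      (Q.filter fun x => ∀ S ∈ Ss, x ∈ S).card * q ^ g ≤ Q.card := by
  intro L
  induction L with
  | nil =>
    intro Ss U g Q hg _ hS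
    obtain rfl : g = 0 := hg
    rw [pow_zero, mul_one]
    exact card_filter_le _ _
  | cons B L ih =>
    intro Ss U g Q hg hQ hS
    obtain ⟨S, Ss, hS1, hSs, rfl⟩ := List.forall₂_cons_left_iff.1 hS
    obtain ⟨D, g', hDB, hD1, hD2, hg', rfl⟩ := hg
    have h1 : (Q ∩ S).card * q ^ nc D ≤ Q.card := by
      refine card_inter_mul_le (verts k D) Q S ?_ _ ?_
      · intro x y hxy
        refine hQ x y fun v hv => hxy v ?_
        exact disjoint_right.1 (verts_disjoint hD2) hv
      · intro z
        rw [Fintype.card_fin]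
        convert hS1.2 D hDB hD1 z
    have h2 := ih (Q ∩ S) hg' (by
      intro x y hxy hx
      rw [mem_inter] at hx ⊢
      exact ⟨hQ.mono (verts_mono subset_union_left) x y hxy hx.1,
        hS1.1.mono (verts_mono subset_union_right) x y hxy hx.2⟩) hSs
    have h3 : (Q.filter fun x => ∀ S' ∈ S :: Ss, x ∈ S')
        = (Q ∩ S).filter fun x => ∀ S' ∈ Ss, x ∈ S' := by
      ext x
      simp [and_assoc]
    rw [h3]
    calc _ = ((Q ∩ S).filter fun x => ∀ S' ∈ Ss, x ∈ S').card * q ^ g' * q ^ nc D := by ring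
      _ ≤ (Q ∩ S).card * q ^ nc D := Nat.mul_le_mul_right _ h2
      _ ≤ _ := h1

/-- The edges of the path `x` in the layers of `A`. -/
def edges {k n : ℕ} (x : Fin (k + 1) → Fin n) (A : Finset ℤ) : Set (Fin k × Fin n × Fin n) :=
  {p | ((p.1 : ℕ) : ℤ) ∈ A ∧ p.2.1 = x p.1.castSucc ∧ p.2.2 = x p.1.succ}

lemma edges_mono {k n : ℕ} (x : Fin (k + 1) → Fin n) {A B : Finset ℤ} (h : A ⊆ B) :
    edges x A ⊆ edges x B := fun _ hp => ⟨h hp.1, hp.2⟩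

lemma edges_congr {k n : ℕ} {x y : Fin (k + 1) → Fin n} {A : Finset ℤ}
    (h : ∀ v ∈ verts k A, x v = y v) : edges x A = edges y A := by
  ext p
  refine and_congr_right fun hp => ?_
  rw [h p.1.castSucc (by simp [verts, hp]), h p.1.succ (by simp [verts, hp])]

open Classical in
/-- The paths `x` such that the edges `A` of `x` are accepted together with the edges `γ a`,
and no edge of `A` can be omitted even with the help of the edges `γ b`. -/
noncomputable def critical {k n : ℕ} (γ : ℕ → Set (Fin k × Fin n × Fin n)) (a b : ℕ)
    (A : Finset ℤ) (f : Set (Fin k × Fin n × Fin n) → Prop) : Finset (Fin (k + 1) → Fin n) :=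
  univ.filter fun x => f (γ a ∪ edges x A) ∧ ∀ e ∈ A, ¬ f (γ b ∪ edges x (A.erase e))

lemma mem_critical {k n : ℕ} {γ : ℕ → Set (Fin k × Fin n × Fin n)} {a b : ℕ}
    {A : Finset ℤ} {f : Set (Fin k × Fin n × Fin n) → Prop} {x : Fin (k + 1) → Fin n} :
    x ∈ critical γ a b A f ↔
      f (γ a ∪ edges x A) ∧ ∀ e ∈ A, ¬ f (γ b ∪ edges x (A.erase e)) := by
  simp [critical]

lemma determinedBy_critical {k n : ℕ} (γ : ℕ → Set (Fin k × Fin n × Fin n)) (a b : ℕ)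
    (A : Finset ℤ) (f : Set (Fin k × Fin n × Fin n) → Prop) :
    DeterminedBy (verts k A) (critical γ a b A f) := by
  intro x y hxy
  rw [mem_critical, mem_critical, edges_congr hxy]
  refine fun h => ⟨h.1, fun e he => ?_⟩
  rw [← edges_congr fun v hv => hxy v (verts_mono (erase_subset e A) hv)]
  exact h.2 e he

lemma critical_anti {k n : ℕ} {γ : ℕ → Set (Fin k × Fin n × Fin n)} (hγ : Monotone γ)
    {a b b' : ℕ} (hb : b ≤ b') (A : Finset ℤ) {f : Set (Fin k × Fin n × Fin n) → Prop}
    (hf : Monotone f) : critical γ a b' A f ⊆ critical γ a b A f := by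
  intro x
  rw [mem_critical, mem_critical]
  exact fun h => ⟨h.1, fun e he h' => h.2 e he (hf (Set.union_subset_union_left _ (hγ hb)) h')⟩

lemma card_filter_exists_mem_le {X Y : Type*} [DecidableEq X] (R : Finset X)
    (p : Y → Finset X) (Fs : List Y) :
    (R.filter fun x => ∃ y ∈ Fs, x ∈ p y).card
      ≤ (Fs.map fun y => (R.filter fun x => x ∈ p y).card).sum := by
  induction Fs with
  | nil => simp
  | cons y Fs ih =>
    rw [List.map_cons, List.sum_cons]
    refine le_trans (le_trans (card_le_card ?_) (card_union_le (R.filter fun x => x ∈ p y)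
      (R.filter fun x => ∃ y ∈ Fs, x ∈ p y))) (Nat.add_le_add_left ih _)
    intro x
    simp only [mem_filter, mem_union, List.mem_cons, exists_eq_or_imp]
    tauto

lemma card_filter_forall_exists_le {X Y I : Type*} [DecidableEq X] (Fs : List Y)
    (p : Y → I → Finset X) (N : ℝ) (w : ℝ) (hw : (Fs.length : ℝ) ≤ w)
    (hN : 0 ≤ N) :
    ∀ (us : List I) (R : Finset X),
      (∀ Qs, List.Forall₂ (fun e Q => ∃ y ∈ Fs, Q = p y e) us Qs →
        ((R.filter fun x => ∀ Q ∈ Qs, x ∈ Q).card : ℝ) ≤ N) →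
      ((R.filter fun x => ∀ e ∈ us, ∃ y ∈ Fs, x ∈ p y e).card : ℝ) ≤ w ^ us.length * N := by
  intro us
  induction us with
  | nil => intro R h; simpa using h [] List.Forall₂.nil
  | cons e us ih =>
    intro R h
    have hw0 : 0 ≤ w := le_trans (Nat.cast_nonneg _) hw
    have e1 : (R.filter fun x => ∀ e' ∈ e :: us, ∃ y ∈ Fs, x ∈ p y e')
        = (R.filter fun x => ∀ e' ∈ us, ∃ y ∈ Fs, x ∈ p y e').filter
          fun x => ∃ y ∈ Fs, x ∈ p y e := by
      ext x
      simp only [mem_filter, List.forall_mem_cons]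
      tauto
    rw [e1]
    have h2 := card_filter_exists_mem_le
      (R.filter fun x => ∀ e' ∈ us, ∃ y ∈ Fs, x ∈ p y e') (fun y => p y e) Fs
    have h3 : ∀ y ∈ Fs, (((R.filter fun x => ∀ e' ∈ us, ∃ y ∈ Fs, x ∈ p y e').filter
        fun x => x ∈ p y e).card : ℝ) ≤ w ^ us.length * N := by
      intro y hy
      have h4 := ih (R.filter fun x => x ∈ p y e) (by
        intro Qs hQs
        have h5 := h (p y e :: Qs) (List.Forall₂.cons ⟨y, hy, rfl⟩ hQs)
        convert h5 using 3
        ext x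
        simp [and_assoc])
      refine le_trans (le_of_eq ?_) h4
      congr 2
      ext x
      simp only [mem_filter]
      tauto
    calc _ ≤ (((Fs.map fun y => ((R.filter fun x => ∀ e' ∈ us, ∃ y ∈ Fs,
          x ∈ p y e').filter fun x => x ∈ p y e).card).sum : ℕ) : ℝ) := by exact_mod_cast h2
      _ ≤ Fs.length * (w ^ us.length * N) := by
          rw [Nat.cast_list_sum, List.map_map]
          have := List.sum_le_card_nsmul (Fs.map ((fun m : ℕ => (m : ℝ)) ∘ fun y =>
            ((R.filter fun x => ∀ e' ∈ us, ∃ y ∈ Fs, x ∈ p y e').filter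
              fun x => x ∈ p y e).card)) (w ^ us.length * N) (by
                intro z hz
                obtain ⟨y, hy, rfl⟩ := List.mem_map.1 hz
                exact h3 y hy)
          simpa using this
      _ ≤ w * (w ^ us.length * N) := by gcongr
      _ = _ := by rw [List.length_cons, pow_succ]; ring

lemma exists_eq_succ_of_antitone {Φ : ℕ → ℕ} (h : ∀ j, Φ (j + 1) ≤ Φ j) (N : ℕ) (h0 : Φ 0 ≤ N) :
    ∃ j ≤ N, Φ (j + 1) = Φ j := by
  by_contra! hc
  have : ∀ j ≤ N + 1, Φ j + j ≤ N := by
    intro j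
    induction j with
    | zero => simpa using h0
    | succ j ih =>
      intro hj
      have h1 := ih (by omega)
      have h2 := h j
      have h3 := hc j (by omega)
      omega
  have := this (N + 1) le_rfl
  omega

/-- If `f e` accepts the edges `A` but needs the edge `e`, then at some time step we may choose
minimal sets of edges accepted by the `f e` simultaneously for all `e`. -/
lemma exists_mem_critical {k n : ℕ} {γ : ℕ → Set (Fin k × Fin n × Fin n)} (hγ : Monotone γ)
    {t : ℕ → ℕ} (ht : Monotone t) (A : Finset ℤ) (x : Fin (k + 1) → Fin n) (N : ℕ)
    (hN : A.card ^ 2 ≤ N)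
    (f : ℤ → Set (Fin k × Fin n × Fin n) → Prop) (hf : ∀ e ∈ A, Monotone (f e))
    (hacc : ∀ e ∈ A, f e (γ (t 0) ∪ edges x A))
    (hrej : ∀ e ∈ A, ¬ f e (γ (t (N + 1)) ∪ edges x (A.erase e))) :
    ∃ j ≤ N, ∃ C : ℤ → Finset ℤ, (∀ e ∈ A, C e ⊆ A ∧ e ∈ C e) ∧
      ∀ e ∈ A, x ∈ critical γ (t j) (t (j + 1)) (C e) (f e) := by
  let sizes : ℤ → ℕ → Set ℕ := fun e j => {c | ∃ C ⊆ A, C.card = c ∧ f e (γ (t j) ∪ edges x C)}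
  have hmono : ∀ e ∈ A, ∀ i j, i ≤ j → ∀ C, f e (γ (t i) ∪ edges x C) →
      f e (γ (t j) ∪ edges x C) := fun e he i j hij C h =>
    hf e he (Set.union_subset_union_left _ (hγ (ht hij))) h
  have hne : ∀ e ∈ A, ∀ j, (sizes e j).Nonempty := fun e he j =>
    ⟨A.card, A, Subset.rfl, rfl, hmono e he 0 j (Nat.zero_le j) A (hacc e he)⟩
  have hanti : ∀ e ∈ A, ∀ j, sInf (sizes e (j + 1)) ≤ sInf (sizes e j) := by
    intro e he j
    obtain ⟨C, hC, hc, hfC⟩ := Nat.sInf_mem (hne e he j)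
    exact Nat.sInf_le ⟨C, hC, hc, hmono e he j (j + 1) (Nat.le_succ j) C hfC⟩
  obtain ⟨j, hj, hjeq⟩ := exists_eq_succ_of_antitone (Φ := fun j => ∑ e ∈ A, sInf (sizes e j))
    (fun j => sum_le_sum fun e he => hanti e he j) N (by
      refine le_trans (sum_le_card_nsmul A _ A.card fun e he => ?_) (by
        rw [smul_eq_mul, ← sq]; exact hN)
      exact Nat.sInf_le ⟨A, Subset.rfl, rfl, hacc e he⟩)
  have heq := (sum_eq_sum_iff_of_le fun e he => hanti e he j).1 hjeq
  choose! C hC hc hfC using fun e (he : e ∈ A) => Nat.sInf_mem (hne e he j)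
  have heC : ∀ e ∈ A, e ∈ C e := by
    intro e he
    by_contra hcon
    refine hrej e he (hf e he ?_ (hmono e he j (N + 1) (by omega) (C e) (hfC e he)))
    exact Set.union_subset_union_right _ (edges_mono x (subset_erase.2 ⟨hC e he, hcon⟩))
  refine ⟨j, hj, C, fun e he => ⟨hC e he, heC e he⟩, fun e he => ?_⟩
  rw [mem_critical]
  refine ⟨hfC e he, fun e' he' hacc' => ?_⟩
  have h1 : sInf (sizes e (j + 1)) ≤ ((C e).erase e').card :=
    Nat.sInf_le ⟨_, (erase_subset _ _).trans (hC e he), rfl, hacc'⟩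
  have h2 := card_erase_lt_of_mem he'
  have h3 := heq e he
  have h4 := hc e he
  omega

/-- The number of time steps used for formulas of `⋀`-depth `d`. -/
def span (k d : ℕ) : ℕ := (k + 1) * (k ^ 2 + 1) ^ d

open Classical in
/-- The functions `C` on `A`, extended by `∅`, whose values are subsets of `A`. -/
noncomputable def choices (A : Finset ℤ) : Finset (ℤ → Finset ℤ) :=
  (A.pi fun _ => A.powerset).image fun φ e => if h : e ∈ A then φ e h else ∅

lemma natCast_sum_map_mul_le {Y : Type*} (p s : Y → ℕ) (c r : ℝ) (Fs : List Y)
    (h : ∀ G ∈ Fs, (p G : ℝ) * c ≤ s G * r) :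
    (((Fs.map p).sum : ℕ) : ℝ) * c ≤ ((Fs.map s).sum : ℕ) * r := by
  induction Fs with
  | nil => simp
  | cons G Fs ih =>
    have h1 := h G (by simp)
    have h2 := ih fun G' hG' => h G' (by simp [hG'])
    simp only [List.map_cons, List.sum_cons, Nat.cast_add, add_mul]
    linarith

lemma card_choices_le (A : Finset ℤ) : (choices A).card ≤ 2 ^ (A.card ^ 2) := by
  classical
  refine card_image_le.trans (le_of_eq ?_)
  rw [card_pi, prod_const, card_powerset, ← pow_mul, sq]

lemma exists_mem_choices {A : Finset ℤ} {C : ℤ → Finset ℤ} (h : ∀ e ∈ A, C e ⊆ A) :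
    ∃ C' ∈ choices A, ∀ e ∈ A, C' e = C e := by
  refine ⟨fun e => if e ∈ A then C e else ∅, ?_, fun e he => by simp [he]⟩
  classical
  rw [choices, mem_image]
  refine ⟨fun e _ => C e, ?_, ?_⟩
  · simpa using h
  · funext e
    by_cases he : e ∈ A <;> simp [he]

set_option maxHeartbeats 2000000 in
/-- The main counting estimate: a strategy of value `v` bounds the number of critical paths of
a formula by `size * u ^ (-v)`. -/
theorem card_critical_le {k n u T : ℕ} [NeZero n] (hu : 1 ≤ u) (hun : u ≤ n)
    {γ : ℕ → Set (Fin k × Fin n × Fin n)} (hγ : Monotone γ)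
    (F : AC0 (Fin k × Fin n × Fin n)) :
    AC0.Mono F → AC0.AndFanInLE (u : ℝ) F →
    (∀ f ∈ AC0.funs F, ∀ a b B, B ⊆ Icc (0 : ℤ) (k - 1) → B.Nonempty → a + (k + 1) ≤ b → b ≤ T →
      Small (u ^ 6) B (critical γ a b B f)) →
    ∀ (d a b : ℕ) (A : Finset ℤ) (L : List (Finset ℤ))
      (Ss : List (Finset (Fin (k + 1) → Fin n))) (v : ℝ),
      AC0.andDepth F ≤ d → a + span k d ≤ b → b ≤ T → A ⊆ Icc (0 : ℤ) (k - 1) → A.Nonempty →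
      List.Forall₂ (Small (u ^ 6)) L Ss → Win d A L v →
      (((critical γ a b A (AC0.sem F)).filter fun x => ∀ S ∈ Ss, x ∈ S).card : ℝ)
        * (u : ℝ) ^ v ≤ AC0.size F * ((k ^ 2 + 1) * 2 ^ (k ^ 2)) ^ d * (n : ℝ) ^ (k + 1) := by
  have hu1 : (1 : ℝ) ≤ u := by exact_mod_cast hu
  have hu0 : (0 : ℝ) < u := by linarith
  have hκ : (1 : ℝ) ≤ ((k : ℝ) ^ 2 + 1) * 2 ^ (k ^ 2) := by
    have h1 : (1 : ℝ) ≤ (k : ℝ) ^ 2 + 1 := by nlinarith [sq_nonneg (k : ℝ)]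
    have h2 : (1 : ℝ) ≤ 2 ^ (k ^ 2) := one_le_pow₀ (by norm_num)
    nlinarith
  induction F using AC0.induction_list with
  | hconst c =>
    intro _ _ _ d a b A L Ss v _ _ _ _ hA _ _
    have : critical γ a b A (AC0.sem (AC0.const c)) = ∅ := by
      rw [eq_empty_iff_forall_notMem]
      intro x hx
      rw [mem_critical] at hx
      obtain ⟨e, he⟩ := hA
      have := hx.2 e he
      rw [AC0.sem_const] at this hx
      exact this hx.1
    simp [this, AC0.size]
  | hlit p c =>
    intro hm _ _ d a b A L Ss v _ hab _ _ hA hSs hW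
    obtain rfl : c = true := hm
    by_cases hemp : critical γ a b A (AC0.sem (AC0.lit p true)) = ∅
    · rw [hemp]
      simp only [filter_empty, card_empty, Nat.cast_zero, zero_mul]
      positivity
    obtain ⟨x₀, hx₀⟩ := nonempty_iff_ne_empty.2 hemp
    set Q := critical γ a b A (AC0.sem (AC0.lit p true)) with hQ
    have hsub : ∀ x ∈ Q, A = {((p.1 : ℕ) : ℤ)} ∧ p.2.1 = x p.1.castSucc := by
      intro x hx
      rw [hQ, mem_critical] at hx
      simp only [AC0.sem_lit_true, Set.mem_union, not_or] at hx
      obtain ⟨h1, h2⟩ := hx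
      have hna : p ∉ γ a := by
        obtain ⟨e, he⟩ := hA
        exact fun h => (h2 e he).1 (hγ (by omega) h)
      have hpx := h1.resolve_left hna
      refine ⟨?_, hpx.2.1⟩
      rw [eq_singleton_iff_unique_mem]
      refine ⟨hpx.1, fun e he => ?_⟩
      by_contra hne
      exact (h2 e he).2 ⟨mem_erase.2 ⟨Ne.symm hne, hpx.1⟩, hpx.2⟩
    have hAeq := (hsub x₀ hx₀).1
    rw [hAeq] at hW
    obtain ⟨g, hg, hv⟩ := Win.singleton hW
    have hcount := card_filter_mul_le_of_gain Q hg
      (by rw [← hAeq]; exact determinedBy_critical γ a b A _) hSs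
    have hQn : Q.card * n ≤ n ^ (k + 1) := by
      have h1 := card_inter_mul_le ({p.1.castSucc} : Finset (Fin (k + 1))) univ Q
        (by simp) n (by
          intro z
          simp only [card_singleton, pow_one, Fintype.card_fin]
          refine (Nat.mul_le_mul_right n (card_le_one.2 ?_)).trans (by simp)
          intro x hx y hy
          simp only [mem_filter, mem_singleton] at hx hy
          funext v
          by_cases hv : v = p.1.castSucc
          · rw [hv, ← (hsub x hx.1).2, ← (hsub y hy.1).2]
          · rw [hx.2 v hv, hy.2 v hv])
      simpa using h1
    set N := (Q.filter fun x => ∀ S ∈ Ss, x ∈ S).card with hN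
    have hfin : (N : ℝ) * (u : ℝ) ^ v ≤ (n : ℝ) ^ (k + 1) := by
      calc (N : ℝ) * (u : ℝ) ^ v ≤ N * (u : ℝ) ^ (6 * (g : ℝ) + 1) := by gcongr
        _ = ((N * (u ^ 6) ^ g : ℕ) : ℝ) * u := by
            rw [Real.rpow_add hu0, Real.rpow_one, Real.rpow_mul hu0.le, Real.rpow_natCast,
              show (6 : ℝ) = ((6 : ℕ) : ℝ) by norm_num, Real.rpow_natCast]
            push_cast
            ring
        _ ≤ (Q.card : ℝ) * n := by gcongr
        _ ≤ (n : ℝ) ^ (k + 1) := by exact_mod_cast hQn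
    refine hfin.trans ?_
    rw [AC0.size, Nat.cast_one, one_mul]
    exact le_mul_of_one_le_left (by positivity) (one_le_pow₀ hκ)
  | hor Fs ih =>
    intro hm hfan hsmall d a b A L Ss v hd hab hbT hAk hA hSs hW
    rw [AC0.andDepth, AC0.andDepthList_le_iff] at hd
    rw [AC0.Mono, AC0.monoList_iff] at hm
    rw [AC0.AndFanInLE, AC0.andFanInLEList_iff] at hfan
    have hcov : ((critical γ a b A (AC0.sem (AC0.or Fs))).filter fun x => ∀ S ∈ Ss, x ∈ S).card
        ≤ ((Fs.map fun G => (((univ : Finset (Fin (k + 1) → Fin n)).filter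
          fun x => ∀ S ∈ Ss, x ∈ S).filter fun x => x ∈ critical γ a b A (AC0.sem G)).card).sum) := by
      refine (card_le_card ?_).trans (card_filter_exists_mem_le _ _ Fs)
      intro x hx
      simp only [mem_filter, mem_univ, true_and, mem_critical, AC0.sem_or, not_exists,
        not_and] at hx ⊢
      obtain ⟨⟨⟨G, hG, h1⟩, h2⟩, h3⟩ := hx
      exact ⟨h3, G, hG, h1, fun e he => h2 e he G hG⟩
    refine (mul_le_mul_of_nonneg_right (Nat.cast_le.2 hcov) (by positivity)).trans ?_
    rw [AC0.size, AC0.sizeList_eq_sum, mul_assoc]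
    refine natCast_sum_map_mul_le _ _ _ _ Fs fun G hG => ?_
    rw [← mul_assoc]
    refine le_trans (le_of_eq ?_) (ih G hG (hm G hG) (hfan G hG) (fun f hf => hsmall f (by
      rw [AC0.funs, Set.mem_insert_iff, AC0.mem_funsList]
      exact Or.inr ⟨G, hG, hf⟩)) d a b A L Ss v (hd G hG) hab hbT hAk hA hSs hW)
    congr 3
    ext x
    simp only [mem_filter, mem_univ, true_and]
    tauto
  | hand Fs ih =>
    intro hm hfan hsmall d a b A L Ss v hd hab hbT hAk hA hSs hW
    rw [AC0.andDepth] at hd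
    obtain ⟨d, rfl⟩ : ∃ d', d = d' + 1 := ⟨d - 1, by omega⟩
    rw [Nat.add_le_add_iff_right, AC0.andDepthList_le_iff] at hd
    rw [AC0.Mono, AC0.monoList_iff] at hm
    rw [AC0.AndFanInLE, AC0.andFanInLEList_iff] at hfan
    have hfuns : ∀ G ∈ Fs, ∀ f ∈ AC0.funs G, f ∈ AC0.funs (AC0.and Fs) := by
      intro G hG f hf
      rw [AC0.funs, Set.mem_insert_iff, AC0.mem_funsList]
      exact Or.inr ⟨G, hG, hf⟩
    have hspan : k + 1 ≤ span k d := Nat.le_mul_of_pos_right _ (by positivity)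
    have hAcard : A.card ≤ k := by
      have := card_le_card hAk
      simpa using this
    set t : ℕ → ℕ := fun j => a + j * span k d with ht
    have htm : Monotone t := fun i j hij => Nat.add_le_add_left (Nat.mul_le_mul_right _ hij) _
    have htb : ∀ j ≤ k ^ 2 + 1, t j ≤ b := by
      intro j hj
      refine le_trans (Nat.add_le_add_left (Nat.mul_le_mul_right _ hj) _) (le_trans ?_ hab)
      rw [span, span, pow_succ]
      exact Nat.add_le_add_left (le_of_eq (by ring)) _
    set r : ℝ := ((k ^ 2 + 1) * 2 ^ (k ^ 2)) ^ d * (n : ℝ) ^ (k + 1) with hr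
    have hr0 : 0 ≤ r := by positivity
    set Y : ℕ × (ℤ → Finset ℤ) → Finset (Fin (k + 1) → Fin n) := fun q =>
      univ.filter fun x => (∀ e ∈ A, ∃ G ∈ Fs,
        x ∈ critical γ (t q.1) (t (q.1 + 1)) (q.2 e) (AC0.sem G)) ∧ ∀ S ∈ Ss, x ∈ S with hY
    have hYbound : ∀ j ≤ k ^ 2, ∀ C : ℤ → Finset ℤ, (∀ e ∈ A, e ∈ C e ∧ C e ⊆ A) →
        ((Y (j, C)).card : ℝ) * (u : ℝ) ^ v ≤ AC0.size (AC0.and Fs) * r := by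
      intro j hj C hC
      have hcrit : ∀ e ∈ A, ∀ G ∈ Fs, Small (u ^ 6) (C e)
          (critical γ (t j) (t (j + 1)) (C e) (AC0.sem G)) := by
        intro e he G hG
        refine hsmall _ (hfuns G hG _ (AC0.sem_mem_funs G)) _ _ _ ((hC e he).2.trans hAk)
          ⟨e, (hC e he).1⟩ ?_ ((htb _ (by omega)).trans hbT)
        simp only [ht, add_mul, one_mul]
        omega
      obtain ⟨h, hh, us, hus, L₁, L₂, rfl, hW'⟩ := hW C hC
      have hS₁ := List.forall₂_take_append Ss L₁ L₂ hSs.flip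
      have hS₂ := List.forall₂_drop_append Ss L₁ L₂ hSs.flip
      have hcov : (Y (j, C)).card ≤ ((Fs.map fun G => ((univ.filter fun x =>
          (∀ S ∈ Ss, x ∈ S) ∧ ∀ e ∈ us, ∃ G' ∈ Fs,
            x ∈ critical γ (t j) (t (j + 1)) (C e) (AC0.sem G')).filter
              fun x => x ∈ critical γ (t j) (t (j + 1)) (C h) (AC0.sem G)).card).sum) := by
        refine (card_le_card ?_).trans (card_filter_exists_mem_le _ _ Fs)
        intro x hx
        simp only [hY, mem_filter, mem_univ, true_and] at hx ⊢
        exact ⟨⟨hx.2, fun e he => hx.1 e (hus e he)⟩, hx.1 h hh⟩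
      refine (mul_le_mul_of_nonneg_right (Nat.cast_le.2 hcov) (by positivity)).trans ?_
      rw [AC0.size, AC0.sizeList_eq_sum]
      refine natCast_sum_map_mul_le _ _ _ _ Fs fun G hG => ?_
      have hch := card_filter_forall_exists_le Fs
        (fun G' e => critical γ (t j) (t (j + 1)) (C e) (AC0.sem G'))
        (AC0.size G * r / (u : ℝ) ^ (v + us.length)) u hfan.1 (by positivity) us
        ((critical γ (t j) (t (j + 1)) (C h) (AC0.sem G)).filter fun x => ∀ S ∈ Ss, x ∈ S) (by
          intro Qs hQs
          have hL : List.Forall₂ (Small (u ^ 6)) (L₁ ++ (us.map C ++ L₂))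
              (Ss.take L₁.length ++ (Qs ++ Ss.drop L₁.length)) := by
            refine List.rel_append hS₁.flip (List.rel_append ?_ hS₂.flip)
            rw [List.forall₂_map_left_iff]
            have hmem : ∀ us' Qs', (∀ e ∈ us', e ∈ A) → List.Forall₂ (fun e Q => ∃ G' ∈ Fs,
                Q = critical γ (t j) (t (j + 1)) (C e) (AC0.sem G')) us' Qs' →
                List.Forall₂ (fun e Q => Small (u ^ 6) (C e) Q) us' Qs' := by
              intro us' Qs' hmem hF
              induction hF with
              | nil => exact List.Forall₂.nil
              | cons hab _ ih' =>
                refine List.Forall₂.cons ?_ (ih' fun e he => hmem e (by simp [he]))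
                obtain ⟨G', hG', rfl⟩ := hab
                exact hcrit _ (hmem _ (by simp)) G' hG'
            exact hmem us Qs hus hQs
          have hih := ih G hG (hm G hG) (hfan.2 G hG) (fun f hf => hsmall f (hfuns G hG f hf))
            d (t j) (t (j + 1)) (C h) _ _ (v + us.length) (hd G hG) (by
              simp only [ht, add_mul, one_mul]
              omega) ((htb _ (by omega)).trans hbT) ((hC h hh).2.trans hAk) ⟨h, (hC h hh).1⟩
            hL hW'
          rw [le_div_iff₀ (by positivity), hr, ← mul_assoc]
          refine le_trans (le_of_eq ?_) hih
          congr 3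
          ext x
          simp only [mem_filter, List.mem_append]
          have : ∀ S, S ∈ Ss ↔ S ∈ Ss.take L₁.length ∨ S ∈ Ss.drop L₁.length := by
            intro S
            rw [← List.mem_append, List.take_append_drop]
          simp only [this]
          constructor
          · rintro ⟨⟨h1, h2⟩, h3⟩
            refine ⟨h1, ?_⟩
            rintro S (hS | hS | hS)
            · exact h2 S (Or.inl hS)
            · exact h3 S hS
            · exact h2 S (Or.inr hS)
          · rintro ⟨h1, h2⟩
            exact ⟨⟨h1, fun S hS => h2 S (by tauto)⟩, fun S hS => h2 S (by tauto)⟩)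
      refine (mul_le_mul_of_nonneg_right (le_trans (le_of_eq ?_) hch) (by positivity)).trans ?_
      · congr 2
        ext x
        simp only [mem_filter, mem_univ, true_and]
        tauto
      · rw [Real.rpow_add hu0, Real.rpow_natCast]
        refine le_of_eq ?_
        field_simp
    have hcov : (critical γ a b A (AC0.sem (AC0.and Fs))).filter (fun x => ∀ S ∈ Ss, x ∈ S)
        ⊆ (range (k ^ 2 + 1) ×ˢ (choices A).filter fun C => ∀ e ∈ A, e ∈ C e ∧ C e ⊆ A).biUnion
          Y := by
      intro x hx
      rw [mem_filter, mem_critical] at hx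
      obtain ⟨⟨hacc, hrej⟩, hxS⟩ := hx
      simp only [AC0.sem_and, not_forall, exists_prop] at hacc hrej
      have : Nonempty (AC0 (Fin k × Fin n × Fin n)) := ⟨AC0.const true⟩
      choose! G hG hGrej using hrej
      obtain ⟨j, hj, C, hC, hxC⟩ := exists_mem_critical hγ htm A x (k ^ 2)
        (Nat.pow_le_pow_left hAcard 2) (fun e => AC0.sem (G e))
        (fun e he => (hm _ (hG e he)).sem_monotone) (fun e he => by
          have : t 0 = a := by simp [ht]
          rw [this]
          exact hacc _ (hG e he)) (fun e he h' => hGrej e he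
            ((hm _ (hG e he)).sem_monotone
              (Set.union_subset_union_left _ (hγ (htb _ le_rfl))) h'))
      obtain ⟨C', hC', hCC'⟩ := exists_mem_choices fun e he => (hC e he).1
      rw [mem_biUnion]
      refine ⟨(j, C'), ?_, ?_⟩
      · rw [mem_product, mem_range, mem_filter]
        refine ⟨Nat.lt_succ_of_le hj, hC', fun e he => ?_⟩
        simp only [hCC' e he]
        exact ⟨(hC e he).2, (hC e he).1⟩
      · simp only [hY, mem_filter, mem_univ, true_and]
        refine ⟨fun e he => ⟨G e, hG e he, ?_⟩, hxS⟩
        rw [hCC' e he]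
        exact hxC e he
    refine (mul_le_mul_of_nonneg_right (Nat.cast_le.2 ((card_le_card hcov).trans
      card_biUnion_le)) (by positivity)).trans ?_
    rw [Nat.cast_sum, sum_mul]
    refine (sum_le_card_nsmul _ _ (AC0.size (AC0.and Fs) * r) ?_).trans ?_
    · rintro ⟨j, C⟩ hq
      rw [mem_product, mem_range, mem_filter] at hq
      exact hYbound j (Nat.le_of_lt_succ hq.1) C hq.2.2
    · rw [nsmul_eq_mul, card_product, card_range]
      have h1 : ((choices A).filter fun C => ∀ e ∈ A, e ∈ C e ∧ C e ⊆ A).card ≤ 2 ^ (k ^ 2) :=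
        (card_filter_le _ _).trans ((card_choices_le A).trans
          (Nat.pow_le_pow_right (by norm_num) (Nat.pow_le_pow_left hAcard 2)))
      have h2 : (((k ^ 2 + 1) * ((choices A).filter
          fun C => ∀ e ∈ A, e ∈ C e ∧ C e ⊆ A).card : ℕ) : ℝ)
          ≤ ((k : ℝ) ^ 2 + 1) * 2 ^ (k ^ 2) := by
        exact_mod_cast Nat.mul_le_mul_left _ h1
      refine (mul_le_mul_of_nonneg_right h2 (by positivity)).trans (le_of_eq ?_)
      rw [hr, pow_succ]
      ring

/-- `D` is a minimal union of components of `B` such that the slice of `S` at `z` is too large. -/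
def Blocking {k n : ℕ} (q : ℕ) (B D : Finset ℤ) (z : Fin (k + 1) → Fin n)
    (S : Finset (Fin (k + 1) → Fin n)) : Prop :=
  (∀ D' ⊆ D, nc D' < nc D → Apart D' (B \ D') → ∀ z' : Fin (k + 1) → Fin n,
    (S.filter fun x => ∀ v ∉ verts k D', x v = z' v).card * q ^ nc D' ≤ n ^ (verts k D').card) ∧
  n ^ (verts k D).card < (S.filter fun x => ∀ v ∉ verts k D, x v = z v).card * q ^ nc D

/-- Some element of the slice of `S` at `z` has all its edges in `D` on the sampled paths. -/
def Hits {k n q : ℕ} (D : Finset ℤ) (z : Fin (k + 1) → Fin n)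
    (S : Finset (Fin (k + 1) → Fin n)) (ω : Fin q → Fin (k + 1) → Fin n) : Prop :=
  ∃ x ∈ S, (∀ v ∉ verts k D, x v = z v) ∧ ∀ i : Fin k, ((i : ℕ) : ℤ) ∈ D →
    ∃ r, x i.castSucc = ω r i.castSucc ∧ x i.succ = ω r i.succ

open Classical in
lemma card_le_mul_card_hits {k n q : ℕ} [NeZero n] (hq : 0 < q) {B D : Finset ℤ}
    (hD : D.Nonempty) (hDB : Apart D (B \ D)) (hk : nc D ≤ k)
    (z : Fin (k + 1) → Fin n) (S : Finset (Fin (k + 1) → Fin n)) (h : Blocking q B D z S) :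
    Fintype.card (Fin q → Fin (k + 1) → Fin n)
      ≤ (2 ^ k + 1) * (univ.filter fun ω : Fin q → _ => Hits D z S ω).card := by
  let G := {x // x ∈ runEnds D}
  obtain ⟨e₀, he₀⟩ := hD
  let g₀ : G := ⟨_, (runEnd_spec he₀).1⟩
  let c : Fin (k + 1) → G := fun v =>
    if h : ((v : ℕ) : ℤ) ∈ D then ⟨_, (runEnd_spec h).1⟩
    else if h : ((v : ℕ) : ℤ) - 1 ∈ D then ⟨_, (runEnd_spec h).1⟩ else g₀
  have hc1 : ∀ v : Fin (k + 1), ((v : ℕ) : ℤ) ∈ D → (c v : ℤ) = runEnd D v := by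
    intro v hv
    simp [c, hv]
  have hc2 : ∀ v : Fin (k + 1), ((v : ℕ) : ℤ) - 1 ∈ D → (c v : ℤ) = runEnd D (v - 1) := by
    intro v hv
    by_cases hv' : ((v : ℕ) : ℤ) ∈ D
    · rw [hc1 v hv']
      exact runEnd_adj hv' hv (by omega)
    · simp [c, hv, hv']
  have hG : Fintype.card G = nc D := by simp [G, nc]
  refine le_trans (card_le_mul_card_hit hq (verts k D) c z
    (S.filter fun x => ∀ v ∉ verts k D, x v = z v) (fun x hx => (mem_filter.1 hx).2) ?_ ?_) ?_
  · intro G' hG' z'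
    let p : ℤ → Prop := fun e => runEnd D e ∈ G'.map (Function.Embedding.subtype _)
    have hp : ∀ v, (c v ∈ G' ↔ (c v : ℤ) ∈ G'.map (Function.Embedding.subtype _)) := by
      intro v
      simp
    have hcomp : Compat p D := by
      intro e he he'
      simp only [p]
      rw [runEnd_adj he he' (by omega)]
    have hnc : nc (D.filter p) = G'.card := by
      unfold nc
      rw [runEnds_filter hcomp, ← card_map (Function.Embedding.subtype _)]
      congr 1
      ext e
      simp only [mem_filter, p]
      constructor
      · rintro ⟨h1, h2⟩
        rwa [runEnd_self h1] at h2
      · intro h1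
        have h2 : e ∈ runEnds D := by
          obtain ⟨g, _, rfl⟩ := mem_map.1 h1
          exact g.2
        rw [runEnd_self h2]
        exact ⟨h2, h1⟩
    have hverts : verts k (D.filter p) = (verts k D).filter fun v => c v ∈ G' := by
      ext v
      simp only [verts, mem_filter, mem_univ, true_and, hp]
      by_cases h1 : ((v : ℕ) : ℤ) ∈ D
      · rw [hc1 v h1]
        by_cases h2 : ((v : ℕ) : ℤ) - 1 ∈ D
        · have h3 : p ((v : ℕ) - 1 : ℤ) ↔ p ((v : ℕ) : ℤ) := by
            simp only [p]
            rw [runEnd_adj h1 h2 (by omega)]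
          simp only [h1, h2, h3, true_and, or_self]
          rfl
        · simp only [h1, h2, true_and, false_and, or_false]
          rfl
      · by_cases h2 : ((v : ℕ) : ℤ) - 1 ∈ D
        · rw [hc2 v h2]
          simp only [h1, h2, true_and, false_and, false_or]
          rfl
        · simp [h1, h2]
    have hlt : nc (D.filter p) < nc D := by
      rw [hnc, ← hG]
      exact card_lt_univ_of_notMem (not_forall.1 (mt eq_univ_iff_forall.2 hG')).choose_spec
    have hap : Apart (D.filter p) (B \ D.filter p) := by
      intro e he f hf
      by_contra hcon
      have heD := (mem_filter.1 he).1
      rw [mem_sdiff] at hf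
      by_cases hfD : f ∈ D
      · refine hf.2 (mem_filter.2 ⟨hfD, ?_⟩)
        have := (mem_filter.1 he).2
        simp only [p] at this ⊢
        rwa [← runEnd_adj heD hfD hcon]
      · exact hcon (hDB e heD f (mem_sdiff.2 ⟨hf.1, hfD⟩))
    have := h.1 _ (filter_subset _ _) hlt hap z'
    rw [hnc, hverts] at this
    rw [Fintype.card_fin]
    refine le_trans (Nat.mul_le_mul_right _ (card_le_card ?_)) this
    intro x hx
    simp only [mem_filter, not_and] at hx ⊢
    refine ⟨hx.1.1, fun v hv => hx.2 v ?_⟩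
    by_cases h1 : v ∈ verts k D
    · exact Or.inr (hv h1)
    · exact Or.inl h1
  · rw [Fintype.card_fin, hG]
    exact h.2.le
  · refine Nat.mul_le_mul ?_ (card_le_card ?_)
    · rw [hG]
      exact Nat.add_le_add_right (Nat.pow_le_pow_right (by norm_num) hk) 1
    · intro ω hω
      rw [mem_filter] at hω ⊢
      obtain ⟨-, i, hi⟩ := hω
      refine ⟨mem_univ _, _, (mem_filter.1 hi).1, (mem_filter.1 hi).2, fun j hj => ?_⟩
      have e1 : c j.castSucc = c j.succ := by
        apply Subtype.ext
        rw [hc1 j.castSucc (by simpa using hj), hc2 j.succ (by simpa using hj)]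
        simp
      refine ⟨i (c j.castSucc), ?_, ?_⟩
      · simp [mix, verts, hj]
      · simp [mix, verts, hj, e1]

/-- The edges of the paths sampled before time `t`. -/
def sampled {k n T u q : ℕ} (ω : Fin T → Fin u → Fin q → Fin (k + 1) → Fin n) (t : ℕ) :
    Set (Fin k × Fin n × Fin n) :=
  {p | ∃ s : Fin T, (s : ℕ) < t ∧ ∃ r i, p.2.1 = ω s r i p.1.castSucc ∧ p.2.2 = ω s r i p.1.succ}

lemma sampled_mono {k n T u q : ℕ} (ω : Fin T → Fin u → Fin q → Fin (k + 1) → Fin n) :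
    Monotone (sampled ω) := by
  rintro t t' h p ⟨s, hs, hp⟩
  exact ⟨s, hs.trans_le h, hp⟩

lemma sampled_congr {k n T u q : ℕ} {ω ω' : Fin T → Fin u → Fin q → Fin (k + 1) → Fin n} {t : ℕ}
    (h : ∀ s : Fin T, (s : ℕ) < t → ω s = ω' s) : sampled ω t = sampled ω' t := by
  ext p
  refine exists_congr fun s => and_congr_right fun hs => ?_
  rw [h s hs]

open Classical in
/-- If a slice is too large, then with high probability it is hit by one of the rounds of the
next samples. -/
lemma card_not_hits_mul_le {k n T u q : ℕ} [NeZero n] (hq : 0 < q) {B D : Finset ℤ}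
    (hD : D.Nonempty) (hDB : Apart D (B \ D)) (hk : nc D ≤ k) (z : Fin (k + 1) → Fin n)
    (f : Set (Fin k × Fin n × Fin n) → Prop) (a : ℕ) (b : Fin T) (hab : a ≤ b) :
    (univ.filter fun ω : Fin T → Fin u → Fin q → Fin (k + 1) → Fin n =>
      Blocking q B D z (critical (sampled ω) a b B f) ∧
        ∀ j, ¬ Hits D z (critical (sampled ω) a b B f) (ω b j)).card * (2 ^ k + 1) ^ u
      ≤ (2 ^ k) ^ u * Fintype.card (Fin T → Fin u → Fin q → Fin (k + 1) → Fin n) := by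
  set N := Fintype.card (Fin q → Fin (k + 1) → Fin n) with hN
  have hNpos : 0 < N := Fintype.card_pos
  let Bad : (Fin T → Fin u → Fin q → Fin (k + 1) → Fin n) →
      Finset (Fin u → Fin q → Fin (k + 1) → Fin n) := fun ω =>
    univ.filter fun y => Blocking q B D z (critical (sampled ω) a b B f) ∧
        ∀ j, ¬ Hits D z (critical (sampled ω) a b B f) (y j)
  have hcrit : ∀ (ω : Fin T → Fin u → Fin q → Fin (k + 1) → Fin n) y,
      critical (sampled (Function.update ω b y)) a b B f
      = critical (sampled ω) a b B f := by
    intro ω y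
    have h1 : ∀ t ≤ (b : ℕ), sampled (Function.update ω b y) t = sampled ω t := by
      intro t ht
      refine sampled_congr fun s hs => ?_
      rw [Function.update_of_ne]
      rintro rfl
      omega
    unfold critical
    rw [h1 a hab, h1 b le_rfl]
  have key := card_mul_card_filter_mem (fun ω : Fin T → Fin u → Fin q → Fin (k + 1) → Fin n => ω b)
    (fun ω y => Function.update ω b y) (by intro ω y; simp) (by intro ω y y'; simp)
    (by intro ω; simp) Bad (by intro ω y; simp only [Bad, hcrit])
  have hcard : Fintype.card (Fin u → Fin q → Fin (k + 1) → Fin n) = N ^ u := by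
    rw [Fintype.card_fun, Fintype.card_fin]
  have hBad : ∀ ω, (Bad ω).card * (2 ^ k + 1) ^ u ≤ (2 ^ k) ^ u * N ^ u := by
    intro ω
    by_cases hb : Blocking q B D z (critical (sampled ω) a b B f)
    · set S := critical (sampled ω) a b B f with hS
      have h1 := card_le_mul_card_hits hq hD hDB hk z S hb
      set M := univ.filter fun y : Fin q → Fin (k + 1) → Fin n => ¬ Hits D z S y with hM
      have h2 : (univ.filter fun y : Fin q → Fin (k + 1) → Fin n => Hits D z S y).card + M.card
          = N := by
        rw [hM, card_filter_add_card_filter_not, card_univ]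
      have h3 : M.card * (2 ^ k + 1) ≤ 2 ^ k * N := by
        rw [← hN] at h1
        have h4 := congrArg (fun x => (2 ^ k + 1) * x) h2
        simp only [mul_add] at h4
        linarith
      have h4 : (Bad ω).card ≤ M.card ^ u := by
        have : Bad ω ⊆ Fintype.piFinset fun _ => M := by
          intro y hy
          rw [Fintype.mem_piFinset]
          intro j
          exact mem_filter.2 ⟨mem_univ _, (mem_filter.1 hy).2.2 j⟩
        refine (card_le_card this).trans (le_of_eq ?_)
        rw [Fintype.card_piFinset, prod_const, card_univ, Fintype.card_fin]
      calc _ ≤ M.card ^ u * (2 ^ k + 1) ^ u := Nat.mul_le_mul_right _ h4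
        _ = (M.card * (2 ^ k + 1)) ^ u := (mul_pow _ _ _).symm
        _ ≤ (2 ^ k * N) ^ u := Nat.pow_le_pow_left h3 u
        _ = _ := mul_pow _ _ _
    · have : Bad ω = ∅ := filter_eq_empty_iff.2 fun y _ hy => hb hy.1
      simp [this]
  rw [hcard] at key
  have hfil : (univ.filter fun ω => ω b ∈ Bad ω) = univ.filter
      fun ω : Fin T → Fin u → Fin q → Fin (k + 1) → Fin n =>
      Blocking q B D z (critical (sampled ω) a b B f) ∧
        ∀ j, ¬ Hits D z (critical (sampled ω) a b B f) (ω b j) := by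
    ext ω
    simp [Bad]
  rw [hfil] at key
  refine Nat.le_of_mul_le_mul_left ?_ (pow_pos hNpos u)
  rw [← mul_assoc, key, sum_mul]
  refine (sum_le_card_nsmul _ _ _ fun ω _ => hBad ω).trans (le_of_eq ?_)
  rw [card_univ, smul_eq_mul]
  ring

lemma slice_eq_empty_of_hits {k n T u q : ℕ} {B D : Finset ℤ} (hD : D.Nonempty) (hDB : D ⊆ B)
    {z : Fin (k + 1) → Fin n} {f : Set (Fin k × Fin n × Fin n) → Prop} (hf : Monotone f)
    {a : ℕ} {b : Fin T} (hab : a ≤ b) {ω : Fin T → Fin u → Fin q → Fin (k + 1) → Fin n} {j : Fin u}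
    (hap : Apart D (B \ D))
    (h : Hits D z (critical (sampled ω) a b B f) (ω b j)) :
    ((critical (sampled ω) a (b + 1) B f).filter fun x => ∀ v ∉ verts k D, x v = z v) = ∅ := by
  refine filter_eq_empty_iff.2 fun x hx hxz => ?_
  obtain ⟨y, hy, hyz, hhit⟩ := h
  obtain ⟨e, he⟩ := hD
  rw [mem_critical] at hx hy
  refine hx.2 e (hDB he) (hf ?_ hy.1)
  have h1 : edges y (B \ D) = edges x (B \ D) := by
    refine edges_congr fun v hv => ?_
    have hv' := disjoint_right.1 (verts_disjoint hap) hv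
    rw [hyz v hv', hxz v hv']
  rintro p (hp | hp)
  · exact Or.inl (sampled_mono ω (by omega) hp)
  · by_cases hpD : ((p.1 : ℕ) : ℤ) ∈ D
    · left
      obtain ⟨r, hr1, hr2⟩ := hhit p.1 hpD
      exact ⟨b, by omega, j, r, by rw [hp.2.1, hr1], by rw [hp.2.2, hr2]⟩
    · right
      have hp' : p ∈ edges y (B \ D) := ⟨mem_sdiff.2 ⟨hp.1, hpD⟩, hp.2⟩
      rw [h1] at hp'
      refine edges_mono x ?_ hp'
      intro e' he'
      rw [mem_sdiff] at he'
      refine mem_erase.2 ⟨?_, he'.1⟩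
      rintro rfl
      exact he'.2 he

lemma nc_le_of_subset_Icc {k : ℕ} {D : Finset ℤ} (h : D ⊆ Icc (0 : ℤ) (k - 1)) : nc D ≤ k := by
  refine (card_le_card ((filter_subset _ _).trans h)).trans (le_of_eq ?_)
  simp

/-- If every slice which is too large is hit, then all critical sets are small after `k + 1`
steps. -/
lemma small_critical_of_hits {k n T u q : ℕ} {B : Finset ℤ} (hB : B ⊆ Icc (0 : ℤ) (k - 1))
    {f : Set (Fin k × Fin n × Fin n) → Prop} (hf : Monotone f)
    {ω : Fin T → Fin u → Fin q → Fin (k + 1) → Fin n} {a : ℕ}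
    (h : ∀ b : Fin T, a ≤ b → ∀ D ⊆ B, D.Nonempty → Apart D (B \ D) →
      ∀ z : Fin (k + 1) → Fin n, Blocking q B D z (critical (sampled ω) a b B f) →
        ∃ j, Hits D z (critical (sampled ω) a b B f) (ω b j))
    {b : ℕ} (hab : a + (k + 1) ≤ b) (hb : b ≤ T) :
    Small q B (critical (sampled ω) a b B f) := by
  refine ⟨determinedBy_critical _ _ _ _ _, ?_⟩
  suffices H : ∀ m, ∀ D ⊆ B, nc D = m → Apart D (B \ D) → ∀ b, a + m ≤ b → b ≤ T →
      ∀ z : Fin (k + 1) → Fin n,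
      ((critical (sampled ω) a b B f).filter fun x => ∀ v ∉ verts k D, x v = z v).card * q ^ nc D
        ≤ n ^ (verts k D).card by
    intro D hD hap z
    refine H _ D hD rfl hap b ?_ hb z
    have := nc_le_of_subset_Icc (hD.trans hB)
    omega
  intro m
  induction m using Nat.strong_induction_on with
  | _ m ih =>
    intro D hD hm hap b hab hb z
    rcases D.eq_empty_or_nonempty with rfl | hne
    · have h0 : verts k ∅ = ∅ := by simp [verts]
      have h1 : nc ∅ = 0 := by simp [nc, runEnds]
      rw [h0, h1]
      simp only [notMem_empty, not_false_eq_true, forall_const, pow_zero, mul_one, card_empty]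
      refine card_le_one.2 fun x hx y hy => ?_
      funext v
      rw [(mem_filter.1 hx).2, (mem_filter.1 hy).2]
    · have hpos := nc_pos hne
      obtain ⟨b, rfl⟩ : ∃ b', b = b' + 1 := ⟨b - 1, by omega⟩
      by_contra! hcon
      have hlt := hcon.trans_le (Nat.mul_le_mul_right _ (card_le_card (filter_subset_filter _
        (critical_anti (sampled_mono ω) (Nat.le_succ b) B hf (a := a)))))
      obtain ⟨j, hj⟩ := h ⟨b, by omega⟩ (by simp only; omega) D hD hne hap z
        ⟨fun D' hD' hlt hap' z' => ih (nc D') (by omega) D' (hD'.trans hD) rfl hap' b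
          (by omega) (by omega) z', hlt⟩
      have := slice_eq_empty_of_hits hne hD hf (b := ⟨b, by omega⟩) (by simp only; omega) hap hj
      simp only at this
      rw [this] at hcon
      simp at hcon

open Classical in
lemma card_filter_eq_mul {k n T u q : ℕ} [NeZero n] (p : Fin T × Fin u × Fin q) (v : Fin (k + 1))
    (X : (Fin T → Fin u → Fin q → Fin (k + 1) → Fin n) → Fin n)
    (hX : ∀ ω ω', (∀ p', p' ≠ p → ω p'.1 p'.2.1 p'.2.2 v = ω' p'.1 p'.2.1 p'.2.2 v) → X ω = X ω') :
    (univ.filter fun ω => ω p.1 p.2.1 p.2.2 v = X ω).card * n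
      = Fintype.card (Fin T → Fin u → Fin q → Fin (k + 1) → Fin n) := by
  let put : (Fin T → Fin u → Fin q → Fin (k + 1) → Fin n) → Fin n →
      Fin T → Fin u → Fin q → Fin (k + 1) → Fin n := fun ω y s r i w =>
    if (s, r, i) = p ∧ w = v then y else ω s r i w
  have key := card_mul_card_filter_mem
    (fun ω : Fin T → Fin u → Fin q → Fin (k + 1) → Fin n => ω p.1 p.2.1 p.2.2 v) put
    (by intro ω y; simp [put])
    (by
      intro ω y y'
      funext s r i w
      by_cases h : (s, r, i) = p ∧ w = v <;> simp [put, h])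
    (by
      intro ω
      funext s r i w
      by_cases h : (s, r, i) = p ∧ w = v
      · obtain ⟨rfl, rfl⟩ := h
        simp [put]
      · simp [put, h])
    (fun ω => {X ω})
    (by
      intro ω y
      rw [hX (put ω y) ω]
      intro p' hp'
      simp [put, hp'])
  simp only [mem_singleton, card_singleton, sum_const, card_univ, smul_eq_mul, mul_one,
    Fintype.card_fin] at key
  rw [← key, mul_comm]

open Classical in
/-- There are samples such that all critical sets of the given functions are small, and the
sampled paths are disjoint and avoid the vertex `0`. -/
lemma exists_good_samples {k n T u q : ℕ} [NeZero n] (hq : 0 < q)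
    (l : List (Set (Fin k × Fin n × Fin n) → Prop))
    (h1 : 2 * (l.length * T * T * 2 ^ k * 2 ^ k * n ^ (k + 1)) * (2 ^ k) ^ u < (2 ^ k + 1) ^ u)
    (h2 : 2 * ((k + 1) * ((T * u * q) * (T * u * q) + T * u * q)) ≤ n) :
    ∃ ω : Fin T → Fin u → Fin q → Fin (k + 1) → Fin n,
      (∀ f ∈ l, Monotone f → ∀ a b B, B ⊆ Icc (0 : ℤ) (k - 1) → a + (k + 1) ≤ b → b ≤ T →
        Small q B (critical (sampled ω) a b B f)) ∧
      (∀ v, ∀ p p' : Fin T × Fin u × Fin q,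
        ω p.1 p.2.1 p.2.2 v = ω p'.1 p'.2.1 p'.2.2 v → p = p') ∧
      ∀ v, ∀ p : Fin T × Fin u × Fin q, ω p.1 p.2.1 p.2.2 v ≠ 0 := by
  set N := Fintype.card (Fin T → Fin u → Fin q → Fin (k + 1) → Fin n) with hN
  have hNpos : 0 < N := Fintype.card_pos
  let P := Fin T × Fin u × Fin q
  have hPcard : Fintype.card P = T * u * q := by simp [P, mul_assoc]
  let I := l.toFinset ×ˢ (univ : Finset (Fin T)) ×ˢ (univ : Finset (Fin T)) ×ˢ
    (Icc (0 : ℤ) (k - 1)).powerset ×ˢ (Icc (0 : ℤ) (k - 1)).powerset ×ˢ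
    (univ : Finset (Fin (k + 1) → Fin n))
  let E : (Set (Fin k × Fin n × Fin n) → Prop) × Fin T × Fin T × Finset ℤ × Finset ℤ ×
      (Fin (k + 1) → Fin n) → Finset (Fin T → Fin u → Fin q → Fin (k + 1) → Fin n) :=
    fun j => univ.filter fun ω => ((j.2.1 : ℕ) ≤ j.2.2.1 ∧ j.2.2.2.2.1.Nonempty ∧
      Apart j.2.2.2.2.1 (j.2.2.2.1 \ j.2.2.2.2.1)) ∧
      (Blocking q j.2.2.2.1 j.2.2.2.2.1 j.2.2.2.2.2
        (critical (sampled ω) j.2.1 j.2.2.1 j.2.2.2.1 j.1) ∧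
      ∀ r, ¬ Hits j.2.2.2.2.1 j.2.2.2.2.2 (critical (sampled ω) j.2.1 j.2.2.1 j.2.2.2.1 j.1)
        (ω j.2.2.1 r))
  have hI : I.card ≤ l.length * T * T * 2 ^ k * 2 ^ k * n ^ (k + 1) := by
    have h0 := List.toFinset_card_le l
    have h3 : I.card = l.toFinset.card * T * T * 2 ^ k * 2 ^ k * n ^ (k + 1) := by
      simp [I, card_product, mul_assoc]
    rw [h3]
    gcongr
  have hE : ∀ j ∈ I, (E j).card * (2 ^ k + 1) ^ u ≤ (2 ^ k) ^ u * N := by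
    rintro ⟨f, a, b, B, D, z⟩ hj
    simp only [I, mem_product, mem_powerset, mem_univ, true_and] at hj
    by_cases hc : (a : ℕ) ≤ b ∧ D.Nonempty ∧ Apart D (B \ D)
    · refine le_trans (Nat.mul_le_mul_right _ (card_le_card ?_))
        (card_not_hits_mul_le hq hc.2.1 hc.2.2 (nc_le_of_subset_Icc hj.2.2.1) z f a b hc.1)
      intro ω hω
      exact mem_filter.2 ⟨mem_univ _, (mem_filter.1 hω).2.2⟩
    · have : E (f, a, b, B, D, z) = ∅ := filter_eq_empty_iff.2 fun y _ hy => hc hy.1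
      simp [this]
  let C₁ : Fin (k + 1) × P × P → Finset (Fin T → Fin u → Fin q → Fin (k + 1) → Fin n) :=
    fun j => univ.filter fun ω => j.2.1 ≠ j.2.2 ∧
      ω j.2.1.1 j.2.1.2.1 j.2.1.2.2 j.1 = ω j.2.2.1 j.2.2.2.1 j.2.2.2.2 j.1
  let C₂ : Fin (k + 1) × P → Finset (Fin T → Fin u → Fin q → Fin (k + 1) → Fin n) :=
    fun j => univ.filter fun ω => ω j.2.1 j.2.2.1 j.2.2.2 j.1 = 0
  have hC₁ : ∀ j, (C₁ j).card * n ≤ N := by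
    rintro ⟨v, p, p'⟩
    by_cases hpp : p = p'
    · have : C₁ (v, p, p') = ∅ := filter_eq_empty_iff.2 fun y _ hy => hy.1 hpp
      simp [this]
    · rw [hN, ← card_filter_eq_mul p v (fun ω => ω p'.1 p'.2.1 p'.2.2 v)
        fun ω ω' h => h p' (Ne.symm hpp)]
      exact Nat.mul_le_mul_right _ (card_le_card fun ω hω =>
        mem_filter.2 ⟨mem_univ _, (mem_filter.1 hω).2.2⟩)
  have hC₂ : ∀ j, (C₂ j).card * n ≤ N := by
    rintro ⟨v, p⟩
    rw [hN, ← card_filter_eq_mul p v (fun _ => 0) fun ω ω' h => rfl]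
  have b1 : 2 * (I.biUnion E).card < N := by
    have h3 : (I.biUnion E).card * (2 ^ k + 1) ^ u ≤ I.card * ((2 ^ k) ^ u * N) := by
      refine (Nat.mul_le_mul_right _ card_biUnion_le).trans ?_
      rw [sum_mul]
      exact sum_le_card_nsmul _ _ _ hE
    refine lt_of_mul_lt_mul_right (a := (2 ^ k + 1) ^ u) ?_ (Nat.zero_le _)
    calc _ = 2 * ((I.biUnion E).card * (2 ^ k + 1) ^ u) := by ring
      _ ≤ 2 * (I.card * ((2 ^ k) ^ u * N)) := Nat.mul_le_mul_left _ h3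
      _ ≤ 2 * ((l.length * T * T * 2 ^ k * 2 ^ k * n ^ (k + 1)) * ((2 ^ k) ^ u * N)) :=
        Nat.mul_le_mul_left _ (Nat.mul_le_mul_right _ hI)
      _ = N * (2 * (l.length * T * T * 2 ^ k * 2 ^ k * n ^ (k + 1)) * (2 ^ k) ^ u) := by ring
      _ < N * (2 ^ k + 1) ^ u := Nat.mul_lt_mul_of_pos_left h1 hNpos
  have b2 : 2 * ((univ.biUnion C₁).card + (univ.biUnion C₂).card) ≤ N := by
    have h3 : (univ.biUnion C₁).card * n ≤ (k + 1) * ((T * u * q) * (T * u * q)) * N := by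
      refine (Nat.mul_le_mul_right _ card_biUnion_le).trans ?_
      rw [sum_mul]
      refine (sum_le_card_nsmul _ _ _ fun j _ => hC₁ j).trans (le_of_eq ?_)
      rw [card_univ, smul_eq_mul, Fintype.card_prod, Fintype.card_prod, hPcard, Fintype.card_fin]
    have h4 : (univ.biUnion C₂).card * n ≤ (k + 1) * (T * u * q) * N := by
      refine (Nat.mul_le_mul_right _ card_biUnion_le).trans ?_
      rw [sum_mul]
      refine (sum_le_card_nsmul _ _ _ fun j _ => hC₂ j).trans (le_of_eq ?_)
      rw [card_univ, smul_eq_mul, Fintype.card_prod, hPcard, Fintype.card_fin]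
    refine Nat.le_of_mul_le_mul_right ?_ (Nat.pos_of_neZero n)
    calc _ = 2 * ((univ.biUnion C₁).card * n + (univ.biUnion C₂).card * n) := by ring
      _ ≤ 2 * ((k + 1) * ((T * u * q) * (T * u * q)) * N + (k + 1) * (T * u * q) * N) := by
        gcongr
      _ = N * (2 * ((k + 1) * ((T * u * q) * (T * u * q) + T * u * q))) := by ring
      _ ≤ N * n := Nat.mul_le_mul_left _ h2
  obtain ⟨ω, hω⟩ : ∃ ω, ω ∉ I.biUnion E ∪ (univ.biUnion C₁ ∪ univ.biUnion C₂) := by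
    by_contra! hcon
    have h3 := card_le_card (fun ω _ => hcon ω :
      univ ⊆ I.biUnion E ∪ (univ.biUnion C₁ ∪ univ.biUnion C₂))
    rw [card_univ, ← hN] at h3
    have h4 := card_union_le (I.biUnion E) (univ.biUnion C₁ ∪ univ.biUnion C₂)
    have h5 := card_union_le (univ.biUnion C₁) (univ.biUnion C₂)
    omega
  simp only [mem_union, mem_biUnion, not_or, not_exists, not_and, mem_univ, true_and] at hω
  obtain ⟨hω1, hω2, hω3⟩ := hω
  refine ⟨ω, ?_, ?_, ?_⟩
  · intro f hf hmono a b B hB hab hb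
    refine small_critical_of_hits hB hmono (fun b' hab' D hD hne hap z hbl => ?_) hab hb
    by_contra! hcon
    refine hω1 (f, ⟨a, by omega⟩, b', B, D, z) ?_ (mem_filter.2 ⟨mem_univ _,
      ⟨hab', hne, hap⟩, hbl, hcon⟩)
    simp only [I, mem_product, mem_powerset, mem_univ, true_and, List.mem_toFinset]
    exact ⟨hf, hB, hD.trans hB, trivial⟩
  · intro v p p' h
    by_contra hpp
    exact hω2 (v, p, p') (mem_filter.2 ⟨mem_univ _, hpp, h⟩)
  · intro v p h
    exact hω3 (v, p) (mem_filter.2 ⟨mem_univ _, h⟩)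

open Classical in
lemma sem_iff_of_computes {n k : ℕ} {F : AC0 (Fin k × Fin n × Fin n)} (hF : ComputesSubPMM n k F)
    (S : Set (Fin k × Fin n × Fin n))
    (h1 : ∀ i a b b', (i, a, b) ∈ S → (i, a, b') ∈ S → b = b')
    (h2 : ∀ i a a' b, (i, a, b) ∈ S → (i, a', b) ∈ S → a = a') :
    F.sem S ↔ ∃ f : Fin (k + 1) → Fin n, (f 0 : ℕ) = 0 ∧ (f (Fin.last k) : ℕ) = 0 ∧
      ∀ i : Fin k, (i, f i.castSucc, f i.succ) ∈ S := by
  have := hF (fun i a b => decide ((i, a, b) ∈ S)) fun i =>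
    ⟨fun a b b' h h' => h1 i a b b' (by simpa using h) (by simpa using h'),
      fun a a' b h h' => h2 i a a' b (by simpa using h) (by simpa using h')⟩
  simpa [AC0.sem, ProdEntryOneOne] using this

lemma mem_critical_of_computes {n k T u q : ℕ} {F : AC0 (Fin k × Fin n × Fin n)}
    (hF : ComputesSubPMM n k F) (ω : Fin T → Fin u → Fin q → Fin (k + 1) → Fin n)
    (hω : ∀ v, ∀ p p' : Fin T × Fin u × Fin q,
        ω p.1 p.2.1 p.2.2 v = ω p'.1 p'.2.1 p'.2.2 v → p = p')
    (x : Fin (k + 1) → Fin n) (hx0 : (x 0 : ℕ) = 0) (hxk : (x (Fin.last k) : ℕ) = 0)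
    (hx : ∀ v, ∀ p : Fin T × Fin u × Fin q, ω p.1 p.2.1 p.2.2 v ≠ x v) (b : ℕ) :
    x ∈ critical (sampled ω) 0 b (Icc (0 : ℤ) (k - 1)) F.sem := by
  have hrow : ∀ t A, ∀ i a b b', (i, a, b) ∈ sampled ω t ∪ edges x A →
      (i, a, b') ∈ sampled ω t ∪ edges x A → b = b' := by
    rintro t A i a b b' (⟨s, -, r, j, h1, h2⟩ | ⟨-, h1, h2⟩) (⟨s', -, r', j', h3, h4⟩ | ⟨-, h3, h4⟩)
    · have := hω i.castSucc (s, r, j) (s', r', j') (h1.symm.trans h3)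
      simp only [Prod.mk.injEq] at this
      obtain ⟨rfl, rfl, rfl⟩ := this
      exact h2.trans h4.symm
    · exact absurd (h1.symm.trans h3) (hx i.castSucc (s, r, j))
    · exact absurd (h3.symm.trans h1) (hx i.castSucc (s', r', j'))
    · exact h2.trans h4.symm
  have hcol : ∀ t A, ∀ i a a' b, (i, a, b) ∈ sampled ω t ∪ edges x A →
      (i, a', b) ∈ sampled ω t ∪ edges x A → a = a' := by
    rintro t A i a a' b (⟨s, -, r, j, h1, h2⟩ | ⟨-, h1, h2⟩) (⟨s', -, r', j', h3, h4⟩ | ⟨-, h3, h4⟩)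
    · have := hω i.succ (s, r, j) (s', r', j') (h2.symm.trans h4)
      simp only [Prod.mk.injEq] at this
      obtain ⟨rfl, rfl, rfl⟩ := this
      exact h1.trans h3.symm
    · exact absurd (h2.symm.trans h4) (hx i.succ (s, r, j))
    · exact absurd (h4.symm.trans h2) (hx i.succ (s', r', j'))
    · exact h1.trans h3.symm
  rw [mem_critical]
  constructor
  · rw [sem_iff_of_computes hF _ (hrow _ _) (hcol _ _)]
    refine ⟨x, hx0, hxk, fun i => Or.inr ⟨?_, rfl, rfl⟩⟩
    simp only [mem_Icc]
    omega
  · intro e he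
    rw [sem_iff_of_computes hF _ (hrow _ _) (hcol _ _)]
    rintro ⟨f, hf0, hfk, hf⟩
    have step : ∀ i : Fin k, f i.castSucc = x i.castSucc →
        (i, f i.castSucc, f i.succ) ∈ edges x ((Icc (0 : ℤ) (k - 1)).erase e) := by
      intro i hi
      rcases hf i with ⟨s, -, r, j, h1, h2⟩ | h
      · exact absurd (h1.symm.trans hi) (hx i.castSucc (s, r, j))
      · exact h
    have hall : ∀ v, f v = x v := by
      intro v
      induction v using Fin.induction with
      | zero => exact Fin.ext (hf0.trans hx0.symm)
      | succ i ih => exact (step i ih).2.2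
    rw [mem_Icc] at he
    have := (step ⟨e.toNat, by omega⟩ (hall _)).1
    simp only [mem_erase] at this
    omega

open Classical in
/-- Most paths avoid a small set of forbidden vertices. -/
lemma pow_le_mul_card_avoiding {n k T u q : ℕ} [NeZero n]
    (hQ : 2 * (T * u * q) ≤ n) (ω : Fin T → Fin u → Fin q → Fin (k + 1) → Fin n) :
    n ^ (k + 1) ≤ 2 ^ (k + 1) * n ^ 2 * (univ.filter fun x : Fin (k + 1) → Fin n =>
      x 0 = 0 ∧ x (Fin.last k) = 0 ∧ ∀ v, v ≠ 0 → v ≠ Fin.last k →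
        ∀ p : Fin T × Fin u × Fin q, ω p.1 p.2.1 p.2.2 v ≠ x v).card := by
  let c : Fin (k + 1) → Finset (Fin n) := fun v => if v = 0 ∨ v = Fin.last k then {0} else
    univ \ univ.image fun p : Fin T × Fin u × Fin q => ω p.1 p.2.1 p.2.2 v
  let m : Fin (k + 1) → ℕ := fun v => if v = 0 ∨ v = Fin.last k then n else 1
  have hcm : ∀ v, n ≤ 2 * m v * (c v).card := by
    intro v
    by_cases hv : v = 0 ∨ v = Fin.last k
    · simp only [m, c, hv, if_true, card_singleton]
      omega
    · simp only [m, c, hv, if_false]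
      have h1 := card_image_le (s := (univ : Finset (Fin T × Fin u × Fin q)))
        (f := fun p => ω p.1 p.2.1 p.2.2 v)
      rw [card_univ] at h1
      simp only [Fintype.card_prod, Fintype.card_fin] at h1
      have h2 := le_card_sdiff (univ.image fun p : Fin T × Fin u × Fin q => ω p.1 p.2.1 p.2.2 v)
        (univ : Finset (Fin n))
      rw [card_univ, Fintype.card_fin] at h2
      rw [← mul_assoc] at h1
      omega
  have hm : ∏ v, m v ≤ n ^ 2 := by
    simp only [m]
    rw [prod_ite, prod_const_one, mul_one, prod_const]
    refine Nat.pow_le_pow_right (Nat.pos_of_neZero n) ?_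
    refine (card_le_card (t := {0, Fin.last k}) ?_).trans card_le_two
    intro v
    simp
  calc n ^ (k + 1) = ∏ _v : Fin (k + 1), n := by simp
    _ ≤ ∏ v, 2 * m v * (c v).card := prod_le_prod' fun v _ => hcm v
    _ = 2 ^ (k + 1) * (∏ v, m v) * (Fintype.piFinset c).card := by
      rw [prod_mul_distrib, prod_mul_distrib, Fintype.card_piFinset]
      simp
    _ ≤ _ := by
      refine Nat.mul_le_mul (Nat.mul_le_mul_left _ hm) (card_le_card ?_)
      intro x hx
      rw [Fintype.mem_piFinset] at hx
      rw [mem_filter]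
      refine ⟨mem_univ _, ?_, ?_, fun v h0 hl p hp => ?_⟩
      · simpa [c] using hx 0
      · simpa [c] using hx (Fin.last k)
      · have := hx v
        simp only [c, h0, hl, or_self, if_false, mem_sdiff, mem_univ, true_and, mem_image,
          not_exists] at this
        exact this p hp

/-- The lower bound obtained from a strategy in the game. -/
theorem rpow_le_mul_size {n k d u : ℕ} (F : AC0 (Fin k × Fin n × Fin n)) (hk : 0 < k)
    (hmono : F.Mono) (hdepth : F.andDepth ≤ d) (hfan : F.AndFanInLE (u : ℝ))
    (hF : ComputesSubPMM n k F) (hu : 1 ≤ u) (hun : u ≤ n)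
    (h1 : 2 * (2 * F.size * span k d * span k d * 2 ^ k * 2 ^ k * n ^ (k + 1)) * (2 ^ k) ^ u
      < (2 ^ k + 1) ^ u)
    (h2 : 2 * ((k + 1) * ((span k d * u * u ^ 6) * (span k d * u * u ^ 6) + span k d * u * u ^ 6))
      ≤ n) {v : ℝ} (hv : Win d (Icc (0 : ℤ) (k - 1)) [] v) :
    (u : ℝ) ^ v ≤ F.size * ((k ^ 2 + 1) * 2 ^ (k ^ 2)) ^ d * 2 ^ (k + 1) * (n : ℝ) ^ 2 := by
  classical
  have : NeZero n := ⟨by omega⟩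
  obtain ⟨l, hl, hlen⟩ := AC0.exists_list_nonconst F
  have hlen' : l.length ≤ 2 * F.size := by
    rcases hlen with h | rfl
    · omega
    · simp
  obtain ⟨ω, hω1, hω2, hω3⟩ := exists_good_samples (T := span k d) (u := u) (q := u ^ 6)
    (by positivity) l (lt_of_le_of_lt (by gcongr) h1) h2
  have hsmall : ∀ f ∈ F.funs, ∀ a b B, B ⊆ Icc (0 : ℤ) (k - 1) → B.Nonempty → a + (k + 1) ≤ b →
      b ≤ span k d → Small (u ^ 6) B (critical (sampled ω) a b B f) := by
    intro f hf a b B hB hBne hab hb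
    by_cases hc : AC0.IsConst f
    · have : critical (sampled ω) a b B f = ∅ := by
        refine filter_eq_empty_iff.2 fun x _ hx => ?_
        obtain ⟨e, he⟩ := hBne
        exact hx.2 e he ((hc _ _).1 hx.1)
      rw [this]
      exact ⟨fun x y _ hx => absurd hx (notMem_empty x), fun D _ _ z => by simp⟩
    · exact hω1 f (hl f hf hc) (hmono.monotone_of_mem_funs f hf) a b B hB hab hb
  have key := card_critical_le hu hun (sampled_mono ω) F hmono hfan hsmall d 0 (span k d)
    (Icc (0 : ℤ) (k - 1)) [] [] v hdepth (by omega) le_rfl Subset.rfl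
    ⟨0, by rw [mem_Icc]; omega⟩ List.Forall₂.nil hv
  simp only [List.not_mem_nil, IsEmpty.forall_iff, implies_true, filter_true] at key
  have hQ : 2 * (span k d * u * u ^ 6) ≤ n := by
    refine le_trans (Nat.mul_le_mul_left _ ?_) h2
    nlinarith [Nat.zero_le (span k d * u * u ^ 6)]
  have hcount := (pow_le_mul_card_avoiding hQ ω).trans (Nat.mul_le_mul_left _ (card_le_card
    (t := critical (sampled ω) 0 (span k d) (Icc (0 : ℤ) (k - 1)) F.sem) ?_))
  · set C := (critical (sampled ω) 0 (span k d) (Icc (0 : ℤ) (k - 1)) F.sem).card with hC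
    have hcount' : (n : ℝ) ^ (k + 1) ≤ 2 ^ (k + 1) * (n : ℝ) ^ 2 * C := by exact_mod_cast hcount
    have hn0 : 0 < n := Nat.pos_of_neZero n
    have hCpos : 0 < (C : ℝ) := by
      rcases Nat.eq_zero_or_pos C with h0 | h0
      · rw [h0] at hcount
        have : 0 < n ^ (k + 1) := by positivity
        omega
      · exact_mod_cast h0
    refine le_of_mul_le_mul_left (key.trans ?_) hCpos
    calc _ ≤ F.size * (((k : ℝ) ^ 2 + 1) * 2 ^ (k ^ 2)) ^ d * (2 ^ (k + 1) * (n : ℝ) ^ 2 * C) :=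
          mul_le_mul_of_nonneg_left hcount' (by positivity)
      _ = _ := by ring
  · intro x hx
    obtain ⟨-, hx0, hxk, hxv⟩ := mem_filter.1 hx
    refine mem_critical_of_computes hF ω hω2 x (by simp [hx0]) (by simp [hxk]) ?_ _
    intro v p
    by_cases h0 : v = 0
    · rw [h0, hx0]
      exact hω3 0 p
    · by_cases hl : v = Fin.last k
      · rw [hl, hxk]
        exact hω3 _ p
      · exact hxv v h0 hl p

end SubPMM

namespace AC0

variable {ι : Type}

/-- A formula only depends on as many variables as its size. -/
lemma exists_list_depends (F : AC0 ι) : ∃ l : List ι, l.length ≤ size F ∧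
    ∀ S S' : Set ι, (∀ i ∈ l, i ∈ S ↔ i ∈ S') → (sem F S ↔ sem F S') := by
  have key : ∀ Fs : List (AC0 ι), (∀ F ∈ Fs, ∃ l : List ι, l.length ≤ size F ∧
      ∀ S S' : Set ι, (∀ i ∈ l, i ∈ S ↔ i ∈ S') → (sem F S ↔ sem F S')) →
      ∃ l : List ι, l.length ≤ sizeList Fs ∧ ∀ F ∈ Fs, ∀ S S' : Set ι,
        (∀ i ∈ l, i ∈ S ↔ i ∈ S') → (sem F S ↔ sem F S') := by
    intro Fs
    induction Fs with
    | nil => intro _; exact ⟨[], by simp⟩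
    | cons F Fs ih =>
      intro h
      obtain ⟨l₁, h₁, hl₁⟩ := h F (by simp)
      obtain ⟨l₂, h₂, hl₂⟩ := ih fun G hG => h G (by simp [hG])
      refine ⟨l₁ ++ l₂, by simp only [sizeList, List.length_append]; omega, ?_⟩
      intro G hG S S' hS
      rcases List.mem_cons.1 hG with rfl | hG
      · exact hl₁ S S' fun i hi => hS i (List.mem_append_left _ hi)
      · exact hl₂ G hG S S' fun i hi => hS i (List.mem_append_right _ hi)
  induction F using induction_list with
  | hconst b => exact ⟨[], by simp, fun S S' _ => by simp [sem_const]⟩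
  | hlit i b => exact ⟨[i], by simp [size], fun S S' h => by
      have := h i (by simp)
      by_cases hb : b = true <;> simp [sem, eval, hb, this]⟩
  | hand Fs ih =>
    obtain ⟨l, hl, h⟩ := key Fs ih
    refine ⟨l, hl, fun S S' hS => ?_⟩
    rw [sem_and, sem_and]
    exact forall₂_congr fun F hF => h F hF S S' hS
  | hor Fs ih =>
    obtain ⟨l, hl, h⟩ := key Fs ih
    refine ⟨l, hl, fun S S' hS => ?_⟩
    rw [sem_or, sem_or]
    exact exists_congr fun F => and_congr_right fun hF => h F hF S S' hS

lemma AndFanInLE.mono {w w' : ℝ} (hw : w ≤ w') {F : AC0 ι} :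
    AndFanInLE w F → AndFanInLE w' F := by
  induction F using induction_list with
  | hconst b => simp [AndFanInLE]
  | hlit i b => simp [AndFanInLE]
  | hand Fs ih =>
    intro h
    simp only [AndFanInLE, andFanInLEList_iff] at h ⊢
    exact ⟨h.1.trans hw, fun F hF => ih F hF (h.2 F hF)⟩
  | hor Fs ih =>
    intro h
    simp only [AndFanInLE, andFanInLEList_iff] at h ⊢
    exact fun F hF => ih F hF (h F hF)

end AC0

namespace SubPMM

open Finset

/-- A formula computing the function has at least `n` leaves. -/
lemma le_size {n k : ℕ} (hk : 2 ≤ k) {F : AC0 (Fin k × Fin n × Fin n)}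
    (hF : ComputesSubPMM n k F) : n ≤ F.size := by
  classical
  rcases Nat.eq_zero_or_pos n with rfl | hn
  · exact Nat.zero_le _
  have : NeZero n := ⟨by omega⟩
  have : NeZero k := ⟨by omega⟩
  obtain ⟨l, hl, hdep⟩ := F.exists_list_depends
  have hmem : ∀ a : Fin n, ((0 : Fin k), (0 : Fin n), a) ∈ l := by
    intro a
    by_contra hcon
    let x : Fin (k + 1) → Fin n := fun v => if (v : ℕ) = 1 then a else 0
    have hx := mem_critical_of_computes (T := 0) (u := 0) (q := 0) hF (fun s => s.elim0)
      (fun v p => p.1.elim0) x (by simp [x]) (by simp [x]; omega) (fun v p => p.1.elim0) 0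
    rw [mem_critical] at hx
    refine hx.2 0 (by rw [mem_Icc]; omega) ((hdep _ _ fun p hp => ?_).1 hx.1)
    refine or_congr_right (and_congr_left fun hpx => ?_)
    rw [mem_erase]
    refine ⟨fun h => ⟨fun h0 => hcon ?_, h⟩, fun h => h.2⟩
    have hp0 : p.1 = 0 := Fin.ext (by simpa using h0)
    have : p = (0, 0, a) := by
      refine Prod.ext hp0 (Prod.ext ?_ ?_)
      · rw [hpx.1, hp0]
        simp [x]
      · rw [hpx.2, hp0]
        simp only [x, Fin.val_succ, Fin.coe_ofNat_eq_mod, Nat.zero_mod, zero_add, if_true]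
    rwa [this] at hp
  calc n = (univ.image fun a : Fin n => ((0 : Fin k), (0 : Fin n), a)).card := by
        rw [card_image_of_injective _ fun a b h => (Prod.ext_iff.1 (Prod.ext_iff.1 h).2).2]
        simp
    _ ≤ l.toFinset.card := card_le_card fun p hp => by
        obtain ⟨a, -, rfl⟩ := mem_image.1 hp
        exact List.mem_toFinset.2 (hmem a)
    _ ≤ l.length := List.toFinset_card_le l
    _ ≤ F.size := hl

/-- The value of the game on the whole line. -/
lemma win_line {k d : ℕ} (hk : 2 ≤ k) (hd : 1 ≤ d) (hdk : (d : ℝ) ≤ Real.logb 2 k) :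
    Win d (Icc (0 : ℤ) (k - 1)) [] (d * (k : ℝ) ^ (1 / (d : ℝ)) / 768 - 1 / 4) := by
  have hd0 : (1 : ℝ) ≤ d := by exact_mod_cast hd
  have hne : (Icc (0 : ℤ) (k - 1)).Nonempty := ⟨0, by rw [mem_Icc]; omega⟩
  by_cases h : 24 ≤ (k : ℝ) ^ (1 / (d : ℝ))
  · refine win_of_pot k d _ (fun _ => True) [] 0 _ (by simp) (fun _ _ _ => Iff.rfl)
      (by simpa using hne) rfl ?_
    have h1 : (filter (fun _ => True) (Icc (0 : ℤ) (k - 1))).card = k := by simp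
    rw [h1, pot, if_neg (by omega)]
    have h2 := mul_le_mul_of_nonneg_left h (zero_le_one.trans hd0)
    have h3 : ∀ m : ℕ, (d * (k : ℝ) ^ (1 / (d : ℝ)) / 768 - 1 / 4)
        ≤ m + (d * (k : ℝ) ^ (1 / (d : ℝ)) - 12 * d) / 24 + 6 * ((0 : ℕ) : ℝ) := by
      intro m
      have := Nat.cast_nonneg (α := ℝ) m
      push_cast
      linarith
    exact h3 _
  · push Not at h
    refine (winInterval d).1 _ 0 (k - 1) [] 0 _ (by omega) Subset.rfl
      (by rw [mem_Icc]; omega) (by rw [mem_Icc]; omega) rfl ?_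
    have h1 := le_max_right 0 ((Real.logb 2 (k : ℝ) - 4 - d / 2) / 16)
    have h2 : (0 : ℝ) ≤ nc ((Icc (0 : ℤ) (k - 1)).filter fun e => e ∉ Icc (0 : ℤ) (k - 1)) :=
      Nat.cast_nonneg _
    have h3 : ((((k : ℤ) - 1 + 1 - 0 : ℤ)) : ℝ) = k := by push_cast; ring
    rw [h3, logPot]
    push_cast
    nlinarith

lemma mul_pow_four_le_two_pow {k : ℕ} (hk : 40 ≤ k) : 64 * k ^ 4 ≤ 2 ^ k := by
  induction k, hk using Nat.le_induction with
  | base => norm_num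
  | succ k hk ih =>
    have h : (k + 1) ^ 4 ≤ 2 * k ^ 4 := by
      have h1 : (k + 1) ^ 2 * 10 ≤ 11 * k ^ 2 := by nlinarith
      nlinarith [Nat.mul_le_mul h1 h1]
    calc 64 * (k + 1) ^ 4 ≤ 64 * (2 * k ^ 4) := Nat.mul_le_mul_left _ h
      _ = 64 * k ^ 4 * 2 := by ring
      _ ≤ 2 ^ k * 2 := Nat.mul_le_mul_right _ ih
      _ = _ := (pow_succ 2 k).symm

lemma two_mul_pow_le {m : ℕ} (hm : 0 < m) : 2 * m ^ m ≤ (m + 1) ^ m := by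
  have h : ∀ j, m ^ j * (m + j) ≤ (m + 1) ^ j * m := by
    intro j
    induction j with
    | zero => simp
    | succ j ih =>
      calc m ^ (j + 1) * (m + (j + 1)) = m ^ j * (m * (m + j + 1)) := by ring
        _ ≤ m ^ j * ((m + j) * (m + 1)) := Nat.mul_le_mul_left _ (by nlinarith)
        _ = m ^ j * (m + j) * (m + 1) := by ring
        _ ≤ (m + 1) ^ j * m * (m + 1) := Nat.mul_le_mul_right _ ih
        _ = _ := by ring
  refine Nat.le_of_mul_le_mul_right ?_ hm
  calc 2 * m ^ m * m = m ^ m * (m + m) := by ring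
    _ ≤ _ := h m

/-- The choice of the number of samples. -/
lemma exists_sample_size {n k d s : ℕ} (hk : 1000 ≤ k) (hd : d ≤ k) (hn : 2 ^ 2 ^ k ≤ n)
    (hs : s ≤ n ^ k ^ 2) :
    ∃ u : ℕ, 1 ≤ u ∧ u ≤ n ∧ n ≤ u ^ 64 ∧
      2 * (2 * s * span k d * span k d * 2 ^ k * 2 ^ k * n ^ (k + 1)) * (2 ^ k) ^ u
        < (2 ^ k + 1) ^ u ∧
      2 * ((k + 1) * ((span k d * u * u ^ 6) * (span k d * u * u ^ 6) + span k d * u * u ^ 6))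
        ≤ n ∧
      ((k ^ 2 + 1) * 2 ^ k ^ 2) ^ d * 2 ^ (k + 1) ≤ u := by
  have hn0 : n ≠ 0 := by
    have : 0 < 2 ^ 2 ^ k := by positivity
    omega
  obtain ⟨l, hl⟩ : ∃ l, l = Nat.log 2 n / 32 := ⟨_, rfl⟩
  have hlog : 2 ^ k ≤ Nat.log 2 n := Nat.le_log_of_pow_le (by norm_num) hn
  have hk4 := mul_pow_four_le_two_pow (show 40 ≤ k by omega)
  have hlk : 2 * k ^ 4 ≤ l := by omega
  have hu32 : (2 ^ l) ^ 32 ≤ n := by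
    rw [← pow_mul]
    exact (Nat.pow_le_pow_right (by norm_num) (by omega)).trans (Nat.pow_log_le_self 2 hn0)
  have hpos : 0 < 2 ^ l := by positivity
  have hk2 : k ^ 2 ≤ k ^ 4 := Nat.pow_le_pow_right (by omega) (by norm_num)
  have hk3 : 1000 * k ^ 3 ≤ k ^ 4 := by
    rw [pow_succ k 3, mul_comm]
    exact Nat.mul_le_mul_left _ hk
  have hk23 : 1000 * k ^ 2 ≤ k ^ 3 := by
    rw [pow_succ k 2, mul_comm]
    exact Nat.mul_le_mul_left _ hk
  have hk12 : 1000 * k ≤ k ^ 2 := by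
    rw [sq]
    exact Nat.mul_le_mul_right _ hk
  have hu64 : n ≤ (2 ^ l) ^ 64 := by
    rw [← pow_mul]
    exact (Nat.lt_pow_succ_log_self (by norm_num) n).le.trans
      (Nat.pow_le_pow_right (by norm_num) (by omega))
  have hk1 : k + 1 ≤ 2 ^ k := Nat.lt_two_pow_self
  have hksq : k ^ 2 + 1 ≤ 2 ^ k := by omega
  have hT : span k d ≤ 2 ^ l := by
    calc span k d ≤ 2 ^ k * (2 ^ k) ^ k := by
          unfold span
          refine Nat.mul_le_mul hk1 ?_
          exact (Nat.pow_le_pow_left hksq d).trans (Nat.pow_le_pow_right (by positivity) hd)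
      _ = 2 ^ (k + k ^ 2) := by rw [← pow_mul, ← pow_add, sq]
      _ ≤ _ := Nat.pow_le_pow_right (by norm_num) (by omega)
  have hκ : ((k ^ 2 + 1) * 2 ^ k ^ 2) ^ d * 2 ^ (k + 1) ≤ 2 ^ l := by
    calc _ ≤ (2 ^ k * 2 ^ k ^ 2) ^ k * 2 ^ (k + 1) := by
          refine Nat.mul_le_mul_right _ ?_
          exact (Nat.pow_le_pow_left (Nat.mul_le_mul_right _ hksq) d).trans
            (Nat.pow_le_pow_right (by positivity) hd)
      _ = 2 ^ (k ^ 2 + k ^ 3 + k + 1) := by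
        rw [← pow_add, ← pow_mul, ← pow_add]
        congr 1
        ring
      _ ≤ _ := Nat.pow_le_pow_right (by norm_num) (by omega)
  refine ⟨2 ^ l, hpos, ?_, hu64, ?_, ?_, hκ⟩
  · refine le_trans ?_ hu32
    exact Nat.le_self_pow (by norm_num) _
  · have h4 : 4 ≤ 2 ^ l := by
      calc 4 = 2 ^ 2 := by norm_num
        _ ≤ _ := Nat.pow_le_pow_right (by norm_num) (by omega)
    have hkk : 2 ^ k * 2 ^ k ≤ 2 ^ l := by
      rw [← pow_add]
      exact Nat.pow_le_pow_right (by norm_num) (by omega)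
    obtain ⟨r, hr⟩ : ∃ r, l = k + r := ⟨l - k, by omega⟩
    have hcoef : 2 * (2 * s * span k d * span k d * 2 ^ k * 2 ^ k * n ^ (k + 1)) < 2 ^ 2 ^ r := by
      calc 2 * (2 * s * span k d * span k d * 2 ^ k * 2 ^ k * n ^ (k + 1))
          = 4 * s * span k d * span k d * (2 ^ k * 2 ^ k) * n ^ (k + 1) := by ring
        _ ≤ 2 ^ l * ((2 ^ l) ^ 64) ^ k ^ 2 * 2 ^ l * 2 ^ l * 2 ^ l * ((2 ^ l) ^ 64) ^ (k + 1) := by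
          have := hs.trans (Nat.pow_le_pow_left hu64 _)
          gcongr
        _ = 2 ^ (l * (64 * k ^ 2 + 64 * k + 68)) := by
          simp only [← pow_mul, ← pow_add]
          congr 1
          ring
        _ < _ := by
          refine Nat.pow_lt_pow_right (by norm_num) ?_
          have h5 : 64 * k ^ 2 + 64 * k + 68 ≤ l := by omega
          have h6 : l ≤ 2 * r := by omega
          have h7 := mul_pow_four_le_two_pow (show 40 ≤ r by omega)
          have h8 : l * (64 * k ^ 2 + 64 * k + 68) ≤ (2 * r) * (2 * r) :=
            Nat.mul_le_mul h6 (h5.trans h6)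
          have h9 : r ^ 2 ≤ r ^ 4 := Nat.pow_le_pow_right (by omega) (by norm_num)
          have h10 : 0 < r ^ 2 := Nat.pow_pos (by omega)
          nlinarith
    have hpow : 2 ^ 2 ^ r * (2 ^ k) ^ 2 ^ l ≤ (2 ^ k + 1) ^ 2 ^ l := by
      rw [hr, pow_add 2 k r, pow_mul (2 ^ k) (2 ^ k), pow_mul (2 ^ k + 1) (2 ^ k), ← mul_pow]
      exact Nat.pow_le_pow_left (two_mul_pow_le (by positivity)) _
    exact (Nat.mul_lt_mul_of_pos_right hcoef (by positivity)).trans_le hpow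
  · have hQ : span k d * 2 ^ l * (2 ^ l) ^ 6 ≤ (2 ^ l) ^ 8 := by
      calc _ ≤ 2 ^ l * 2 ^ l * (2 ^ l) ^ 6 := by gcongr
        _ = _ := by ring
    have hk' : 4 * (k + 1) ≤ 2 ^ l := by
      calc _ ≤ 2 ^ 2 * 2 ^ k := by omega
        _ = 2 ^ (2 + k) := (pow_add _ _ _).symm
        _ ≤ _ := Nat.pow_le_pow_right (by norm_num) (by omega)
    calc _ ≤ 2 * ((k + 1) * ((2 ^ l) ^ 8 * (2 ^ l) ^ 8 + (2 ^ l) ^ 8 * (2 ^ l) ^ 8)) := by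
          refine Nat.mul_le_mul_left _ (Nat.mul_le_mul_left _ (Nat.add_le_add
            (Nat.mul_le_mul hQ hQ) (hQ.trans (Nat.le_mul_of_pos_left _ (by positivity)))))
      _ = 4 * (k + 1) * (2 ^ l) ^ 16 := by ring
      _ ≤ 2 ^ l * (2 ^ l) ^ 16 := Nat.mul_le_mul_right _ hk'
      _ = (2 ^ l) ^ 17 := by ring
      _ ≤ (2 ^ l) ^ 32 := Nat.pow_le_pow_right hpos (by norm_num)
      _ ≤ n := hu32

theorem rpow_le_size {n k d : ℕ} (F : AC0 (Fin k × Fin n × Fin n)) (hk : 2 ≤ k)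
    (hkn : (k : ℝ) ≤ Real.logb 2 (Real.logb 2 (n : ℝ))) (hd : 1 ≤ d)
    (hdk : (d : ℝ) ≤ Real.logb 2 (k : ℝ)) (hmono : F.Mono) (hdepth : F.andDepth ≤ d)
    (hfan : F.AndFanInLE ((n : ℝ) ^ (1 / (k : ℝ)))) (hF : ComputesSubPMM n k F) :
    (n : ℝ) ^ (1 / 1000000 * d * (k : ℝ) ^ (1 / (d : ℝ))) ≤ (F.size : ℝ) := by
  have hk0 : (0 : ℝ) < k := by exact_mod_cast (by omega : 0 < k)
  have hd0 : (1 : ℝ) ≤ d := by exact_mod_cast hd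
  have hloglog : (2 : ℝ) ≤ Real.logb 2 (Real.logb 2 (n : ℝ)) :=
    le_trans (by exact_mod_cast hk) hkn
  have hlogpos : 0 < Real.logb 2 (n : ℝ) := by
    refine lt_of_le_of_ne ?_ ?_
    · rcases Nat.eq_zero_or_pos n with rfl | hn
      · simp
      · exact Real.logb_nonneg (by norm_num) (by exact_mod_cast hn)
    · intro h
      rw [← h, Real.logb_zero] at hloglog
      norm_num at hloglog
  have hnpos : 0 < n := by
    rcases Nat.eq_zero_or_pos n with rfl | hn
    · simp at hlogpos
    · exact hn
  have hn1 : (1 : ℝ) ≤ n := by exact_mod_cast hnpos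
  have hn0 : (0 : ℝ) < n := zero_lt_one.trans_le hn1
  have hnk : 2 ^ 2 ^ k ≤ n := by
    rw [Real.le_logb_iff_rpow_le (by norm_num) hlogpos, Real.rpow_natCast,
      Real.le_logb_iff_rpow_le (by norm_num) hn0] at hkn
    have h : ((2 : ℝ) ^ k) = ((2 ^ k : ℕ) : ℝ) := by push_cast; rfl
    rw [h, Real.rpow_natCast] at hkn
    exact_mod_cast hkn
  have h2d : 2 ^ d ≤ k := by
    rw [Real.le_logb_iff_rpow_le (by norm_num) hk0, Real.rpow_natCast] at hdk
    exact_mod_cast hdk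
  have hdk' : d ≤ k := Nat.lt_two_pow_self.le.trans h2d
  obtain ⟨Φ, hΦ⟩ : ∃ Φ : ℝ, Φ = d * (k : ℝ) ^ (1 / (d : ℝ)) := ⟨_, rfl⟩
  have hwin := win_line hk hd hdk
  rw [← hΦ] at hwin
  rw [mul_assoc, ← hΦ]
  have hk1 : (1 : ℝ) ≤ k := by exact_mod_cast (by omega : 1 ≤ k)
  have hΦk : Φ ≤ (k : ℝ) ^ 2 := by
    have h1 : (k : ℝ) ^ (1 / (d : ℝ)) ≤ (k : ℝ) ^ (1 : ℝ) :=
      Real.rpow_le_rpow_of_exponent_le hk1 ((div_le_one (by linarith)).2 hd0)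
    rw [Real.rpow_one] at h1
    rw [hΦ, sq]
    exact mul_le_mul (by exact_mod_cast hdk') h1 (by positivity) (by positivity)
  have hsize : (n : ℝ) ≤ F.size := by exact_mod_cast le_size hk hF
  by_cases hsmall : Φ ≤ 1000000
  · refine le_trans ?_ hsize
    calc (n : ℝ) ^ (1 / 1000000 * Φ) ≤ (n : ℝ) ^ (1 : ℝ) :=
          Real.rpow_le_rpow_of_exponent_le hn1 (by linarith)
      _ = n := Real.rpow_one _
  push Not at hsmall
  have hk1000 : 1000 ≤ k := by
    by_contra hcon
    have : (k : ℝ) ≤ 1000 := by exact_mod_cast (by omega : k ≤ 1000)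
    nlinarith
  by_cases hs : F.size ≤ n ^ k ^ 2
  swap
  · push Not at hs
    have h1 : ((n ^ k ^ 2 : ℕ) : ℝ) ≤ F.size := by exact_mod_cast hs.le
    refine le_trans ?_ h1
    rw [Nat.cast_pow, ← Real.rpow_natCast]
    refine Real.rpow_le_rpow_of_exponent_le hn1 ?_
    push_cast
    linarith
  obtain ⟨u, hu, hun, hnu, h1, h2, hκ⟩ := exists_sample_size hk1000 hdk' hnk hs
  have hu1 : (1 : ℝ) ≤ u := by exact_mod_cast hu
  have hnu' : (n : ℝ) ≤ (u : ℝ) ^ 64 := by exact_mod_cast hnu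
  have hfan' : (n : ℝ) ^ (1 / (k : ℝ)) ≤ u := by
    calc (n : ℝ) ^ (1 / (k : ℝ)) ≤ ((u : ℝ) ^ k) ^ (1 / (k : ℝ)) := by
          refine Real.rpow_le_rpow hn0.le (hnu'.trans ?_) (by positivity)
          exact pow_le_pow_right₀ hu1 (by omega)
      _ = u := by
          rw [one_div]
          exact Real.pow_rpow_inv_natCast (by linarith) (by omega)
  have key := rpow_le_mul_size F (by omega) hmono hdepth (hfan.mono hfan') hF hu hun h1 h2 hwin
  have hκ' : (((k : ℝ) ^ 2 + 1) * 2 ^ k ^ 2) ^ d * 2 ^ (k + 1) ≤ n := by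
    exact_mod_cast hκ.trans hun
  have hlow : (n : ℝ) ^ ((Φ / 768 - 1 / 4) / 64) ≤ (u : ℝ) ^ (Φ / 768 - 1 / 4) := by
    calc (n : ℝ) ^ ((Φ / 768 - 1 / 4) / 64)
        ≤ ((u : ℝ) ^ (64 : ℝ)) ^ ((Φ / 768 - 1 / 4) / 64) := by
          refine Real.rpow_le_rpow hn0.le ?_ (by linarith)
          exact_mod_cast hnu'
      _ = _ := by
          rw [← Real.rpow_mul (by linarith)]
          congr 1
          ring
  have hhigh : (n : ℝ) ^ ((Φ / 768 - 1 / 4) / 64) ≤ F.size * (n : ℝ) ^ 3 := by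
    refine (hlow.trans key).trans ?_
    calc _ = F.size * ((((k : ℝ) ^ 2 + 1) * 2 ^ k ^ 2) ^ d * 2 ^ (k + 1)) * (n : ℝ) ^ 2 := by ring
      _ ≤ F.size * n * (n : ℝ) ^ 2 := by gcongr
      _ = _ := by ring
  have h3 : (0 : ℝ) < (n : ℝ) ^ 3 := by positivity
  refine le_of_mul_le_mul_right (le_trans ?_ hhigh) h3
  rw [← Real.rpow_natCast (n : ℝ) 3, ← Real.rpow_add hn0]
  refine Real.rpow_le_rpow_of_exponent_le hn1 ?_
  push_cast
  linarith

end SubPMM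

/-- **Theorem (tradeoff (I)⁺ for monotone `SAC⁰` formulas).**
There is an absolute constant `c > 0` such that for all `n, k, d` with `2 ≤ k ≤ log₂ log₂ n`
and `1 ≤ d ≤ log₂ k`, every monotone `AC⁰` formula of `⋀`-depth at most `d` and `⋀`-fan-in at
most `n^{1/k}` computing `SUB-PMM_{n,k}` has size at least `n^{c·d·k^{1/d}}`. -/
theorem monotone_SAC0_tradeoff :
    ∃ c : ℝ, 0 < c ∧
      ∀ (n k d : ℕ) (F : AC0 (Fin k × Fin n × Fin n)),
        2 ≤ k → (k : ℝ) ≤ Real.logb 2 (Real.logb 2 (n : ℝ)) →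
        1 ≤ d → (d : ℝ) ≤ Real.logb 2 (k : ℝ) →
        AC0.Mono F → AC0.andDepth F ≤ d →
        AC0.AndFanInLE ((n : ℝ) ^ (1 / (k : ℝ))) F →
        ComputesSubPMM n k F →
        (n : ℝ) ^ (c * d * (k : ℝ) ^ (1 / (d : ℝ))) ≤ (AC0.size F : ℝ) :=
  ⟨1 / 1000000, by norm_num, fun _ _ _ F hk hkn hd hdk hmono hdepth hfan hF =>
    SubPMM.rpow_le_size F hk hkn hd hdk hmono hdepth hfan hF⟩
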